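/- The monoid of pointed homotopy classes of self-maps of ℝP^{2n} (n ≥ 1) under composition is isomorphic to the quotient monoid M = ℤ/~, where x ~ y iff x = y or x ≡ y ≡ 0 mod 4 or x ≡ y ≡ 2 mod 4, with multiplication induced from ℤ. In particular this monoid is commutative and countably infinite, with exactly two classes of even elements. -/

import Mathlib

open Metric

/-- The relation on `ℤ`: `x ~ y` iff `x = y`, or both are `≡ 0 mod 4`,
or both are `≡ 2 mod 4`. -/
def MRel (x y : ℤ) : Prop :=
  x = y ∨ (x % 4 = 0 ∧ y % 4 = 0) ∨ (x % 4 = 2 ∧ y % 4 = 2)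

/-- The quotient `M = ℤ/~`. -/
def MQuot : Type := Quot MRel

/-- Class of an integer in `M`. -/
def MQuot.mk (x : ℤ) : MQuot := Quot.mk MRel x
open Metric

/-- The `N`-sphere, as the unit sphere in `ℝ^{N+1}`. -/
abbrev Sph (N : ℕ) : Type := Metric.sphere (0 : EuclideanSpace ℝ (Fin (N + 1))) 1

/-- A base point of the sphere. -/
noncomputable def Sph.pt (N : ℕ) : Sph N :=
  ⟨EuclideanSpace.single 0 1, by
    simp [mem_sphere_zero_iff_norm, EuclideanSpace.norm_single]⟩

/-- The antipodal map of the sphere. -/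
def Sph.antipode (N : ℕ) : Sph N → Sph N := fun x =>
  ⟨-x.1, by
    rw [mem_sphere_zero_iff_norm, norm_neg, ← mem_sphere_zero_iff_norm]
    exact x.2⟩

/-- An axiomatization of the Brouwer–Hopf mapping degree for self-maps of `S^N`:
a homotopy-invariant complete invariant (Hopf's theorem), multiplicative under
composition, normalized on the identity, realizing every integer, and taking the
value `(-1)^{N+1}` on the antipodal map. -/
structure SphereDegree (N : ℕ) where
  deg : C(Sph N, Sph N) → ℤ
  deg_id : deg (ContinuousMap.id (Sph N)) = 1
  deg_comp : ∀ f g : C(Sph N, Sph N), deg (f.comp g) = deg f * deg g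
  homotopic_iff : ∀ f g : C(Sph N, Sph N), f.Homotopic g ↔ deg f = deg g
  deg_surjective : Function.Surjective deg
  deg_antipode : ∀ h : Continuous (Sph.antipode N),
    deg ⟨Sph.antipode N, h⟩ = (-1) ^ (N + 1)

/-- Real projective `N`-space, as the quotient of `S^N` identifying antipodes. -/
def RP (N : ℕ) : Type := Quot (fun x y : Sph N => y = x ∨ y = Sph.antipode N x)

noncomputable instance (N : ℕ) : TopologicalSpace (RP N) := by unfold RP; infer_instance

/-- The covering projection `p : S^N → ℝP^N`. -/
noncomputable def RP.proj (N : ℕ) : C(Sph N, RP N) := ⟨Quot.mk _, continuous_quot_mk⟩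

/-- Base point of `ℝP^N`. -/
noncomputable def RP.pt (N : ℕ) : RP N := RP.proj N (Sph.pt N)

/-- Pointed self-maps of a pointed space. -/
def PtdSelfMap (X : Type*) [TopologicalSpace X] (x₀ : X) : Type _ :=
  {f : C(X, X) // f x₀ = x₀}

/-- The set of pointed homotopy classes of pointed self-maps of `(X, x₀)`. -/
def PtdSelfMapClass (X : Type*) [TopologicalSpace X] (x₀ : X) : Type _ :=
  Quot (fun f g : PtdSelfMap X x₀ => ContinuousMap.HomotopicRel f.1 g.1 {x₀})

/-- Composition of pointed self-maps. -/
def PtdSelfMap.comp {X : Type*} [TopologicalSpace X] {x₀ : X}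
    (f g : PtdSelfMap X x₀) : PtdSelfMap X x₀ :=
  ⟨f.1.comp g.1, by simp [g.2, f.2]⟩

/-- The identity as a pointed self-map. -/
def PtdSelfMap.id (X : Type*) [TopologicalSpace X] (x₀ : X) : PtdSelfMap X x₀ :=
  ⟨ContinuousMap.id X, rfl⟩

/-- The pointed homotopy class of a pointed self-map. -/
def PtdSelfMapClass.mk {X : Type*} [TopologicalSpace X] {x₀ : X}
    (f : PtdSelfMap X x₀) : PtdSelfMapClass X x₀ :=
  Quot.mk _ f

namespace RPX
open Metric
open Set
set_option linter.unusedSectionVars false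
set_option linter.unusedSimpArgs false
set_option linter.style.longLine false


/-- clamp to `[0,1]` -/
noncomputable def c01 (t : ℝ) : ℝ := max 0 (min 1 t)

lemma continuous_c01 : Continuous c01 := by unfold c01; fun_prop
lemma c01_mem (t : ℝ) : c01 t ∈ Icc (0:ℝ) 1 := ⟨le_max_left _ _, max_le zero_le_one (min_le_left _ _)⟩
lemma c01_nonneg (t : ℝ) : 0 ≤ c01 t := (c01_mem t).1
lemma c01_le_one (t : ℝ) : c01 t ≤ 1 := (c01_mem t).2
lemma c01_of_mem {t : ℝ} (h : t ∈ Icc (0:ℝ) 1) : c01 t = t := by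
  unfold c01; rw [min_eq_right h.2, max_eq_right h.1]
@[simp] lemma c01_zero : c01 0 = 0 := c01_of_mem ⟨le_refl _, zero_le_one⟩
@[simp] lemma c01_one : c01 1 = 1 := c01_of_mem ⟨zero_le_one, le_refl _⟩
lemma c01_of_le {t : ℝ} (h : t ≤ 0) : c01 t = 0 := by
  unfold c01; exact max_eq_left (le_trans (min_le_right _ _) h)
lemma c01_of_ge {t : ℝ} (h : 1 ≤ t) : c01 t = 1 := by
  unfold c01; rw [min_eq_left h, max_eq_right zero_le_one]

section Hom
variable {X Y : Type*} [TopologicalSpace X] [TopologicalSpace Y]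

/-- Homotopy through maps in `A`. -/
def HomIn (A : Set (X → Y)) (f g : X → Y) : Prop :=
  ∃ H : ℝ → X → Y, Continuous (fun p : ℝ × X => H p.1 p.2) ∧
    (∀ t ∈ Icc (0:ℝ) 1, H t ∈ A) ∧ H 0 = f ∧ H 1 = g

lemma HomIn.mono {A B : Set (X → Y)} {f g : X → Y} (h : HomIn A f g) (hAB : A ⊆ B) : HomIn B f g := by
  obtain ⟨H, h1, h2, h3, h4⟩ := h
  exact ⟨H, h1, fun t ht => hAB (h2 t ht), h3, h4⟩

lemma HomIn.refl {A : Set (X → Y)} {f : X → Y} (hf : Continuous f) (hA : f ∈ A) : HomIn A f f :=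
  ⟨fun _ => f, by fun_prop, fun _ _ => hA, rfl, rfl⟩

lemma HomIn.symm {A : Set (X → Y)} {f g : X → Y} (h : HomIn A f g) : HomIn A g f := by
  obtain ⟨H, h1, h2, h3, h4⟩ := h
  refine ⟨fun t => H (1 - t), h1.comp (by fun_prop : Continuous fun p : ℝ × X => (1 - p.1, p.2)),
    fun t ht => h2 _ ⟨by linarith [ht.2], by linarith [ht.1]⟩, by simp [h4], by simp [h3]⟩

lemma HomIn.trans {A : Set (X → Y)} {f g k : X → Y} (h : HomIn A f g) (h' : HomIn A g k) :
    HomIn A f k := by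
  obtain ⟨H, h1, h2, h3, h4⟩ := h
  obtain ⟨K, k1, k2, k3, k4⟩ := h'
  refine ⟨fun t x => if t ≤ 1/2 then H (2*t) x else K (2*t-1) x, ?_, ?_, ?_, ?_⟩
  · refine Continuous.if_le ?_ ?_ (by fun_prop) (by fun_prop) ?_
    · exact h1.comp (by fun_prop : Continuous fun p : ℝ × X => (2*p.1, p.2))
    · exact k1.comp (by fun_prop : Continuous fun p : ℝ × X => (2*p.1-1, p.2))
    · rintro ⟨t, x⟩ h
      simp only at h
      subst h
      norm_num [h4, k3]
  · intro t ht
    by_cases hh : t ≤ 1/2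
    · simp only [hh, if_true]; exact h2 _ ⟨by linarith [ht.1], by linarith⟩
    · simp only [hh, if_false]; exact k2 _ ⟨by linarith [ht.1], by linarith [ht.2]⟩
  · simp [h3]
  · norm_num [k4]

lemma HomIn.left_mem {A : Set (X → Y)} {f g : X → Y} (h : HomIn A f g) : f ∈ A := by
  obtain ⟨H, h1, h2, h3, h4⟩ := h
  exact h3 ▸ h2 0 ⟨le_refl _, zero_le_one⟩
lemma HomIn.right_mem {A : Set (X → Y)} {f g : X → Y} (h : HomIn A f g) : g ∈ A := h.symm.left_mem
lemma HomIn.left_cont {A : Set (X → Y)} {f g : X → Y} (h : HomIn A f g) : Continuous f := by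
  obtain ⟨H, h1, h2, h3, h4⟩ := h
  exact h3 ▸ h1.comp (by fun_prop : Continuous fun x : X => ((0:ℝ), x))
lemma HomIn.right_cont {A : Set (X → Y)} {f g : X → Y} (h : HomIn A f g) : Continuous g := h.symm.left_cont

/-- build from a clamped family -/
lemma HomIn.mk_family {A : Set (X → Y)} (H : ℝ → X → Y) (h1 : Continuous (fun p : ℝ × X => H p.1 p.2))
    (h2 : ∀ t ∈ Icc (0:ℝ) 1, H t ∈ A) : HomIn A (H 0) (H 1) := ⟨H, h1, h2, rfl, rfl⟩

/-- the homotopy can be taken with all times in `A`. -/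
lemma HomIn.exists_clamp {A : Set (X → Y)} {f g : X → Y} (h : HomIn A f g) :
    ∃ H : ℝ → X → Y, Continuous (fun p : ℝ × X => H p.1 p.2) ∧
    (∀ t, H t ∈ A) ∧ (∀ t ≤ 0, H t = f) ∧ (∀ t, 1 ≤ t → H t = g) := by
  obtain ⟨H, h1, h2, h3, h4⟩ := h
  refine ⟨fun t => H (c01 t), h1.comp
    ((continuous_c01.comp continuous_fst).prodMk continuous_snd), fun t => h2 _ (c01_mem t), ?_, ?_⟩
  · intro t ht; simp [c01_of_le ht, h3]
  · intro t ht; simp [c01_of_ge ht, h4]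

variable {Z : Type*} [TopologicalSpace Z] in
lemma HomIn.post {A : Set (X → Y)} {B : Set (X → Z)} {f g : X → Y} (h : HomIn A f g) {G : Y → Z}
    (hG : Continuous G) (hAB : ∀ k ∈ A, G ∘ k ∈ B) : HomIn B (G ∘ f) (G ∘ g) := by
  obtain ⟨H, h1, h2, h3, h4⟩ := h
  exact ⟨fun t => G ∘ H t, hG.comp h1, fun t ht => hAB _ (h2 t ht), by simp [h3], by simp [h4]⟩

variable {Z : Type*} [TopologicalSpace Z] in
lemma HomIn.pre {A : Set (X → Y)} {B : Set (Z → Y)} {f g : X → Y} (h : HomIn A f g) {φ : Z → X}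
    (hφ : Continuous φ) (hAB : ∀ k ∈ A, k ∘ φ ∈ B) : HomIn B (f ∘ φ) (g ∘ φ) := by
  obtain ⟨H, h1, h2, h3, h4⟩ := h
  exact ⟨fun t => H t ∘ φ, h1.comp (by fun_prop : Continuous fun p : ℝ × Z => (p.1, φ p.2)),
    fun t ht => hAB _ (h2 t ht), by simp [h3], by simp [h4]⟩

/-- overlay -/
noncomputable def ov (y0 : Y) (g h : X → Y) : X → Y := by
  classical exact fun x => if g x = y0 then h x else g x

lemma ov_of_left {y0 : Y} {g h : X → Y} {x : X} (hx : g x = y0) : ov y0 g h x = h x := by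
  classical simp [ov, hx]
lemma ov_of_right {y0 : Y} {g h : X → Y} {x : X} (hx : h x = y0) : ov y0 g h x = g x := by
  classical
  by_cases hg : g x = y0
  · rw [ov_of_left hg, hg, hx]
  · simp [ov, hg]

lemma continuous_ov {y0 : Y} {g h : X → Y} (hg : Continuous g) (hh : Continuous h) {K L : Set X}
    (hK : IsClosed K) (hL : IsClosed L) (hKL : ∀ x, x ∈ K ∨ x ∈ L) (hgK : ∀ x ∈ K, g x = y0)
    (hhL : ∀ x ∈ L, h x = y0) : Continuous (ov y0 g h) := by
  have h1 : ContinuousOn (ov y0 g h) K :=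
    hh.continuousOn.congr (fun x hx => ov_of_left (hgK x hx))
  have h2 : ContinuousOn (ov y0 g h) L :=
    hg.continuousOn.congr (fun x hx => ov_of_right (hhL x hx))
  have h3 := h1.union_of_isClosed h2 hK hL
  have : K ∪ L = univ := by ext x; simpa using hKL x
  rw [this] at h3
  exact continuousOn_univ.1 h3

lemma ov_comp_right {Z : Type*} [TopologicalSpace Z] {y0 : Y} {g h : X → Y} {φ : Z → X} :
    ov y0 g h ∘ φ = ov y0 (g ∘ φ) (h ∘ φ) := by
  classical
  ext x; simp [ov]

lemma post_ov {Z : Type*} [TopologicalSpace Z] {y0 : Y} {z0 : Z} {g h : X → Y} {G : Y → Z} (hG : G y0 = z0)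
    (hgh : ∀ x, g x = y0 ∨ h x = y0) :
    G ∘ ov y0 g h = ov z0 (G ∘ g) (G ∘ h) := by
  ext x
  rcases hgh x with hx | hx
  · rw [Function.comp, ov_of_left hx, ov_of_left (by simp [hx, hG])]; rfl
  · rw [Function.comp, ov_of_right hx, ov_of_right (by simp [hx, hG])]; rfl

lemma ov_symm {y0 : Y} {g h : X → Y} (hgh : ∀ x, g x = y0 ∨ h x = y0) : ov y0 g h = ov y0 h g := by
  ext x
  rcases hgh x with hx | hx
  · rw [ov_of_left hx, ov_of_right hx]
  · rw [ov_of_right hx, ov_of_left hx]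

end Hom

section Ball
variable {E Y : Type*} [NormedAddCommGroup E] [NormedSpace ℝ E] [TopologicalSpace Y]

/-- homotopy rel `‖x‖ ≥ 1`. -/
def HR (f g : E → Y) : Prop := HomIn {h : E → Y | ∀ x, 1 ≤ ‖x‖ → h x = f x} f g

lemma HR.refl {f : E → Y} (hf : Continuous f) : HR f f := HomIn.refl hf (fun _ _ => rfl)
lemma HR.eqOn {f g : E → Y} (h : HR f g) : ∀ x, 1 ≤ ‖x‖ → g x = f x := HomIn.right_mem h
lemma HR.symm {f g : E → Y} (h : HR f g) : HR g f :=
  (HomIn.symm h).mono (fun k hk x hx => by rw [hk x hx, h.eqOn x hx])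
lemma HR.trans {f g k : E → Y} (h : HR f g) (h' : HR g k) : HR f k :=
  HomIn.trans h (h'.mono (fun k hk x hx => by rw [hk x hx, h.eqOn x hx]))
lemma HR.left_cont {f g : E → Y} (h : HR f g) : Continuous f := HomIn.left_cont h
lemma HR.right_cont {f g : E → Y} (h : HR f g) : Continuous g := HomIn.right_cont h
lemma HR.of_eq {f g : E → Y} (hf : Continuous f) (h : f = g) : HR f g := h ▸ HR.refl hf

/-- straight line homotopy in the domain -/
lemma HR.line {f : E → Y} (hf : Continuous f) {φ ψ : E → E} (hφ : Continuous φ) (hψ : Continuous ψ)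
    (h : ∀ x, 1 ≤ ‖x‖ → φ x = ψ x) : HR (f ∘ φ) (f ∘ ψ) := by
  refine ⟨fun t x => f ((1 - t) • φ x + t • ψ x), by fun_prop, ?_, by ext; simp, by ext; simp⟩
  intro t _ x hx
  simp only [Function.comp, ← h x hx, ← add_smul]
  simp

lemma HR.post {Z : Type*} [TopologicalSpace Z] {f g : E → Y} (h : HR f g) {G : Y → Z} (hG : Continuous G) :
    HR (G ∘ f) (G ∘ g) := HomIn.post h hG (fun k hk x hx => by simp [hk x hx])

/-- from a family -/
lemma HR.family (H : ℝ → E → Y) (h1 : Continuous (fun p : ℝ × E => H p.1 p.2))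
    (h2 : ∀ t ∈ Icc (0:ℝ) 1, ∀ x, 1 ≤ ‖x‖ → H t x = H 0 x) : HR (H 0) (H 1) :=
  ⟨H, h1, fun t ht => h2 t ht, rfl, rfl⟩

/-- a member of the class of ball maps -/
def IsBall (y0 : Y) (f : E → Y) : Prop := Continuous f ∧ ∀ x, 1 ≤ ‖x‖ → f x = y0

lemma HR.isBall {y0 : Y} {f g : E → Y} (h : HR f g) (hf : IsBall y0 f) : IsBall y0 g :=
  ⟨h.right_cont, fun x hx => by rw [h.eqOn x hx, hf.2 x hx]⟩

lemma isBall_const (y0 : Y) : IsBall y0 (fun _ : E => y0) := ⟨continuous_const, fun _ _ => rfl⟩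

/-- `κ` -/
noncomputable def kap (x : E) : ℝ := c01 (2 - 2 * ‖x‖)
/-- `û` -/
noncomputable def uh (x : E) : E := (max (1/2) (min 1 ‖x‖))⁻¹ • x

lemma cl_pos (x : E) : 0 < max (1/2:ℝ) (min 1 ‖x‖) := lt_of_lt_of_le (by norm_num) (le_max_left _ _)

@[fun_prop] lemma continuous_kap : Continuous (kap : E → ℝ) :=
  continuous_c01.comp (by fun_prop)
@[fun_prop] lemma continuous_uh : Continuous (uh : E → E) := by
  unfold uh
  exact (Continuous.inv₀ (by fun_prop) (fun x => (cl_pos x).ne')).smul continuous_id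

lemma kap_in {x : E} (h : ‖x‖ ≤ 1/2) : kap x = 1 := c01_of_ge (by linarith)
lemma kap_out {x : E} (h : 1 ≤ ‖x‖) : kap x = 0 := c01_of_le (by linarith)
lemma uh_in {x : E} (h : ‖x‖ ≤ 1/2) : uh x = (2:ℝ) • x := by
  unfold uh; rw [min_eq_right (by linarith), max_eq_left h]; norm_num
lemma uh_out {x : E} (h : 1 ≤ ‖x‖) : uh x = x := by
  unfold uh; rw [min_eq_left h, max_eq_right (by norm_num)]; simp
lemma uh_mid {x : E} (h : 1/2 ≤ ‖x‖) (h' : ‖x‖ ≤ 1) : uh x = ‖x‖⁻¹ • x := by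
  unfold uh; rw [min_eq_right h', max_eq_right h]
lemma norm_uh_mid {x : E} (h : 1/2 ≤ ‖x‖) (h' : ‖x‖ ≤ 1) : ‖uh x‖ = 1 := by
  rw [uh_mid h h', norm_smul, norm_inv, norm_norm, inv_mul_cancel₀]; linarith

/-- `q_p` -/
noncomputable def qm (p x : E) : E := (1 - kap x) • uh x + kap x • p

lemma continuous_qm2 : Continuous (fun z : E × E => qm z.1 z.2) := by
  unfold qm; fun_prop
lemma continuous_qm (p : E) : Continuous (qm p) := by unfold qm; fun_prop
lemma qm_in {p x : E} (h : ‖x‖ ≤ 1/2) : qm p x = p := by simp [qm, kap_in h]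
lemma qm_out {p x : E} (h : 1 ≤ ‖x‖) : qm p x = x := by simp [qm, kap_out h, uh_out h]

lemma qm_ray {v : E} (hv : ‖v‖ = 1) {s : ℝ} (hs : s ∈ Icc (0:ℝ) 1) : qm v (s • v) = v := by
  have hn : ‖s • v‖ = s := by rw [norm_smul, hv, mul_one, Real.norm_of_nonneg hs.1]
  rcases le_total s (1/2) with h | h
  · exact qm_in (by rw [hn]; exact h)
  · have : uh (s • v) = v := by
      rw [uh_mid (by rw [hn]; exact h) (by rw [hn]; exact hs.2), hn, smul_smul, inv_mul_cancel₀, one_smul]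
      linarith
    rw [qm, this, ← add_smul]; simp

/-- action of ball maps -/
noncomputable def star (y0 : Y) (v : E) (F β : E → Y) : E → Y :=
  ov y0 (F ∘ qm v) (fun x => β ((2:ℝ) • x))

variable {y0 : Y} {v : E}

lemma star_in {F β : E → Y} (hF : F v = y0) {x : E} (hx : ‖x‖ ≤ 1/2) : star y0 v F β x = β ((2:ℝ) • x) :=
  ov_of_left (by simp [qm_in hx, hF])

lemma IsBall.two {β : E → Y} (hβ : IsBall y0 β) {x : E} (hx : 1/2 ≤ ‖x‖) : β ((2:ℝ) • x) = y0 :=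
  hβ.2 _ (by rw [norm_smul]; norm_num; linarith)

lemma star_out {F β : E → Y} (hβ : IsBall y0 β) {x : E} (hx : 1/2 ≤ ‖x‖) :
    star y0 v F β x = F (qm v x) :=
  ov_of_right (hβ.two hx)

lemma star_bd {F β : E → Y} (hβ : IsBall y0 β) {x : E} (hx : 1 ≤ ‖x‖) :
    star y0 v F β x = F x := by
  rw [star_out hβ (by linarith), qm_out hx]

lemma continuous_star {F β : E → Y} (hF : Continuous F) (hv : F v = y0) (hβ : IsBall y0 β) :
    Continuous (star y0 v F β) := by
  refine continuous_ov (hF.comp (continuous_qm v)) (hβ.1.comp (by fun_prop)) (K := {x | ‖x‖ ≤ 1/2})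
    (L := {x | 1/2 ≤ ‖x‖}) (isClosed_le (by fun_prop) (by fun_prop))
    (isClosed_le (by fun_prop) (by fun_prop)) (fun x => by simp only [mem_ofPred_eq]; exact le_total _ _) ?_ ?_
  · intro x hx; simp [qm_in hx, hv]
  · intro x hx; exact hβ.two hx

lemma IsBall.star {F β : E → Y} (hF : IsBall y0 F) (hv : ‖v‖ = 1) (hβ : IsBall y0 β) :
    IsBall y0 (star y0 v F β) :=
  ⟨continuous_star hF.1 (hF.2 v hv.ge) hβ, fun x hx => by rw [star_bd hβ hx, hF.2 x hx]⟩

lemma star_v {F β : E → Y} (hv : ‖v‖ = 1) (hF : F v = y0) (hβ : IsBall y0 β) : star y0 v F β v = y0 := by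
  rw [star_bd hβ hv.ge, hF]

lemma post_star {Z : Type*} [TopologicalSpace Z] {z0 : Z} {F β : E → Y} (hF : F v = y0) (hβ : IsBall y0 β)
    {G : Y → Z} (hG : G y0 = z0) : G ∘ star y0 v F β = star z0 v (G ∘ F) (G ∘ β) := by
  refine post_ov hG (fun x => ?_)
  rcases le_total ‖x‖ (1/2) with h | h
  · left; simp [qm_in h, hF]
  · right; exact hβ.two h

/-- general homotopy of stars -/
lemma star_homIn {A B : Set (E → Y)} {F F' β β' : E → Y} (hF : HomIn A F F') (hA : ∀ k ∈ A, k v = y0)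
    (hβ : HR β β') (hb : IsBall y0 β)
    (hB : ∀ k ∈ A, ∀ γ, IsBall y0 γ → star y0 v k γ ∈ B) :
    HomIn B (star y0 v F β) (star y0 v F' β') := by
  obtain ⟨H, h1, h2, h3, h4⟩ := hF.exists_clamp
  obtain ⟨K, k1, k2, k3, k4⟩ := HomIn.exists_clamp hβ
  have k2' : ∀ t x, 1 ≤ ‖x‖ → K t x = y0 := fun t x hx => by rw [k2 t x hx, hb.2 x hx]
  refine ⟨fun t => star y0 v (H t) (K t), ?_, ?_, by simp [h3, k3], by simp [h4, k4]⟩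
  · have : (fun p : ℝ × E => star y0 v (H p.1) (K p.1) p.2) =
      ov y0 (fun p : ℝ × E => H p.1 (qm v p.2)) (fun p : ℝ × E => K p.1 ((2:ℝ) • p.2)) := by
      classical
      ext p; simp [star, ov]
    rw [this]
    refine continuous_ov (h1.comp (continuous_fst.prodMk ((continuous_qm v).comp continuous_snd)))
      (k1.comp (by fun_prop : Continuous fun p : ℝ × E => (p.1, (2:ℝ) • p.2)))
      (K := {p | ‖p.2‖ ≤ 1/2})
      (L := {p | 1/2 ≤ ‖p.2‖}) (isClosed_le (by fun_prop) (by fun_prop))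
      (isClosed_le (by fun_prop) (by fun_prop)) (fun x => by simp only [mem_ofPred_eq]; exact le_total _ _) ?_ ?_
    · intro p hp; simp only [mem_ofPred_eq] at hp; simp [qm_in hp, hA _ (h2 p.1)]
    · intro p hp; simp only [mem_ofPred_eq] at hp
      exact k2' _ _ (by rw [norm_smul]; norm_num; linarith)
  · intro t _
    exact hB _ (h2 t) _ ⟨k1.comp (by fun_prop : Continuous fun x : E => (t, x)), k2' t⟩

lemma star_HR {F F' β β' : E → Y} (hv : ‖v‖ = 1) (hF : HR F F') (hFv : F v = y0)
    (hβ : HR β β') (hb : IsBall y0 β) : HR (star y0 v F β) (star y0 v F' β') := by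
  refine star_homIn hF (fun k hk => by rw [hk v hv.ge, hFv]) hβ hb ?_
  intro k hk γ hγ x hx
  rw [star_bd hγ hx, star_bd hb hx, hk x hx]

/-- the peel lemma -/
lemma peel {g h : E → Y} (hg : Continuous g) (hh : Continuous h) {p : E} {σ : ℝ} (hσ : 0 < σ)
    (hσp : σ ≤ 1 - ‖p‖) (hgp : ∀ x, ‖x - p‖ ≤ σ → g x = y0) (hhp : ∀ x, σ ≤ ‖x - p‖ → h x = y0)
    {γ : ℝ → E} (hγ : Continuous γ) (hγ0 : γ 0 = p) (hγ1 : γ 1 = v)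
    (hgγ : ∀ t ∈ Icc (0:ℝ) 1, g (γ t) = y0) :
    HR (ov y0 g h) (star y0 v g (fun x => h (p + σ • x))) := by
  have hc : Continuous (ov y0 g h) := continuous_ov hg hh (K := {x | ‖x - p‖ ≤ σ}) (L := {x | σ ≤ ‖x - p‖})
    (isClosed_le (by fun_prop) (by fun_prop)) (isClosed_le (by fun_prop) (by fun_prop))
    (fun x => by simp only [mem_ofPred_eq]; exact le_total _ _) hgp hhp
  set φ : ℝ → E → E := fun s x => (1 - kap x) • uh x + kap x • (p + (s * σ) • uh x) with hφ
  have hφc : Continuous (fun z : ℝ × E => φ z.1 z.2) := by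
    simp only [hφ]; fun_prop
  have hφc1 : ∀ s, Continuous (φ s) := fun s => hφc.comp (by fun_prop : Continuous fun x : E => (s, x))
  have hφout : ∀ s x, 1 ≤ ‖x‖ → φ s x = x := by
    intro s x hx; simp [hφ, kap_out hx, uh_out hx]
  set β2 : E → Y := fun x => h (p + σ • ((2:ℝ) • x)) with hβ2
  have hβ2c : Continuous β2 := hh.comp (by fun_prop)
  have hβ2out : ∀ x, 1/2 ≤ ‖x‖ → β2 x = y0 := by
    intro x hx
    refine hhp _ ?_
    rw [add_sub_cancel_left, norm_smul, norm_smul, Real.norm_of_nonneg hσ.le]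
    norm_num
    nlinarith
  -- step 1
  have s1 : HR (ov y0 g h) (ov y0 g h ∘ φ 1) := by
    have := HR.line hc continuous_id (hφc1 1) (fun x hx => (hφout 1 x hx).symm)
    simpa using this
  have e1 : ov y0 g h ∘ φ 1 = ov y0 (g ∘ φ 1) β2 := by
    rw [ov_comp_right]
    congr 1
    ext x
    rcases le_total ‖x‖ (1/2) with hx | hx
    · simp only [Function.comp, hβ2, hφ, kap_in hx, uh_in hx]
      simp
    · rw [hβ2out x hx]
      refine hhp _ ?_
      rcases le_total 1 ‖x‖ with hx1 | hx1
      · rw [hφout 1 x hx1]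
        have := norm_sub_norm_le x p
        linarith
      · have hu := norm_uh_mid hx hx1
        obtain ⟨l, hl, hlu⟩ := exists_dual_vector ℝ (uh x) (by rw [hu]; norm_num)
        have hlu' : l (uh x) = 1 := by rw [hlu, hu]; simp
        have hb : l (φ 1 x - p) ≤ ‖φ 1 x - p‖ := by
          refine le_trans (le_abs_self _) ?_
          have := l.le_opNorm (φ 1 x - p)
          rwa [hl, one_mul] at this
        have hlp : l p ≤ ‖p‖ := by
          refine le_trans (le_abs_self _) ?_
          have := l.le_opNorm p
          rwa [hl, one_mul] at this
        refine le_trans ?_ hb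
        have e : φ 1 x - p = (1 - kap x) • (uh x - p) + (kap x * σ) • uh x := by
          simp only [hφ, one_mul]
          module
        rw [e, map_add, map_smul, map_smul, map_sub, hlu']
        simp only [smul_eq_mul]
        have k0 : 0 ≤ kap x := c01_nonneg _
        have k1 : kap x ≤ 1 := c01_le_one _
        nlinarith
  -- step 2 and 3 : a common lemma
  have key : ∀ P : ℝ → E → E, Continuous (fun z : ℝ × E => P z.1 z.2) →
      (∀ t ∈ Icc (0:ℝ) 1, ∀ x, ‖x‖ ≤ 1/2 → g (P t x) = y0) → (∀ t x, 1 ≤ ‖x‖ → P t x = x) →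
      HR (ov y0 (g ∘ P 0) β2) (ov y0 (g ∘ P 1) β2) := by
    intro P hP hP1 hP2
    have hfam := HR.family (fun t => ov y0 (g ∘ P (c01 t)) β2) ?_ ?_
    · simpa using hfam
    · have : (fun z : ℝ × E => ov y0 (g ∘ P (c01 z.1)) β2 z.2) =
        ov y0 (fun z : ℝ × E => g (P (c01 z.1) z.2)) (fun z => β2 z.2) := by
        classical
        ext p; simp [ov]
      rw [this]
      refine continuous_ov (hg.comp (hP.comp ((continuous_c01.comp continuous_fst).prodMk continuous_snd)))
        (hβ2c.comp continuous_snd) (K := {p | ‖p.2‖ ≤ 1/2})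
        (L := {p | 1/2 ≤ ‖p.2‖}) (isClosed_le (by fun_prop) (by fun_prop))
        (isClosed_le (by fun_prop) (by fun_prop)) (fun x => by simp only [mem_ofPred_eq]; exact le_total _ _) ?_ ?_
      · intro z hz; exact hP1 _ (c01_mem _) _ hz
      · intro z hz; exact hβ2out _ hz
    · intro t _ x hx
      have hb := hβ2out x (by linarith)
      simp only [ov_of_right hb, Function.comp, hP2 _ x hx]
  have s2 : HR (ov y0 (g ∘ φ 1) β2) (ov y0 (g ∘ φ 0) β2) := by
    have := key (fun t => φ (1 - t)) (hφc.comp (by fun_prop : Continuous fun z : ℝ × E => (1 - z.1, z.2))) ?_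
      (fun t x hx => hφout _ x hx)
    · simpa using this
    · intro t ht x hx
      refine hgp _ ?_
      simp only [hφ, kap_in hx, uh_in hx]
      have : (1 - 1 : ℝ) • (2:ℝ) • x + (1:ℝ) • (p + ((1 - t) * σ) • (2:ℝ) • x) - p = ((1-t) * σ * 2) • x := by
        module
      rw [this, norm_smul, Real.norm_of_nonneg (mul_nonneg (mul_nonneg (by linarith [ht.2]) hσ.le) (by norm_num))]
      have h1 : (1 - t) * σ ≤ σ := by nlinarith [ht.1]
      have h2 : 0 ≤ (1 - t) * σ := mul_nonneg (by linarith [ht.2]) hσ.le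
      nlinarith [norm_nonneg x]
  have s3 : HR (ov y0 (g ∘ φ 0) β2) (ov y0 (g ∘ qm v) β2) := by
    have := key (fun t => qm (γ t)) (continuous_qm2.comp ((hγ.comp continuous_fst).prodMk continuous_snd)) ?_
      (fun t x hx => qm_out hx)
    · have e : φ 0 = qm p := by ext x; simp [hφ, qm]
      simpa [hγ0, hγ1, e] using this
    · intro t ht x hx
      simp only [qm_in hx]
      exact hgγ t ht
  rw [e1] at s1
  exact (s1.trans s2).trans s3

end Ball

end RPX

namespace RPX
open Metric
open Set
set_option linter.unusedSectionVars false
set_option linter.unusedSimpArgs false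
set_option linter.style.longLine false


section Ball2
variable {E Y : Type*} [NormedAddCommGroup E] [NormedSpace ℝ E] [TopologicalSpace Y]
variable {y0 : Y} {v : E}

lemma ov_assoc {X : Type*} {Y : Type*} [TopologicalSpace X] [TopologicalSpace Y] {y0 : Y} (f g h : X → Y) :
    ov y0 f (ov y0 g h) = ov y0 (ov y0 f g) h := by
  classical
  ext x
  by_cases h1 : f x = y0
  · simp [ov, h1]
  · simp [ov, h1]

lemma star_const {F : E → Y} (hF : Continuous F) : HR (star y0 v F (fun _ => y0)) F := by
  have e : star y0 v F (fun _ => y0) = F ∘ qm v := by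
    ext x; exact ov_of_right rfl
  rw [e]
  exact HR.line hF (continuous_qm v) continuous_id (fun x hx => qm_out hx)

lemma IsBall.scale {β : E → Y} (hβ : IsBall y0 β) {c : ℝ} (hc : 1 ≤ c) : HR (fun x => β (c • x)) β := by
  have hf := HR.family (fun t x => β ((1 + (1 - c01 t) * (c - 1)) • x)) ?_ ?_
  · simpa using hf
  · have := continuous_c01
    have := hβ.1
    fun_prop
  · have key : ∀ t (x : E), 1 ≤ ‖x‖ → β ((1 + (1 - c01 t) * (c - 1)) • x) = y0 := by
      intro t x hx
      refine hβ.2 _ ?_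
      rw [norm_smul]
      have h1 : 1 ≤ 1 + (1 - c01 t) * (c - 1) := by nlinarith [c01_le_one t]
      rw [Real.norm_of_nonneg (by linarith)]
      nlinarith
    intro t _ x hx
    rw [key t x hx, key 0 x hx]

lemma IsBall.comp_scale {β : E → Y} (hβ : IsBall y0 β) {c : ℝ} (hc : 1 ≤ c) : IsBall y0 (fun x => β (c • x)) :=
  ⟨hβ.1.comp (by fun_prop), fun x hx => hβ.2 _ (by
    rw [norm_smul, Real.norm_of_nonneg (by linarith)]; nlinarith)⟩

lemma const_star {β : E → Y} (hβ : IsBall y0 β) : HR (star y0 v (fun _ => y0) β) β := by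
  have e : star y0 v (fun _ => y0) β = fun x => β ((2:ℝ) • x) := by
    ext x; exact ov_of_left rfl
  rw [e]
  exact hβ.scale (by norm_num)

lemma ball_qm {α : E → Y} (hα : IsBall y0 α) : IsBall y0 (α ∘ qm v) :=
  ⟨hα.1.comp (continuous_qm v), fun x hx => by simp [qm_out hx, hα.2 x hx]⟩

lemma HR_qm {α : E → Y} (hα : Continuous α) : HR (α ∘ qm v) α :=
  HR.line hα (continuous_qm v) continuous_id (fun x hx => qm_out hx)

lemma norm_ray (hv : ‖v‖ = 1) {t : ℝ} (ht : 0 ≤ t) : ‖t • v‖ = t := by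
  rw [norm_smul, hv, mul_one, Real.norm_of_nonneg ht]

lemma star_assoc (hv : ‖v‖ = 1) {F α β : E → Y} (hF : Continuous F) (hFv : F v = y0)
    (hα : IsBall y0 α) (hβ : IsBall y0 β) :
    HR (star y0 v (star y0 v F α) β) (star y0 v F (star y0 v α β)) := by
  set g := star y0 v F (α ∘ qm v) with hg
  have hgc : Continuous g := continuous_star hF hFv (ball_qm hα)
  have hαv : α v = y0 := hα.2 v hv.ge
  have e : star y0 v F (star y0 v α β) = ov y0 g (fun x => β ((4:ℝ) • x)) := by
    rw [hg]; unfold star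
    rw [← ov_assoc]
    congr 1
    ext x
    have : (4:ℝ) • x = (2:ℝ) • (2:ℝ) • x := by rw [smul_smul]; norm_num
    classical
    simp only [ov, Function.comp, this]
  have hp := peel (y0 := y0) (v := v) (g := g) (h := fun x => β ((4:ℝ) • x)) hgc (hβ.1.comp (by fun_prop))
    (p := 0) (σ := 1/4) (by norm_num) (by norm_num) ?_ ?_ (γ := fun t => t • v) (by fun_prop) (by simp) (by simp) ?_
  · have e2 : (fun x : E => β ((4:ℝ) • ((0:E) + (1/4:ℝ) • x))) = β := by
      ext x; congr 1; module
    rw [e2, ← e] at hp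
    refine HR.symm (hp.trans ?_)
    exact star_HR hv (star_HR hv (HR.refl hF) hFv (HR_qm hα.1) (ball_qm hα))
      (star_v hv hFv (ball_qm hα)) (HR.refl hβ.1) hβ
  · intro x hx
    rw [sub_zero] at hx
    rw [hg, star_in hFv (by linarith)]
    have : ‖(2:ℝ) • x‖ ≤ 1/2 := by rw [norm_smul]; norm_num; linarith
    simp [qm_in this, hαv]
  · intro x hx
    rw [sub_zero] at hx
    refine hβ.2 _ ?_
    rw [norm_smul]; norm_num; linarith
  · intro t ht
    rcases le_total t (1/2) with h | h
    · rw [hg, star_in hFv (by rw [norm_ray hv ht.1]; exact h)]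
      rw [smul_smul, Function.comp, qm_ray hv ⟨by linarith [ht.1], by linarith⟩, hαv]
    · rw [hg, star_out (ball_qm hα) (by rw [norm_ray hv ht.1]; exact h), qm_ray hv ht, hFv]

/-- tent map -/
noncomputable def tent (v x : E) : E := kap x • uh x + (1 - kap x) • v

lemma continuous_tent : Continuous (tent v) := by unfold tent; fun_prop
lemma tent_in {x : E} (h : ‖x‖ ≤ 1/2) : tent v x = (2:ℝ) • x := by simp [tent, kap_in h, uh_in h]
lemma tent_out {x : E} (h : 1 ≤ ‖x‖) : tent v x = v := by simp [tent, kap_out h]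

/-- difference element -/
noncomputable def dif (v : E) (f f' : E → Y) (x : E) : Y :=
  if ‖x‖ ≤ 1/2 then f' ((2:ℝ) • x) else f (tent v x)

lemma dif_in {f f' : E → Y} {x : E} (h : ‖x‖ ≤ 1/2) : dif v f f' x = f' ((2:ℝ) • x) := by simp only [dif, h, if_true]
lemma dif_out {f f' : E → Y} (hff : ∀ x, 1 ≤ ‖x‖ → f' x = f x) {x : E} (h : 1/2 ≤ ‖x‖) :
    dif v f f' x = f (tent v x) := by
  rcases eq_or_lt_of_le h with h1 | h1
  · rw [dif_in h1.ge, tent_in h1.ge, hff]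
    rw [norm_smul, ← h1]; norm_num
  · simp only [dif, not_le.2 h1, if_false]

lemma dif_isBall {f f' : E → Y} (hf : Continuous f) (hf' : Continuous f')
    (hff : ∀ x, 1 ≤ ‖x‖ → f' x = f x) (hv : f v = y0) : IsBall y0 (dif v f f') := by
  constructor
  · unfold dif
    refine Continuous.if_le (hf'.comp (by fun_prop)) (hf.comp continuous_tent) (by fun_prop) (by fun_prop) ?_
    intro x hx
    rw [tent_in hx.le, hff]
    rw [norm_smul, hx]; norm_num
  · intro x hx
    rw [dif_out hff (by linarith), tent_out hx, hv]

lemma dif_HR {f f' f'' : E → Y} (hf : Continuous f) (hff : ∀ x, 1 ≤ ‖x‖ → f' x = f x)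
    (h : HR f' f'') : HR (dif v f f') (dif v f f'') := by
  obtain ⟨H, h1, h2, h3, h4⟩ := HomIn.exists_clamp h
  have hfam := HR.family (fun t => dif v f (H t)) ?_ ?_
  · simpa [h3 0 le_rfl, h4 1 le_rfl] using hfam
  · unfold dif
    refine Continuous.if_le (h1.comp (by fun_prop : Continuous fun z : ℝ × E => (z.1, (2:ℝ) • z.2)))
      (hf.comp (continuous_tent.comp continuous_snd)) (by fun_prop) (by fun_prop) ?_
    intro x hx
    have : 1 ≤ ‖(2:ℝ) • x.2‖ := by rw [norm_smul, hx]; norm_num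
    rw [tent_in hx.le, h2 _ _ this, hff _ this]
  · intro t _ x hx
    have : ∀ t, ∀ x, 1 ≤ ‖x‖ → H t x = f x := fun t x hx => by rw [h2 t x hx, hff x hx]
    rw [dif_out (this _) (by linarith), dif_out (this _) (by linarith)]

lemma tent_ray (hv : ‖v‖ = 1) {t : ℝ} (h : 1/2 ≤ t) (h1 : t ≤ 1) : tent v (t • v) = v := by
  have hn := norm_ray hv (show 0 ≤ t by linarith)
  have : uh (t • v) = v := by
    rw [uh_mid (by rw [hn]; exact h) (by rw [hn]; exact h1), hn, smul_smul, inv_mul_cancel₀, one_smul]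
    linarith
  rw [tent, this, ← add_smul]; simp

lemma dif_star (hv : ‖v‖ = 1) {f β : E → Y} (hf : Continuous f) (hfv : f v = y0) (hβ : IsBall y0 β) :
    HR (dif v f (star y0 v f β)) β := by
  have hfq : ∀ x, 1 ≤ ‖x‖ → (f ∘ qm v) x = f x := fun x hx => by simp [qm_out hx]
  set g := dif v f (f ∘ qm v) with hg
  have hgb : IsBall y0 g := dif_isBall hf (hf.comp (continuous_qm v)) hfq hfv
  have e : dif v f (star y0 v f β) = ov y0 g (fun x => β ((4:ℝ) • x)) := by
    ext x
    rcases le_total ‖x‖ (1/2) with h | h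
    · have : (4:ℝ) • x = (2:ℝ) • (2:ℝ) • x := by rw [smul_smul]; norm_num
      rw [dif_in h]
      classical
      simp only [ov, star, Function.comp, this, hg, dif_in h]
    · rw [dif_out (fun x hx => star_bd hβ hx) h, ov_of_right, hg, dif_out hfq h]
      refine hβ.2 _ ?_
      rw [norm_smul]; norm_num; linarith
  have hp := peel (y0 := y0) (v := v) (g := g) (h := fun x => β ((4:ℝ) • x)) hgb.1 (hβ.1.comp (by fun_prop))
    (p := 0) (σ := 1/4) (by norm_num) (by norm_num) ?_ ?_ (γ := fun t => t • v) (by fun_prop) (by simp) (by simp) ?_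
  · have e2 : (fun x : E => β ((4:ℝ) • ((0:E) + (1/4:ℝ) • x))) = β := by
      ext x; congr 1; module
    rw [e2, ← e] at hp
    refine hp.trans ?_
    have h1 : HR g (dif v f f) := dif_HR hf hfq (HR_qm hf)
    have h2 : dif v f f = f ∘ tent v := by
      ext x
      rcases le_total ‖x‖ (1/2) with h | h
      · rw [dif_in h, Function.comp, tent_in h]
      · rw [dif_out (fun _ _ => rfl) h]; rfl
    have h3 : HR (f ∘ tent v) (f ∘ fun _ => v) :=
      HR.line hf continuous_tent continuous_const (fun x hx => tent_out hx)
    have h4 : (f ∘ fun _ : E => v) = fun _ => y0 := by ext; simp [hfv]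
    rw [h4, ← h2] at h3
    exact (star_HR hv (h1.trans h3) (hgb.2 v hv.ge) (HR.refl hβ.1) hβ).trans (const_star hβ)
  · intro x hx
    rw [sub_zero] at hx
    rw [hg, dif_in (by linarith)]
    have : ‖(2:ℝ) • x‖ ≤ 1/2 := by rw [norm_smul]; norm_num; linarith
    simp [qm_in this, hfv]
  · intro x hx
    rw [sub_zero] at hx
    refine hβ.2 _ ?_
    rw [norm_smul]; norm_num; linarith
  · intro t ht
    rcases le_total t (1/2) with h | h
    · rw [hg, dif_in (by rw [norm_ray hv ht.1]; exact h)]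
      rw [smul_smul, Function.comp, qm_ray hv ⟨by linarith [ht.1], by linarith⟩, hfv]
    · rw [hg, dif_out hfq (by rw [norm_ray hv ht.1]; exact h), tent_ray hv h ht.2, hfv]

lemma star_free (hv : ‖v‖ = 1) {f β β' : E → Y} (hf : Continuous f) (hfv : f v = y0) (hβ : IsBall y0 β)
    (hβ' : IsBall y0 β') (h : HR (star y0 v f β) (star y0 v f β')) : HR β β' :=
  ((dif_star hv hf hfv hβ).symm.trans (dif_HR hf (fun x hx => star_bd hβ hx) h)).trans (dif_star hv hf hfv hβ')

lemma torsor {f f' : E → Y} (hf : Continuous f) (hf' : Continuous f') (hfv : f v = y0)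
    (hff : ∀ x, 1 ≤ ‖x‖ → f' x = f x) : HR f' (star y0 v f (dif v f f')) := by
  have hb := dif_isBall hf hf' hff hfv
  set τ : E → E := fun x => if ‖x‖ ≤ 1/2 then tent v ((2:ℝ) • x) else qm v x with hτ
  set uu : E → E := fun x => (max (1/4) (min 1 ‖x‖))⁻¹ • x with huu
  have hτc : Continuous τ := by
    refine Continuous.if_le (continuous_tent.comp (by fun_prop)) (continuous_qm v) (by fun_prop) (by fun_prop) ?_
    intro x hx
    rw [qm_in hx.le, tent_out]
    rw [norm_smul, hx]; norm_num
  have huc : Continuous uu := by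
    refine (Continuous.inv₀ (by fun_prop) (fun x => ?_)).smul continuous_id
    exact (lt_of_lt_of_le (by norm_num : (0:ℝ) < 1/4) (le_max_left _ _)).ne'
  have huin : ∀ x : E, ‖x‖ ≤ 1/4 → uu x = (4:ℝ) • x := by
    intro x hx
    simp only [huu]
    rw [min_eq_right (by linarith), max_eq_left hx]; norm_num
  have huout : ∀ x : E, 1 ≤ ‖x‖ → uu x = x := by
    intro x hx
    simp only [huu]
    rw [min_eq_left hx, max_eq_right (by norm_num)]; simp
  have hunorm : ∀ x : E, 1/4 ≤ ‖x‖ → 1 ≤ ‖uu x‖ := by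
    intro x hx
    rcases le_total 1 ‖x‖ with h | h
    · rw [huout x h]; exact h
    · simp only [huu]
      rw [min_eq_right h, max_eq_right hx, norm_smul, norm_inv, norm_norm, inv_mul_cancel₀]; linarith
  have hτin : ∀ x : E, ‖x‖ ≤ 1/4 → τ x = (4:ℝ) • x := by
    intro x hx
    simp only [hτ]
    rw [if_pos (by linarith), tent_in (by rw [norm_smul]; norm_num; linarith), smul_smul]; norm_num
  have hτout : ∀ x : E, 1 ≤ ‖x‖ → τ x = x := by
    intro x hx
    simp only [hτ]
    rw [if_neg (by linarith), qm_out hx]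
  have hfam := HR.family (fun t x => if ‖x‖ ≤ 1/4 then f' ((4:ℝ) • x) else f ((1 - t) • τ x + t • uu x)) ?_ ?_
  · have e0 : (fun x => if ‖x‖ ≤ 1/4 then f' ((4:ℝ) • x) else f ((1 - (0:ℝ)) • τ x + (0:ℝ) • uu x)) =
        star y0 v f (dif v f f') := by
      ext x
      split_ifs with h
      · rw [star_in hfv (by linarith), dif_in (by rw [norm_smul]; norm_num; linarith), smul_smul]; norm_num
      · simp only [sub_zero, one_smul, zero_smul, add_zero, hτ]
        split_ifs with h2
        · rw [star_in hfv h2, dif_out hff (by rw [norm_smul]; norm_num; linarith)]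
        · rw [star_out hb (by linarith)]
    have e1 : (fun x => if ‖x‖ ≤ 1/4 then f' ((4:ℝ) • x) else f ((1 - (1:ℝ)) • τ x + (1:ℝ) • uu x)) =
        f' ∘ uu := by
      ext x
      split_ifs with h
      · simp [huin x h]
      · simp only [sub_self, zero_smul, one_smul, zero_add, Function.comp]
        rw [hff _ (hunorm x (by linarith))]
    rw [e0, e1] at hfam
    exact (hfam.trans (HR.line hf' huc continuous_id huout)).symm
  · refine Continuous.if_le (hf'.comp (by fun_prop)) (hf.comp (by fun_prop)) (by fun_prop) (by fun_prop) ?_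
    rintro ⟨t, x⟩ hx
    simp only at hx ⊢
    rw [hτin x hx.le, huin x hx.le, ← add_smul, hff]
    · simp
    · rw [norm_smul, hx]; norm_num
  · intro t _ x hx
    have : ¬ ‖x‖ ≤ 1/4 := by linarith
    simp only [this, if_false, hτout x hx, huout x hx, ← add_smul]
    simp

end Ball2
end RPX

namespace RPX
open Metric
open Set
set_option linter.unusedSectionVars false
set_option linter.unusedSimpArgs false
set_option linter.unusedVariables false
set_option linter.style.longLine false


/-- the coordinate space -/
abbrev EE (M : ℕ) := Fin (M + 2) → ℝ
/-- the sphere -/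
abbrev SS (M : ℕ) := Sph (M + 2)
/-- the ambient space -/
abbrev VV (M : ℕ) := EuclideanSpace ℝ (Fin (M + 3))
/-- base point -/
noncomputable abbrev y0 (M : ℕ) : SS M := Sph.pt (M + 2)
/-- base vector on the boundary -/
noncomputable def v0 (M : ℕ) : EE M := Pi.single 0 1

variable {M : ℕ}

lemma norm_v0 : ‖v0 M‖ = 1 := by simp [v0, Pi.norm_single]

lemma y0_coe : ((y0 M : SS M) : VV M) = EuclideanSpace.single 0 1 := rfl

/-- normalisation -/
noncomputable def toS (w : VV M) : SS M := by
  classical exact if h : w = 0 then y0 M else ⟨‖w‖⁻¹ • w, by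
    rw [mem_sphere_zero_iff_norm, norm_smul, norm_inv, norm_norm, inv_mul_cancel₀ (norm_ne_zero_iff.2 h)]⟩

lemma toS_coe {w : VV M} (h : w ≠ 0) : ((toS w : SS M) : VV M) = ‖w‖⁻¹ • w := by simp [toS, h]

lemma norm_SS (y : SS M) : ‖(y : VV M)‖ = 1 := mem_sphere_zero_iff_norm.1 y.2
lemma SS_ne (y : SS M) : (y : VV M) ≠ 0 := by
  intro h; have := norm_SS y; rw [h] at this; simp at this

@[simp] lemma toS_self (y : SS M) : toS (y : VV M) = y := by
  apply Subtype.ext; rw [toS_coe (SS_ne y), norm_SS]; simp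

lemma toS_smul {w : VV M} {c : ℝ} (hc : 0 < c) : toS (c • w) = toS w := by
  by_cases h : w = 0
  · simp [h]
  · apply Subtype.ext
    rw [toS_coe h, toS_coe (smul_ne_zero hc.ne' h), norm_smul, smul_smul, Real.norm_of_nonneg hc.le]
    congr 1
    have := norm_ne_zero_iff.2 h
    field_simp

lemma continuous_toS {X : Type*} [TopologicalSpace X] {F : X → VV M} (hF : Continuous F) (h0 : ∀ x, F x ≠ 0) :
    Continuous (fun x => toS (F x)) := by
  refine Continuous.subtype_mk (p := fun w => w ∈ Metric.sphere (0 : VV M) 1) (f := fun x => ‖F x‖⁻¹ • F x)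
    ((Continuous.inv₀ (by fun_prop) (fun x => norm_ne_zero_iff.2 (h0 x))).smul hF)
    (fun x => by
      rw [mem_sphere_zero_iff_norm, norm_smul, norm_inv, norm_norm, inv_mul_cancel₀ (norm_ne_zero_iff.2 (h0 x))])
    |>.congr ?_
  intro x
  apply Subtype.ext
  simp [toS_coe (h0 x)]

/-- straight-line homotopy in the target -/
lemma homIn_toS {X : Type*} [TopologicalSpace X] {A : Set (X → SS M)} {F G : X → VV M} (hF : Continuous F)
    (hG : Continuous G) (h0 : ∀ t ∈ Icc (0:ℝ) 1, ∀ x, (1 - t) • F x + t • G x ≠ 0)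
    (hA : ∀ t ∈ Icc (0:ℝ) 1, (fun x => toS ((1 - t) • F x + t • G x)) ∈ A) :
    HomIn A (fun x => toS (F x)) (fun x => toS (G x)) := by
  have := HomIn.mk_family (A := A) (fun t x => toS ((1 - c01 t) • F x + c01 t • G x)) ?_ ?_
  · simpa using this
  · refine continuous_toS ?_ (fun z => h0 _ (c01_mem _) _)
    have := continuous_c01
    fun_prop
  · intro t ht
    exact hA _ (c01_mem t)

lemma HR_toS {F G : EE M → VV M} (hF : Continuous F)
    (hG : Continuous G) (h0 : ∀ t ∈ Icc (0:ℝ) 1, ∀ x, (1 - t) • F x + t • G x ≠ 0)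
    (hA : ∀ x, 1 ≤ ‖x‖ → F x = G x) : HR (fun x => toS (F x)) (fun x => toS (G x)) := by
  refine homIn_toS hF hG h0 ?_
  intro t ht x hx
  simp only [hA x hx, ← add_smul]
  simp

/-- vector from head and tail -/
noncomputable def mk (a : ℝ) (z : EE M) : VV M := WithLp.toLp 2 (Fin.cons a z)

@[simp] lemma mk_zero (a : ℝ) (z : EE M) : mk a z 0 = a := by simp [mk]
@[simp] lemma mk_succ (a : ℝ) (z : EE M) (i : Fin (M + 2)) : mk a z i.succ = z i := by simp [mk]
lemma mk_eq_iff {a : ℝ} {z : EE M} {w : VV M} : mk a z = w ↔ a = w 0 ∧ ∀ i : Fin (M+2), z i = w i.succ := by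
  constructor
  · rintro rfl; simp
  · rintro ⟨h1, h2⟩
    ext i
    refine Fin.cases ?_ (fun i => ?_) i
    · simp [h1]
    · simp [h2]
lemma mk_ne_zero {a : ℝ} {z : EE M} (h : a ≠ 0 ∨ z ≠ 0) : mk a z ≠ 0 := by
  intro h0
  rw [mk_eq_iff] at h0
  rcases h with h | h
  · exact h (by simpa using h0.1)
  · exact h (by ext i; simpa using h0.2 i)
lemma mk_add (a b : ℝ) (z w : EE M) : mk a z + mk b w = mk (a + b) (z + w) := by
  rw [eq_comm, mk_eq_iff]; simp
lemma mk_smul (c a : ℝ) (z : EE M) : c • mk a z = mk (c * a) (c • z) := by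
  rw [eq_comm, mk_eq_iff]; simp
lemma mk_one_zero : mk 1 0 = ((y0 M : SS M) : VV M) := by
  rw [y0_coe, mk_eq_iff]; simp
lemma mk_eta (w : VV M) : mk (w 0) (fun i => w i.succ) = w := by rw [mk_eq_iff]; simp

lemma continuous_mk {X : Type*} [TopologicalSpace X] {a : X → ℝ} {z : X → EE M} (ha : Continuous a)
    (hz : Continuous z) : Continuous (fun x => mk (a x) (z x)) := by
  unfold mk
  refine (PiLp.continuous_toLp 2 _).comp ?_
  refine continuous_pi (fun i => ?_)
  refine Fin.cases ?_ (fun i => ?_) i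
  · simpa using ha
  · simp only [Fin.cons_succ]; exact (continuous_apply i).comp hz

/-- the generator before normalisation -/
noncomputable def c0v (z : EE M) : VV M := mk (min (2 * ‖z‖ - 1) 1) (max (1 - ‖z‖) 0 • z)

lemma c0v_ne (z : EE M) : c0v z ≠ 0 := by
  refine mk_ne_zero ?_
  rcases le_or_gt 1 ‖z‖ with h | h
  · left; rw [min_eq_right (by linarith)]; norm_num
  · by_cases hz : z = 0
    · left; rw [hz]; norm_num
    · right; refine smul_ne_zero ?_ hz
      rw [max_eq_left (by linarith)]; linarith

lemma continuous_c0v : Continuous (c0v : EE M → VV M) := by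
  unfold c0v
  exact continuous_mk (by fun_prop) (by fun_prop)

lemma c0v_out {z : EE M} (h : 1 ≤ ‖z‖) : c0v z = ((y0 M : SS M) : VV M) := by
  rw [← mk_one_zero, c0v, min_eq_right (by linarith), max_eq_right (by linarith), zero_smul]

/-- the generator -/
noncomputable def c0 (z : EE M) : SS M := toS (c0v z)

lemma c0_ball : IsBall (y0 M) (c0 : EE M → SS M) :=
  ⟨continuous_toS continuous_c0v c0v_ne, fun z hz => by rw [c0, c0v_out hz, toS_self]⟩

/-- ball maps -/
abbrev BM (M : ℕ) := {f : EE M → SS M // IsBall (y0 M) f}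

/-- setoid of homotopy -/
instance bmSetoid (M : ℕ) : Setoid (BM M) where
  r f g := HR f.1 g.1
  iseqv := ⟨fun f => HR.refl f.2.1, fun h => HR.symm h, fun h h' => HR.trans h h'⟩

/-- classes of ball maps -/
def Cls (M : ℕ) := Quotient (bmSetoid M)

/-- class of a ball map -/
def cls (f : EE M → SS M) (hf : IsBall (y0 M) f) : Cls M := Quotient.mk _ ⟨f, hf⟩

lemma cls_eq {f g : EE M → SS M} {hf : IsBall (y0 M) f} {hg : IsBall (y0 M) g} :
    cls f hf = cls g hg ↔ HR f g := Quotient.eq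

lemma cls_ind {P : Cls M → Prop} (h : ∀ f hf, P (cls f hf)) (a : Cls M) : P a := by
  refine Quotient.inductionOn a (fun f => h f.1 f.2)

/-- the action -/
noncomputable abbrev st (F β : EE M → SS M) : EE M → SS M := star (y0 M) (v0 M) F β

lemma st_ball {F β : EE M → SS M} (hF : IsBall (y0 M) F) (hβ : IsBall (y0 M) β) : IsBall (y0 M) (st F β) :=
  hF.star norm_v0 hβ

noncomputable instance : Monoid (Cls M) where
  mul := Quotient.map₂ (fun f g : BM M => (⟨st f.1 g.1, st_ball f.2 g.2⟩ : BM M))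
    (fun f f' hf g g' hg => star_HR norm_v0 hf (f.2.2 _ norm_v0.ge) hg g.2)
  one := cls (fun _ => y0 M) (isBall_const _)
  mul_assoc a b c := Quotient.inductionOn₃ a b c (fun f g h => Quotient.sound
    (star_assoc norm_v0 f.2.1 (f.2.2 _ norm_v0.ge) g.2 h.2))
  one_mul a := Quotient.inductionOn a (fun f => Quotient.sound (const_star f.2))
  mul_one a := Quotient.inductionOn a (fun f => Quotient.sound (star_const f.2.1))

lemma cls_mul {f g : EE M → SS M} (hf : IsBall (y0 M) f) (hg : IsBall (y0 M) g) :
    cls f hf * cls g hg = cls (st f g) (st_ball hf hg) := rfl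
lemma cls_one : (1 : Cls M) = cls (fun _ => y0 M) (isBall_const _) := rfl

lemma IsBall.postc {f : EE M → SS M} (hf : IsBall (y0 M) f) {G : SS M → SS M} (hG : Continuous G)
    (h0 : G (y0 M) = y0 M) : IsBall (y0 M) (G ∘ f) :=
  ⟨hG.comp hf.1, fun x hx => by simp [hf.2 x hx, h0]⟩

/-- induced homomorphism -/
noncomputable def postHom (G : SS M → SS M) (hG : Continuous G) (h0 : G (y0 M) = y0 M) : Cls M →* Cls M where
  toFun := Quotient.map (fun f : BM M => (⟨G ∘ f.1, f.2.postc hG h0⟩ : BM M)) (fun f g h => HR.post h hG)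
  map_one' := by
    refine Quotient.sound ?_
    exact HR.of_eq (hG.comp continuous_const) (funext fun _ => h0)
  map_mul' a b := Quotient.inductionOn₂ a b (fun f g => Quotient.sound (HR.of_eq
    (hG.comp (st_ball f.2 g.2).1) (post_star (f.2.2 _ norm_v0.ge) g.2 h0)))

lemma postHom_cls (G : SS M → SS M) (hG : Continuous G) (h0 : G (y0 M) = y0 M) (f : EE M → SS M) (hf) :
    postHom G hG h0 (cls f hf) = cls (G ∘ f) (hf.postc hG h0) := rfl

end RPX

namespace RPX
open Metric
open Set
set_option linter.unusedSectionVars false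
set_option linter.unusedSimpArgs false
set_option linter.unusedVariables false
set_option linter.style.longLine false


section GLs
variable {M : ℕ}

/-- square matrices -/
abbrev MM (M : ℕ) := Matrix (Fin (M + 2)) (Fin (M + 2)) ℝ

/-- joined by a path of invertible matrices -/
def JJ (A B : MM M) : Prop := JoinedIn {A : MM M | A.det ≠ 0} A B

lemma JJ.trans {A B C : MM M} (h : JJ A B) (h' : JJ B C) : JJ A C := JoinedIn.trans h h'
lemma JJ.symm {A B : MM M} (h : JJ A B) : JJ B A := JoinedIn.symm h
lemma JJ.refl {A : MM M} (h : A.det ≠ 0) : JJ A A := JoinedIn.refl h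
lemma JJ.of_fun {A B : MM M} (H : ℝ → MM M) (h : Continuous H) (hd : ∀ t ∈ Icc (0:ℝ) 1, (H t).det ≠ 0)
    (h0 : H 0 = A) (h1 : H 1 = B) : JJ A B := by
  refine JoinedIn.ofLine (f := H) h.continuousOn h0 h1 ?_
  rintro _ ⟨t, ht, rfl⟩
  exact hd t ht
lemma JJ.exists_fun {A B : MM M} (h : JJ A B) : ∃ H : ℝ → MM M, Continuous H ∧ (∀ t, (H t).det ≠ 0) ∧ H 0 = A ∧ H 1 = B := by
  obtain ⟨γ, hγ⟩ := h
  exact ⟨γ.extend, γ.continuous_extend, fun t => hγ _, by simp, by simp⟩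
lemma JJ.mul {A B C D : MM M} (h : JJ A B) (h' : JJ C D) : JJ (A * C) (B * D) := by
  obtain ⟨H, h1, h2, h3, h4⟩ := h.exists_fun
  obtain ⟨K, k1, k2, k3, k4⟩ := h'.exists_fun
  refine JJ.of_fun (fun t => H t * K t) (h1.matrix_mul k1) (fun t _ => ?_) (by simp [h3, k3]) (by simp [h4, k4])
  rw [Matrix.det_mul]; exact mul_ne_zero (h2 t) (k2 t)

/-- diagonal matrix with one nontrivial entry -/
noncomputable def Dg (i : Fin (M + 2)) (d : ℝ) : MM M := Matrix.diagonal (Function.update 1 i d)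

lemma det_Dg (i : Fin (M + 2)) (d : ℝ) : (Dg i d).det = d := by
  simp [Dg, Matrix.det_diagonal, Finset.prod_update_of_mem]

lemma Dg_joined (i : Fin (M + 2)) {d e : ℝ} (h : 0 < d * e) : JJ (Dg i d) (Dg i e) := by
  refine JJ.of_fun (fun t => Dg i ((1 - t) * d + t * e)) ?_ ?_ (by simp) (by simp)
  · unfold Dg
    refine Continuous.matrix_diagonal ?_
    exact Continuous.update continuous_const i (by fun_prop)
  · intro t ht
    rw [det_Dg]
    intro h0
    have h1 : d * ((1 - t) * d + t * e) = 0 := by rw [h0, mul_zero]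
    have hd : d ≠ 0 := by rintro rfl; simp at h
    have : 0 < d * d := mul_self_pos.2 hd
    rcases eq_or_lt_of_le ht.1 with h2 | h2
    · subst h2; simp at h1; exact hd h1
    · nlinarith [mul_pos h2 h, mul_nonneg (sub_nonneg.2 ht.2) this.le]

lemma Dg_one (i : Fin (M + 2)) : Dg (M := M) i 1 = 1 := by
  rw [Dg, ← Matrix.diagonal_one]; congr 1; simp; rfl

lemma Dg_neg_joined (i j : Fin (M + 2)) : JJ (Dg i (-1)) (Dg j (-1)) := by
  by_cases hij : i = j
  · subst hij; exact JJ.refl (by rw [det_Dg]; norm_num)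
  let w : ℝ → Fin (M + 2) → ℝ := fun t => Real.cos (Real.pi / 2 * t) • Pi.single i 1 + Real.sin (Real.pi / 2 * t) • Pi.single j 1
  have hw : Continuous w := by fun_prop
  have key : ∀ k, (1 : MM M) - (2:ℝ) • Matrix.vecMulVec (Pi.single k 1) (Pi.single k 1) = Dg k (-1) := by
    intro k
    ext a b
    simp only [Matrix.sub_apply, Matrix.smul_apply, Matrix.vecMulVec_apply, Dg, Matrix.diagonal_apply, Matrix.one_apply, smul_eq_mul]
    by_cases hab : a = b
    · subst hab
      by_cases hk : a = k
      · subst hk; simp; norm_num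
      · simp [hk]
    · by_cases hk : a = k
      · subst hk; simp [hab, Pi.single_apply, Ne.symm hab]
      · simp [hk, hab, Pi.single_apply]
  refine JJ.of_fun (fun t => (1 : MM M) - (2:ℝ) • Matrix.vecMulVec (w t) (w t)) ?_ ?_ ?_ ?_
  · have := hw.matrix_vecMulVec hw
    fun_prop
  · intro t _
    have h1 : (1 : MM M) - (2:ℝ) • Matrix.vecMulVec (w t) (w t)
       = 1 + Matrix.replicateCol Unit ((-2:ℝ) • w t) * Matrix.replicateRow Unit (w t) := by
      rw [← Matrix.vecMulVec_eq]
      rw [Matrix.smul_vecMulVec, neg_smul, sub_eq_add_neg]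
    rw [h1, Matrix.det_one_add_replicateCol_mul_replicateRow]
    have : (w t) ⬝ᵥ ((-2:ℝ) • w t) = -2 := by
      simp only [w, dotProduct_smul, dotProduct_add, add_dotProduct, smul_dotProduct]
      simp [Pi.single_apply, hij, Ne.symm hij]
      nlinarith [Real.sin_sq_add_cos_sq (Real.pi / 2 * t)]
    rw [this]; norm_num
  · rw [← key]; simp [w]
  · rw [← key]; simp [w]

lemma GL_aux (A : MM M) (hA : A.det ≠ 0) : JJ A 1 ∨ JJ A (Dg 1 (-1)) := by
  have hR : Dg (M := M) 1 (-1) * Dg 1 (-1) = 1 := by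
    rw [Dg, Matrix.diagonal_mul_diagonal, ← Matrix.diagonal_one]
    congr 1
    ext i
    by_cases hi : i = 1
    · subst hi; simp
    · simp [hi]
  have hmul : ∀ A B : MM M, (JJ A 1 ∨ JJ A (Dg 1 (-1))) → (JJ B 1 ∨ JJ B (Dg 1 (-1))) →
      (JJ (A * B) 1 ∨ JJ (A * B) (Dg 1 (-1))) := by
    rintro A B (hA | hA) (hB | hB)
    · left; simpa using hA.mul hB
    · right; simpa using hA.mul hB
    · right; simpa using hA.mul hB
    · left; simpa [hR] using hA.mul hB
  have hone : JJ (1 : MM M) 1 := JJ.refl (by simp)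
  have hsing : ∀ i d, d ≠ 0 → (JJ (Dg (M := M) i d) 1 ∨ JJ (Dg i d) (Dg 1 (-1))) := by
    intro i d hd
    rcases lt_or_gt_of_ne hd with h | h
    · right; exact (Dg_joined i (by linarith)).trans (Dg_neg_joined i 1)
    · left; simpa [Dg_one] using Dg_joined i (d := d) (e := 1) (by linarith)
  refine Matrix.diagonal_transvection_induction_of_det_ne_zero (fun A => JJ A 1 ∨ JJ A (Dg 1 (-1))) A hA ?_ ?_
    (fun A B _ _ => hmul A B)
  · intro D hD
    have hD' : ∀ i, D i ≠ 0 := by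
      intro i h
      rw [Matrix.det_diagonal] at hD
      exact hD (Finset.prod_eq_zero (Finset.mem_univ i) h)
    have : ∀ s : Finset (Fin (M + 2)), (JJ (Matrix.diagonal (fun i => if i ∈ s then D i else 1) : MM M) 1 ∨
        JJ (Matrix.diagonal (fun i => if i ∈ s then D i else 1) : MM M) (Dg 1 (-1))) := by
      intro s
      induction s using Finset.induction_on with
      | empty => left; simpa using hone
      | insert a s ha ih =>
        have : (Matrix.diagonal (fun i => if i ∈ insert a s then D i else 1) : MM M) =
            Dg a (D a) * Matrix.diagonal (fun i => if i ∈ s then D i else 1) := by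
          rw [Dg, Matrix.diagonal_mul_diagonal]
          congr 1
          ext i
          by_cases hi : i = a
          · subst hi; simp [ha]
          · simp [hi]
        rw [this]
        exact hmul _ _ (hsing a _ (hD' a)) ih
    simpa using this Finset.univ
  · intro t
    left
    refine JJ.of_fun (fun s => Matrix.transvection t.i t.j ((1 - s) * t.c)) ?_ (fun s _ => ?_) (by simp [Matrix.TransvectionStruct.toMatrix]) (by simp)
    · unfold Matrix.transvection
      refine continuous_const.add ?_
      refine continuous_matrix (fun a b => ?_)
      simp only [Matrix.single_apply]
      split_ifs <;> fun_prop
    · rw [Matrix.det_transvection_of_ne _ _ t.hij]; norm_num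

lemma JJ.det_pos {A B : MM M} (h : JJ A B) (hA : 0 < A.det) : 0 < B.det := by
  obtain ⟨H, h1, h2, h3, h4⟩ := h.exists_fun
  by_contra hB
  have hc : Continuous (fun t => (H t).det) := h1.matrix_det
  have := intermediate_value_Icc' (zero_le_one (α := ℝ)) hc.continuousOn
  obtain ⟨t, _, ht⟩ := this (show (0:ℝ) ∈ _ from ⟨by simpa [h4] using hB, by simpa [h3] using hA.le⟩)
  exact h2 t ht

lemma GL_pos {A : MM M} (hA : 0 < A.det) : JJ A 1 := by
  rcases GL_aux A hA.ne' with h | h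
  · exact h
  · have := h.det_pos hA
    rw [det_Dg] at this; norm_num at this
lemma GL_neg {A : MM M} (hA : A.det < 0) : JJ A (Dg 1 (-1)) := by
  rcases GL_aux A hA.ne with h | h
  · have := h.symm.det_pos (by simp)
    linarith
  · exact h
end GLs

end RPX

namespace RPX
open Metric
open Set
set_option linter.unusedSectionVars false
set_option linter.unusedSimpArgs false
set_option linter.unusedVariables false
set_option linter.style.longLine false


section Lin
variable {M : ℕ}
open Matrix

/-- expanding with factor -/
def Ex (A : MM M) (s : ℝ) : Prop := 0 < s ∧ ∀ x : EE M, ‖x‖ ≤ s * ‖A *ᵥ x‖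

lemma Ex.ball {A : MM M} {s : ℝ} (h : Ex A s) {β : EE M → SS M} (hβ : IsBall (y0 M) β) :
    IsBall (y0 M) (fun x => β (s • (A *ᵥ x))) := by
  refine ⟨hβ.1.comp (by fun_prop), fun x hx => hβ.2 _ ?_⟩
  rw [norm_smul, Real.norm_of_nonneg h.1.le]
  exact hx.trans (h.2 x)

lemma Ex.mono {A : MM M} {s s' : ℝ} (h : Ex A s) (hs : s ≤ s') : Ex A s' :=
  ⟨h.1.trans_le hs, fun x => (h.2 x).trans (by gcongr)⟩

lemma lin_family {K : ℝ → MM M} (hK : Continuous K) (hE : ∀ t ∈ Icc (0:ℝ) 1, ∀ x, ‖x‖ ≤ ‖K t *ᵥ x‖)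
    {β : EE M → SS M} (hβ : IsBall (y0 M) β) : HR (fun x => β (K 0 *ᵥ x)) (fun x => β (K 1 *ᵥ x)) := by
  refine HR.family (fun t x => β (K t *ᵥ x)) (hβ.1.comp ?_) ?_
  · exact (hK.comp continuous_fst).matrix_mulVec continuous_snd
  · intro t ht x hx
    rw [hβ.2 _ (hx.trans (hE t ht x)), hβ.2 _ (hx.trans (hE 0 ⟨le_rfl, zero_le_one⟩ x))]

lemma lin_HR {A B : MM M} (h : JJ A B) {s s' : ℝ} (hA : Ex A s) (hB : Ex B s') {β : EE M → SS M}
    (hβ : IsBall (y0 M) β) : HR (fun x => β (s • (A *ᵥ x))) (fun x => β (s' • (B *ᵥ x))) := by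
  obtain ⟨H, h1, h2, h3, h4⟩ := h.exists_fun
  have hcomp : IsCompact ((Icc (0:ℝ) 1) ×ˢ (sphere (0 : EE M) 1)) := isCompact_Icc.prod (isCompact_sphere 0 1)
  have hne : ((Icc (0:ℝ) 1) ×ˢ (sphere (0 : EE M) 1)).Nonempty :=
    ⟨(0, v0 M), ⟨le_rfl, zero_le_one⟩, by simp [norm_v0]⟩
  have hc : Continuous (fun p : ℝ × EE M => ‖H p.1 *ᵥ p.2‖) :=
    ((h1.comp continuous_fst).matrix_mulVec continuous_snd).norm
  obtain ⟨p, hp, hmin⟩ := hcomp.exists_isMinOn hne hc.continuousOn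
  set m := ‖H p.1 *ᵥ p.2‖ with hm
  have hmpos : 0 < m := by
    rw [hm, norm_pos_iff]
    intro h0
    have := Matrix.eq_zero_of_mulVec_eq_zero (h2 p.1) h0
    have h5 := mem_sphere_zero_iff_norm.1 hp.2
    rw [this] at h5; simp at h5
  have hex : ∀ t ∈ Icc (0:ℝ) 1, Ex (H t) m⁻¹ := by
    intro t ht
    refine ⟨by positivity, fun x => ?_⟩
    by_cases hx : x = 0
    · simp [hx]
    have hx' : 0 < ‖x‖ := norm_pos_iff.2 hx
    have := hmin (show (t, ‖x‖⁻¹ • x) ∈ _ from ⟨ht, by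
      rw [mem_sphere_zero_iff_norm, norm_smul, norm_inv, norm_norm, inv_mul_cancel₀ hx'.ne']⟩)
    simp only [mem_ofPred_eq, Matrix.mulVec_smul, norm_smul, norm_inv, norm_norm] at this
    change m ≤ _ at this
    rw [inv_mul_eq_div, le_div_iff₀ hx'] at this
    rw [inv_mul_eq_div, le_div_iff₀ hmpos]; linarith
  set S := max m⁻¹ (max s s') with hS
  have hexS : ∀ t ∈ Icc (0:ℝ) 1, Ex (H t) S := fun t ht => (hex t ht).mono (le_max_left _ _)
  have scal : ∀ (C : MM M) (r r' : ℝ), Ex C r → Ex C r' →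
      HR (fun x => β (r • (C *ᵥ x))) (fun x => β (r' • (C *ᵥ x))) := by
    intro C r r' hr hr'
    have := lin_family (K := fun t => ((1 - t) * r + t * r') • C) (by fun_prop) ?_ hβ
    · simpa [Matrix.smul_mulVec] using this
    · intro t ht x
      have : 0 ≤ (1 - t) * r + t * r' := by
        have := ht.1; have := sub_nonneg.2 ht.2; have := hr.1; have := hr'.1; positivity
      rw [Matrix.smul_mulVec, norm_smul, Real.norm_of_nonneg this]
      have e1 := mul_le_mul_of_nonneg_left (hr.2 x) (sub_nonneg.2 ht.2)
      have e2 := mul_le_mul_of_nonneg_left (hr'.2 x) ht.1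
      nlinarith
  have mid : HR (fun x => β (S • (A *ᵥ x))) (fun x => β (S • (B *ᵥ x))) := by
    have := lin_family (K := fun t => S • H t) (by fun_prop) ?_ hβ
    · simpa [Matrix.smul_mulVec, h3, h4] using this
    · intro t ht x
      rw [Matrix.smul_mulVec, norm_smul, Real.norm_of_nonneg (hexS t ht).1.le]
      exact (hexS t ht).2 x
  have eA : Ex A S := hA.mono ((le_max_left _ _).trans (le_max_right _ _))
  have eB : Ex B S := hB.mono ((le_max_right _ _).trans (le_max_right _ _))
  exact (scal A s S hA eA).trans (mid.trans (scal B S s' eB hB))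

lemma Ex_one : Ex (1 : MM M) 1 := ⟨one_pos, fun x => by simp⟩

/-- the reflection in coordinate 1 -/
noncomputable def Rr (x : EE M) : EE M := Function.update x 1 (-x 1)

lemma Dg_mulVec (x : EE M) : Dg 1 (-1) *ᵥ x = Rr x := by
  ext i
  rw [Dg, Matrix.mulVec_diagonal]
  by_cases hi : i = 1
  · subst hi; simp [Rr]
  · simp [Rr, hi]

lemma continuous_Rr : Continuous (Rr : EE M → EE M) := by
  unfold Rr
  exact continuous_id.update 1 (by fun_prop)
lemma Rr_Rr (x : EE M) : Rr (Rr x) = x := by simp [Rr]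
lemma norm_Rr_le (x : EE M) : ‖Rr x‖ ≤ ‖x‖ := by
  rw [pi_norm_le_iff_of_nonneg (norm_nonneg x)]
  intro i
  by_cases hi : i = 1
  · subst hi; simpa [Rr] using norm_le_pi_norm x 1
  · simpa [Rr, hi] using norm_le_pi_norm x i
lemma norm_Rr (x : EE M) : ‖Rr x‖ = ‖x‖ :=
  le_antisymm (norm_Rr_le x) (by simpa [Rr_Rr] using norm_Rr_le (Rr x))
lemma Rr_add (x y : EE M) : Rr (x + y) = Rr x + Rr y := by
  rw [← Dg_mulVec, ← Dg_mulVec, ← Dg_mulVec, Matrix.mulVec_add]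
lemma Rr_smul (c : ℝ) (x : EE M) : Rr (c • x) = c • Rr x := by
  rw [← Dg_mulVec, ← Dg_mulVec, Matrix.mulVec_smul]
lemma Rr_v0 : Rr (v0 M) = v0 M := by
  simp [Rr, v0]

lemma Ex_Dg : Ex (Dg (M := M) 1 (-1)) 1 := ⟨one_pos, fun x => by rw [Dg_mulVec, norm_Rr, one_mul]⟩

/-- a ball map precomposed with an orientation preserving matrix -/
lemma lin_pos {A : MM M} (h : 0 < A.det) {s : ℝ} (hA : Ex A s) {β : EE M → SS M} (hβ : IsBall (y0 M) β) :
    HR (fun x => β (s • (A *ᵥ x))) β := by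
  simpa using lin_HR (GL_pos h) hA Ex_one hβ

lemma lin_neg {A : MM M} (h : A.det < 0) {s : ℝ} (hA : Ex A s) {β : EE M → SS M} (hβ : IsBall (y0 M) β) :
    HR (fun x => β (s • (A *ᵥ x))) (β ∘ Rr) := by
  simpa [Dg_mulVec, Function.comp_def] using lin_HR (GL_neg h) hA Ex_Dg hβ

lemma ball_neg (hM : Even M) {β : EE M → SS M} (hβ : IsBall (y0 M) β) : HR (fun x => β (-x)) β := by
  have := lin_pos (A := (-1 : MM M)) (s := 1) (by
    rw [Matrix.det_neg]; simp [hM.add (by decide : Even 2)]) ⟨one_pos, fun x => by simp [Matrix.neg_mulVec]⟩ hβ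
  simpa [Matrix.neg_mulVec] using this

lemma IsBall.Rr {β : EE M → SS M} (hβ : IsBall (y0 M) β) : IsBall (y0 M) (β ∘ Rr) :=
  ⟨hβ.1.comp continuous_Rr, fun x hx => hβ.2 _ (by rw [norm_Rr]; exact hx)⟩

lemma kap_Rr (x : EE M) : kap (RPX.Rr x) = kap x := by simp [kap, norm_Rr]
lemma uh_Rr (x : EE M) : uh (RPX.Rr x) = RPX.Rr (uh x) := by simp [uh, norm_Rr, Rr_smul]
lemma qm_Rr (x : EE M) : qm (v0 M) (RPX.Rr x) = RPX.Rr (qm (v0 M) x) := by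
  simp [qm, kap_Rr, uh_Rr, Rr_add, Rr_smul, Rr_v0]

lemma st_Rr (F β : EE M → SS M) : st F β ∘ RPX.Rr = st (F ∘ RPX.Rr) (β ∘ RPX.Rr) := by
  unfold st star
  rw [ov_comp_right]
  congr 1
  · ext x; simp [qm_Rr]
  · ext x; simp [Rr_smul]

/-- precomposition with the reflection as an endomorphism -/
noncomputable def rrHom : Cls M →* Cls M where
  toFun := Quotient.map (fun f : BM M => (⟨f.1 ∘ RPX.Rr, f.2.Rr⟩ : BM M)) (fun f g h =>
    HomIn.pre h continuous_Rr (fun k hk x hx => hk _ (by rw [norm_Rr]; exact hx)))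
  map_one' := rfl
  map_mul' a b := Quotient.inductionOn₂ a b (fun f g => by
    refine Quotient.sound (HR.of_eq ((st_ball f.2 g.2).Rr).1 (st_Rr _ _)))

lemma rrHom_cls (f : EE M → SS M) (hf) : rrHom (cls f hf) = cls (f ∘ RPX.Rr) hf.Rr := rfl
end Lin

end RPX

namespace RPX
open Metric
open Set
set_option linter.unusedSectionVars false
set_option linter.unusedSimpArgs false
set_option linter.unusedVariables false
set_option linter.style.longLine false


section Inv
variable {M : ℕ}

lemma HR.Rr {f g : EE M → SS M} (h : HR f g) : HR (f ∘ Rr) (g ∘ Rr) :=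
  HomIn.pre h continuous_Rr (fun k hk x hx => hk _ (by rw [norm_Rr]; exact hx))

/-- a translated and rescaled ball map is homotopic to the original one -/
lemma ball_move {β : EE M → SS M} (hβ : IsBall (y0 M) β) {p : EE M} {σ : ℝ} (hσ : 0 < σ) (hp : σ ≤ 1 - ‖p‖) :
    HR (fun x => β (σ⁻¹ • (x - p))) β := by
  have hh : ∀ x, σ ≤ ‖x - p‖ → β (σ⁻¹ • (x - p)) = y0 M := by
    intro x hx
    apply hβ.2
    rw [norm_smul, norm_inv, Real.norm_of_nonneg hσ.le, inv_mul_eq_div, le_div_iff₀ hσ]; linarith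
  have hb := hβ.1
  have h1 := peel (y0 := y0 M) (v := v0 M) (g := fun _ => y0 M) (h := fun x => β (σ⁻¹ • (x - p))) continuous_const
    (by fun_prop) hσ hp (fun _ _ => rfl) hh (γ := fun t => (1 - t) • p + t • v0 M) (by fun_prop) (by simp) (by simp)
    (fun _ _ => rfl)
  have h2 : (fun x => β (σ⁻¹ • (p + σ • x - p))) = β := by
    ext1 x; congr 1; simp [smul_smul, inv_mul_cancel₀ hσ.ne']
  rw [h2] at h1
  have h3 : ov (y0 M) (fun _ => y0 M) (fun x => β (σ⁻¹ • (x - p))) = (fun x => β (σ⁻¹ • (x - p))) := by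
    ext1 x; exact ov_of_left rfl
  rw [h3] at h1
  exact h1.trans (const_star hβ)

lemma rr_mul_self {β : EE M → SS M} (hβ : IsBall (y0 M) β) : HR (st (β ∘ Rr) β) (fun _ => y0 M) := by
  set p : EE M := Pi.single 1 (1/2) with hp
  have hpn : ‖p‖ = 1/2 := by rw [hp, Pi.norm_single]; norm_num
  set h : EE M → SS M := fun x => β ((1/2:ℝ)⁻¹ • (x - p)) with hh
  have hb := hβ.1
  have hhc : Continuous h := by fun_prop
  have hmove : HR h β := ball_move hβ (by norm_num) (by rw [hpn]; norm_num)
  have hhp : ∀ x, 1/2 ≤ ‖x - p‖ → h x = y0 M := by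
    intro x hx
    apply hβ.2
    rw [norm_smul]; norm_num; linarith
  have hcoord : ∀ (x : EE M) i, 1/2 ≤ |x i - p i| → h x = y0 M := fun x i hi => hhp x (by
    have := norm_le_pi_norm (x - p) i
    simp only [Pi.sub_apply, Real.norm_eq_abs] at this; linarith)
  have hneg : ∀ x : EE M, x 1 ≤ 0 → h x = y0 M := by
    intro x hx
    refine hcoord x 1 ?_
    rw [hp, Pi.single_eq_same, abs_of_nonpos (by linarith)]; linarith
  have hpos : ∀ x : EE M, 0 ≤ x 1 → (h ∘ Rr) x = y0 M := by
    intro x hx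
    refine hneg _ ?_
    simpa [Rr] using hx
  have h1 := peel (y0 := y0 M) (v := v0 M) (g := h ∘ Rr) (h := h) (hhc.comp continuous_Rr)
    hhc (p := p) (σ := 1/2) (by norm_num) (by rw [hpn]; norm_num) (fun x hx => hpos x (by
      have := (norm_le_pi_norm (x - p) 1).trans hx
      simp only [Pi.sub_apply, Real.norm_eq_abs, hp, Pi.single_eq_same] at this
      linarith [(abs_le.1 this).1])) hhp (γ := fun t => (1 - t) • p + t • v0 M) (by fun_prop) (by simp) (by simp)
    (fun t ht => hpos _ (by
      have := sub_nonneg.2 ht.2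
      simp [hp, v0]; linarith))
  have h2 : (fun x => h (p + (1/2:ℝ) • x)) = β := by
    ext x; simp [hh]
  rw [h2] at h1
  have hgb : IsBall (y0 M) h := hmove.symm.isBall hβ
  have h3 : HR (st (h ∘ Rr) β) (st (β ∘ Rr) β) :=
    star_HR norm_v0 hmove.Rr (hgb.Rr.2 _ norm_v0.ge) (HR.refl hβ.1) hβ
  have h4 : ov (y0 M) (h ∘ Rr) h = fun x => h (Function.update x 1 (max |x 1| 0)) := by
    ext1 x
    rw [max_eq_left (abs_nonneg _)]
    rcases le_total 0 (x 1) with hx | hx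
    · rw [ov_of_left (hpos x hx), abs_of_nonneg hx]; simp
    · rw [ov_of_right (hneg x hx), abs_of_nonpos hx]; rfl
  have h5 : HR (fun x => h (Function.update x 1 (max |x 1| 0))) (fun x => h (Function.update x 1 (max |x 1| 1))) := by
    have bd : ∀ t ∈ Icc (0:ℝ) 1, ∀ x : EE M, 1 ≤ ‖x‖ → h (Function.update x 1 (max |x 1| t)) = y0 M := by
      intro t ht x hx
      have : ∃ i, 1 ≤ |x i| := by
        by_contra hcon
        push Not at hcon
        have := (pi_norm_lt_iff (x := x) (one_pos)).2 hcon
        linarith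
      obtain ⟨i, hi⟩ := this
      by_cases h1 : i = 1
      · subst h1
        refine hcoord _ 1 ?_
        rw [Function.update_self, hp, Pi.single_eq_same]
        have := le_max_left |x 1| t
        rw [abs_of_nonneg (by linarith)]; linarith
      · refine hcoord _ i ?_
        rw [Function.update_of_ne h1, hp, Pi.single_eq_of_ne h1, sub_zero]; linarith
    refine HR.family (fun t x => h (Function.update x 1 (max |x 1| t))) (hhc.comp ?_) ?_
    · exact (continuous_snd).update 1 (by fun_prop)
    · intro t ht x hx
      rw [bd t ht x hx, bd 0 ⟨le_rfl, zero_le_one⟩ x hx]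
  have h6 : (fun x => h (Function.update x 1 (max |x 1| 1))) = fun _ => y0 M := by
    ext1 x
    refine hcoord _ 1 ?_
    rw [Function.update_self, hp, Pi.single_eq_same]
    have := le_max_right |x 1| 1
    rw [abs_of_nonneg (by linarith)]; linarith
  rw [h4] at h1
  rw [h6] at h5
  exact h3.symm.trans (h1.symm.trans h5)

noncomputable instance : Group (Cls M) :=
  { (inferInstance : Monoid (Cls M)) with
    inv := fun a => rrHom a
    inv_mul_cancel := by
      intro a
      induction a using cls_ind with
      | h f hf => exact cls_eq.2 (rr_mul_self hf) }

lemma inv_cls (f : EE M → SS M) (hf) : (cls f hf)⁻¹ = cls (f ∘ Rr) hf.Rr := rfl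

/-- the generator class -/
noncomputable def bb (M : ℕ) : Cls M := cls c0 c0_ball

open Matrix in
lemma cls_lin {A : MM M} (h : A.det ≠ 0) {s : ℝ} (hA : Ex A s) {β : EE M → SS M} (hβ : IsBall (y0 M) β) :
    cls (fun x => β (s • (A *ᵥ x))) (hA.ball hβ) = (cls β hβ) ^ (SignType.sign A.det : ℤ) := by
  rcases lt_or_gt_of_ne h with h | h
  · rw [sign_neg h]
    simp only [SignType.coe_neg_one, _root_.zpow_neg, _root_.zpow_one]
    rw [inv_cls, cls_eq]; exact lin_neg h hA hβ
  · rw [sign_pos h]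
    simp only [SignType.coe_one, _root_.zpow_one]
    rw [cls_eq]; exact lin_pos h hA hβ
end Inv

end RPX

namespace RPX
open Metric
open Set
set_option linter.unusedSectionVars false
set_option linter.unusedSimpArgs false
set_option linter.unusedVariables false
set_option linter.style.longLine false


section MultiBall
variable {M : ℕ}

/-- multi-ball maps -/
structure IsMB (P : Finset (EE M)) (σ : ℝ) (β : EE M → EE M → SS M) (f : EE M → SS M) : Prop where
  cont : Continuous f
  inside : ∀ p ∈ P, ∀ x, ‖x - p‖ ≤ σ → f x = β p (σ⁻¹ • (x - p))
  outside : ∀ x, (∀ p ∈ P, σ ≤ ‖x - p‖) → f x = y0 M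

/-- the path used for peeling -/
noncomputable def pth (p : EE M) (t : ℝ) : EE M :=
  Function.update (c01 (2 - 2 * t) • p) 0 ((1 - c01 (2 * t)) * p 0 + c01 (2 * t))

lemma continuous_pth (p : EE M) : Continuous (pth p) := by
  have := continuous_c01
  unfold pth
  exact Continuous.update (by fun_prop) 0 (by fun_prop)

lemma pth_zero (p : EE M) : pth p 0 = p := by
  unfold pth
  rw [c01_of_ge (by norm_num : (1:ℝ) ≤ 2 - 2 * 0)]
  simp

lemma pth_one (p : EE M) : pth p 1 = v0 M := by
  unfold pth
  rw [c01_of_ge (by norm_num : (1:ℝ) ≤ 2 * 1)]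
  simp [v0, Pi.single]

lemma pth_big (p : EE M) {t : ℝ} (ht : 1/2 ≤ t) : 1 ≤ ‖pth p t‖ := by
  have := norm_le_pi_norm (pth p t) 0
  unfold pth at this ⊢
  rw [c01_of_ge (by linarith : (1:ℝ) ≤ 2 * t)] at this ⊢
  simpa using this

lemma pth_small (p : EE M) (hp : ‖p‖ ≤ 1) {t : ℝ} (h0 : 0 ≤ t) (ht : t ≤ 1/2) :
    p 0 ≤ pth p t 0 ∧ ∀ i, i ≠ 0 → pth p t i = p i := by
  unfold pth
  rw [c01_of_ge (by linarith : (1:ℝ) ≤ 2 - 2 * t), c01_of_mem (⟨by linarith, by linarith⟩ : 2 * t ∈ Icc (0:ℝ) 1)]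
  refine ⟨?_, fun i hi => by simp [hi]⟩
  have h1 := norm_le_pi_norm p 0
  rw [Real.norm_eq_abs] at h1
  have := (abs_le.1 (h1.trans hp)).2
  simp; nlinarith

lemma multiball {σ : ℝ} (hσ : 0 < σ) {β : EE M → EE M → SS M} (hβ : ∀ p, IsBall (y0 M) (β p)) (k : EE M → ℤ)
    (P : Finset (EE M)) (hk : ∀ p ∈ P, cls (β p) (hβ p) = bb M ^ k p)
    (hP : ∀ p ∈ P, ‖p‖ + σ ≤ 1) (hPP : ∀ p ∈ P, ∀ q ∈ P, p ≠ q → 2 * σ ≤ ‖p - q‖)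
    {f : EE M → SS M} (hf : IsMB P σ β f) :
    ∃ hb : IsBall (y0 M) f, cls f hb = bb M ^ (∑ p ∈ P, k p) := by
  classical
  induction hn : P.card generalizing P f with
  | zero =>
    rw [Finset.card_eq_zero] at hn
    subst hn
    have : f = fun _ => y0 M := funext fun x => hf.outside x (by simp)
    subst this
    exact ⟨isBall_const _, by simp [cls_one]⟩
  | succ n ih =>
    have hne : P.Nonempty := by rw [← Finset.card_pos]; omega
    obtain ⟨p, hp, hmax⟩ := Finset.exists_max_image P (fun p => p 0) hne
    set g : EE M → SS M := fun x => if ‖x - p‖ ≤ σ then y0 M else f x with hg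
    set h : EE M → SS M := fun x => β p (σ⁻¹ • (x - p)) with hh
    have hfar : ∀ q ∈ P, q ≠ p → ∀ x, ‖x - p‖ ≤ σ → σ ≤ ‖x - q‖ := by
      intro q hq hqp x hx
      have h1 := hPP p hp q hq (Ne.symm hqp)
      have h2 : ‖p - q‖ ≤ ‖x - q‖ + ‖x - p‖ := by
        have : p - q = (x - q) - (x - p) := by abel
        rw [this]; exact norm_sub_le _ _
      linarith
    have hhout : ∀ x, σ ≤ ‖x - p‖ → h x = y0 M := by
      intro x hx
      refine (hβ p).2 _ ?_
      rw [norm_smul, norm_inv, Real.norm_of_nonneg hσ.le, inv_mul_eq_div, le_div_iff₀ hσ]; linarith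
    have hfsph : ∀ x, ‖x - p‖ = σ → f x = y0 M := by
      intro x hx
      rw [hf.inside p hp x hx.le]; exact hhout x hx.ge
    have hgc : Continuous g := by
      refine Continuous.if_le continuous_const hf.cont (by fun_prop) continuous_const ?_
      intro x hx; exact (hfsph x hx).symm
    have hgin : ∀ x, ‖x - p‖ ≤ σ → g x = y0 M := fun x hx => by simp [hg, hx]
    have hgout : ∀ x, σ ≤ ‖x - p‖ → g x = f x := by
      intro x hx
      rcases hx.lt_or_eq with h1 | h1
      · simp [hg, not_le.2 h1]
      · rw [hgin x h1.ge, hfsph x h1.symm]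
    have hov : ov (y0 M) g h = f := by
      ext1 x
      rcases le_total ‖x - p‖ σ with hx | hx
      · rw [ov_of_left (hgin x hx), hf.inside p hp x hx]
      · rw [ov_of_right (hhout x hx), hgout x hx]
    have hgMB : IsMB (P.erase p) σ β g := by
      refine ⟨hgc, ?_, ?_⟩
      · intro q hq x hx
        have hq' := Finset.mem_erase.1 hq
        rcases le_total ‖x - p‖ σ with h1 | h1
        · rw [hgin x h1]
          have h2 := hfar q hq'.2 hq'.1 x h1
          symm
          refine (hβ q).2 _ ?_
          rw [norm_smul, norm_inv, Real.norm_of_nonneg hσ.le, inv_mul_eq_div, le_div_iff₀ hσ]; linarith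
        · rw [hgout x h1, hf.inside q hq'.2 x hx]
      · intro x hx
        rcases le_total ‖x - p‖ σ with h1 | h1
        · exact hgin x h1
        · rw [hgout x h1]
          refine hf.outside x (fun q hq => ?_)
          by_cases hqp : q = p
          · rw [hqp]; exact h1
          · exact hx q (Finset.mem_erase.2 ⟨hqp, hq⟩)
    obtain ⟨hgb, hgcls⟩ := ih (P.erase p) (fun q hq => hk q (Finset.mem_of_mem_erase hq))
      (fun q hq => hP q (Finset.mem_of_mem_erase hq))
      (fun q hq r hr => hPP q (Finset.mem_of_mem_erase hq) r (Finset.mem_of_mem_erase hr)) hgMB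
      (by rw [Finset.card_erase_of_mem hp, hn]; rfl)
    have hpn := hP p hp
    have hpeel := peel (y0 := y0 M) (v := v0 M) (h := h) hgc ((hβ p).1.comp (by fun_prop)) hσ (by linarith) hgin hhout
      (continuous_pth p) (pth_zero p) (pth_one p) (by
        intro t ht
        rcases le_total t (1/2) with h1 | h1
        · obtain ⟨e1, e2⟩ := pth_small p (by linarith) ht.1 h1
          refine hgMB.outside _ (fun q hq => ?_)
          have hq' := Finset.mem_erase.1 hq
          have h2 := hPP p hp q hq'.2 (Ne.symm hq'.1)
          have h3 : ∃ i, 2 * σ ≤ |p i - q i| := by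
            by_contra hcon
            push Not at hcon
            have := (pi_norm_lt_iff (x := p - q) (by linarith : (0:ℝ) < 2 * σ)).2 hcon
            linarith
          obtain ⟨i, hi⟩ := h3
          have h4 := norm_le_pi_norm (pth p t - q) i
          simp only [Pi.sub_apply, Real.norm_eq_abs] at h4
          by_cases hi0 : i = 0
          · subst hi0
            have h5 := hmax q hq'.2
            rw [abs_of_nonneg (by linarith)] at hi h4
            linarith
          · rw [e2 i hi0] at h4; linarith
        · exact hgb.2 _ (pth_big p h1))
    rw [hov] at hpeel
    have h2 : (fun x => h (p + σ • x)) = β p := by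
      ext1 x; simp only [hh]; congr 1; simp [smul_smul, inv_mul_cancel₀ hσ.ne']
    rw [h2] at hpeel
    have hfb : IsBall (y0 M) f := hpeel.symm.isBall (st_ball hgb (hβ p))
    refine ⟨hfb, ?_⟩
    rw [(cls_eq (hf := hfb) (hg := st_ball hgb (hβ p))).2 hpeel, ← cls_mul hgb (hβ p), hgcls, hk p hp, ← zpow_add,
      Finset.sum_erase_add _ _ hp]
end MultiBall

end RPX

namespace RPX
open Metric
open Set
set_option linter.unusedSectionVars false
set_option linter.unusedSimpArgs false
set_option linter.unusedVariables false
set_option linter.style.longLine false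


section HopfReg
variable {M : ℕ}
open Matrix

/-- tail -/
def tl (w : VV M) : EE M := fun i => w i.succ

lemma mk_tl (w : VV M) : mk (w 0) (tl w) = w := mk_eta w

@[simp] lemma tl_mk (a : ℝ) (z : EE M) : tl (mk a z) = z := by ext i; simp [tl]
@[simp] lemma tl_add (v w : VV M) : tl (v + w) = tl v + tl w := by ext i; simp [tl]
@[simp] lemma tl_smul (c : ℝ) (w : VV M) : tl (c • w) = c • tl w := by ext i; simp [tl]
@[simp] lemma tl_y0 : tl ((y0 M : SS M) : VV M) = 0 := by rw [← mk_one_zero, tl_mk]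
@[simp] lemma y0_zero : ((y0 M : SS M) : VV M) 0 = 1 := by rw [← mk_one_zero, mk_zero]

lemma exists_Ex {A : MM M} (h : A.det ≠ 0) : ∃ s, Ex A s := by
  obtain ⟨K, hK, hK'⟩ := LinearMap.exists_antilipschitzWith (Matrix.mulVecLin A) (by
    rw [LinearMap.ker_eq_bot']
    intro x hx
    exact Matrix.eq_zero_of_mulVec_eq_zero h hx)
  refine ⟨K, by exact_mod_cast hK, fun x => ?_⟩
  have := hK'.le_mul_dist x 0
  simpa [dist_eq_norm] using this

lemma hopf_reg {F : EE M → VV M} (hF : Continuous F) (h0 : ∀ x, F x ≠ 0) (hbd : ∀ x, 1 ≤ ‖x‖ → F x = y0 M)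
    (Z : Finset (EE M)) (hZ : ∀ x, x ∈ Z ↔ (F x 0 ≤ 0 ∧ tl (F x) = 0)) (A : EE M → MM M)
    (hA : ∀ p, (A p).det ≠ 0)
    (hder : ∀ p ∈ Z, ∃ ε > 0, ∀ x, ‖x - p‖ ≤ ε → x ≠ p → ‖tl (F x) - A p *ᵥ (x - p)‖ < ‖A p *ᵥ (x - p)‖) :
    ∃ hb : IsBall (y0 M) (fun x => toS (F x)),
      cls (fun x => toS (F x)) hb = bb M ^ (∑ p ∈ Z, (SignType.sign (A p).det : ℤ)) := by
  classical
  choose! ε hε hder using hder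
  choose s hs using fun p => exists_Ex (hA p)
  have hZ1 : ∀ p ∈ Z, ‖p‖ < 1 := by
    intro p hp
    by_contra hcon
    have h1 := ((hZ p).1 hp).1
    rw [hbd p (not_lt.1 hcon), y0_zero] at h1
    linarith
  have hev : ∀ c : ℝ, 0 < c → ∀ᶠ σ in nhdsWithin (0:ℝ) (Ioi 0), σ ≤ c := by
    intro c hc
    filter_upwards [Ioc_mem_nhdsGT hc] with σ hσ using hσ.2
  have e1 : ∀ᶠ σ in nhdsWithin (0:ℝ) (Ioi 0), ∀ p ∈ Z, σ ≤ ε p :=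
    (Filter.eventually_all_finset Z).2 (fun p hp => hev _ (hε p hp))
  have e2 : ∀ᶠ σ in nhdsWithin (0:ℝ) (Ioi 0), ∀ p ∈ Z, σ ≤ 1 - ‖p‖ :=
    (Filter.eventually_all_finset Z).2 (fun p hp => hev _ (by linarith [hZ1 p hp]))
  have e3 : ∀ᶠ σ in nhdsWithin (0:ℝ) (Ioi 0), ∀ p ∈ Z, ∀ q ∈ Z, p ≠ q → σ ≤ ‖p - q‖ / 2 :=
    (Filter.eventually_all_finset Z).2 (fun p hp => (Filter.eventually_all_finset Z).2 (fun q hq => by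
      by_cases hpq : p = q
      · simp [hpq]
      · filter_upwards [hev (‖p - q‖ / 2) (by
          have := norm_pos_iff.2 (sub_ne_zero.2 hpq); linarith)] with σ hσ _ using hσ))
  obtain ⟨σ, ⟨⟨k1, k2⟩, k3⟩, hσ⟩ := (((e1.and e2).and e3).and self_mem_nhdsWithin).exists
  have hσ : 0 < σ := hσ
  set L : EE M → EE M → EE M := fun p x => s p • (A p *ᵥ (σ⁻¹ • (x - p))) with hL
  have hLc : ∀ p, Continuous (L p) := fun p => by
    simp only [hL]; fun_prop
  have hLbig : ∀ p x, σ ≤ ‖x - p‖ → 1 ≤ ‖L p x‖ := by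
    intro p x hx
    simp only [hL]
    rw [norm_smul, Real.norm_of_nonneg (hs p).1.le]
    refine le_trans ?_ ((hs p).2 _)
    rw [norm_smul, norm_inv, Real.norm_of_nonneg hσ.le, inv_mul_eq_div, le_div_iff₀ hσ]; linarith
  set G : EE M → VV M := fun x => (y0 M : SS M) + ∑ p ∈ Z, (c0v (L p x) - (y0 M : SS M)) with hG
  have hGc : Continuous G := by
    simp only [hG]
    refine continuous_const.add (continuous_finsetSum _ (fun p _ => ?_))
    exact (continuous_c0v.comp (hLc p)).sub continuous_const
  have hfar : ∀ p ∈ Z, ∀ q ∈ Z, q ≠ p → ∀ x, ‖x - p‖ ≤ σ → σ ≤ ‖x - q‖ := by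
    intro p hp q hq hqp x hx
    have h1 := k3 p hp q hq (Ne.symm hqp)
    have h2 : ‖p - q‖ ≤ ‖x - q‖ + ‖x - p‖ := by
      have : p - q = (x - q) - (x - p) := by abel
      rw [this]; exact norm_sub_le _ _
    linarith
  have hGin : ∀ p ∈ Z, ∀ x, ‖x - p‖ ≤ σ → G x = c0v (L p x) := by
    intro p hp x hx
    simp only [hG]
    rw [Finset.sum_eq_single_of_mem p hp]
    · abel
    · intro q hq hqp
      rw [c0v_out (hLbig q x (hfar p hp q hq hqp x hx)), sub_self]
  have hGout : ∀ x, (∀ p ∈ Z, σ ≤ ‖x - p‖) → G x = (y0 M : SS M) := by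
    intro x hx
    simp only [hG]
    rw [Finset.sum_eq_zero, add_zero]
    intro p hp
    rw [c0v_out (hLbig p x (hx p hp)), sub_self]
  have hMB : IsMB Z σ (fun p x => c0 (s p • (A p *ᵥ x))) (fun x => toS (G x)) := by
    refine ⟨continuous_toS hGc ?_, ?_, ?_⟩
    · intro x
      by_cases hx : ∃ p ∈ Z, ‖x - p‖ ≤ σ
      · obtain ⟨p, hp, hx⟩ := hx
        rw [hGin p hp x hx]; exact c0v_ne _
      · push Not at hx
        rw [hGout x (fun p hp => (hx p hp).le)]; exact SS_ne _
    · intro p hp x hx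
      simp only [hGin p hp x hx]; rfl
    · intro x hx
      simp only [hGout x hx, toS_self]
  obtain ⟨hb, hcls⟩ := multiball hσ (fun p => (hs p).ball c0_ball) (fun p => (SignType.sign (A p).det : ℤ)) Z
    (fun p hp => cls_lin (hA p) (hs p) c0_ball) (fun p hp => by linarith [k2 p hp])
    (fun p hp q hq hpq => by linarith [k3 p hp q hq hpq]) hMB
  have hline : HR (fun x => toS (F x)) (fun x => toS (G x)) := by
    refine HR_toS hF hGc ?_ ?_
    · intro t ht x hcon
      have c1 : (1 - t) * F x 0 + t * G x 0 = 0 := by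
        have := congrArg (fun w : VV M => w 0) hcon; simpa using this
      have c2 : (1 - t) • tl (F x) + t • tl (G x) = 0 := by
        have := congrArg (fun w : VV M => tl w) hcon
        simp only [tl_add, tl_smul] at this
        rw [this]; rfl
      by_cases hx : ∃ p ∈ Z, ‖x - p‖ ≤ σ
      · obtain ⟨p, hp, hx⟩ := hx
        rw [hGin p hp x hx] at c1 c2 hcon
        by_cases ht1 : t = 1
        · subst ht1; simp at hcon; exact c0v_ne _ hcon
        have ht1' : 0 < 1 - t := by
          have := lt_of_le_of_ne ht.2 ht1; linarith
        by_cases hxp : x = p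
        · subst hxp
          have hL0 : L x x = 0 := by simp [hL]
          rw [hL0] at c1
          have h3 : c0v (0 : EE M) 0 = -1 := by simp [c0v]
          have h4 : F x 0 ≠ 0 := by
            intro h4
            apply h0 x
            rw [← mk_tl (F x), h4, ((hZ x).1 hp).2]
            rw [mk_eq_iff]; simp
          have h5 := lt_of_le_of_ne ((hZ x).1 hp).1 h4
          rw [h3] at c1
          nlinarith [ht.1, mul_neg_of_pos_of_neg ht1' h5]
        · have h6 := hder p hp x (hx.trans (k1 p hp)) hxp
          set w := A p *ᵥ (x - p) with hw
          have h7 : tl (c0v (L p x)) = (max (1 - ‖L p x‖) 0 * s p * σ⁻¹) • w := by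
            rw [c0v, tl_mk]
            simp only [hL, Matrix.mulVec_smul, smul_smul, hw]
            ring_nf
          rw [h7, smul_smul] at c2
          set c := t * (max (1 - ‖L p x‖) 0 * s p * σ⁻¹) with hc
          have hc0 : 0 ≤ c := by
            have := ht.1; have := (hs p).1; positivity
          have h8 : tl (F x) = (-(c / (1 - t))) • w := by
            have : (1 - t) • tl (F x) = (-c) • w := by
              rw [neg_smul]; exact eq_neg_of_add_eq_zero_left c2
            calc tl (F x) = (1 - t)⁻¹ • ((1 - t) • tl (F x)) := by
                  rw [smul_smul, inv_mul_cancel₀ ht1'.ne', one_smul]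
              _ = _ := by rw [this, smul_smul]; congr 1; field_simp
          have h9 : tl (F x) - w = (-(c / (1 - t) + 1)) • w := by
            rw [h8]; module
          have hd : 0 ≤ c / (1 - t) := div_nonneg hc0 ht1'.le
          rw [h9, norm_smul, norm_neg, Real.norm_of_nonneg (by linarith)] at h6
          nlinarith [norm_nonneg w]
      · push Not at hx
        rw [hGout x (fun p hp => (hx p hp).le)] at c1 c2
        simp only [y0_zero, tl_y0, smul_zero, add_zero, mul_one] at c1 c2
        by_cases ht1 : t = 1
        · subst ht1; simp at c1
        have ht1' : 0 < 1 - t := by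
          have := lt_of_le_of_ne ht.2 ht1; linarith
        have h3 : tl (F x) = 0 := (smul_eq_zero.1 c2).resolve_left ht1'.ne'
        have h4 : F x 0 ≤ 0 := by
          by_contra hcon
          nlinarith [mul_pos ht1' (not_le.1 hcon), ht.1]
        have := hx x ((hZ x).2 ⟨h4, h3⟩)
        simp at this; linarith
    · intro x hx
      rw [hbd x hx, hGout]
      intro p hp
      have h1 := k2 p hp
      have h2 := norm_sub_norm_le x p
      linarith
  have hFb := hline.symm.isBall hb
  exact ⟨hFb, by rw [← hcls]; exact cls_eq.2 hline⟩
end HopfReg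

end RPX

namespace RPX
open Metric
open Set
set_option linter.unusedSectionVars false
set_option linter.unusedSimpArgs false
set_option linter.unusedVariables false
set_option linter.style.longLine false


section Transv
variable {M : ℕ}
open Matrix

lemma continuous_tl : Continuous (tl : VV M → EE M) := by
  unfold tl; fun_prop
lemma contDiff_tl : ContDiff ℝ 1 (tl : VV M → EE M) := by
  unfold tl; fun_prop
lemma continuous_hd : Continuous (fun w : VV M => w 0) := by fun_prop

lemma abs_coord_le (w : VV M) (i) : |w i| ≤ ‖w‖ := by
  simpa using PiLp.norm_apply_le w i

/-- a smooth approximation of a ball map -/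
lemma smooth_approx {f : EE M → SS M} (hf : IsBall (y0 M) f) {δ : ℝ} (hδ : 0 < δ) :
    ∃ g : EE M → VV M, ContDiff ℝ 1 g ∧ (∀ x, ‖g x - f x‖ < δ) ∧ (∀ x, 1 ≤ ‖x‖ → g x = y0 M) ∧
      ((∀ x, f (-x) = f x) → ∀ x, g (-x) = g x) := by
  have hc : Continuous (fun x => ((f x : VV M) - (y0 M : SS M))) := (continuous_subtype_val.comp hf.1).sub continuous_const
  obtain ⟨g, g1, g2, g3⟩ := hc.exists_contDiff_approx 1 (continuous_const (y := δ)) (fun _ => hδ)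
  have g4 : ∀ x, 1 ≤ ‖x‖ → g x = 0 := by
    intro x hx
    by_contra hcon
    have := g3 (Function.mem_support.2 hcon)
    rw [Function.mem_support] at this
    apply this
    rw [hf.2 x hx, sub_self]
  have g2' : ∀ x, ‖g x + (y0 M : SS M) - f x‖ < δ := by
    intro x
    have := g2 x
    rw [dist_eq_norm] at this
    have e : g x + (y0 M : SS M) - f x = g x - ((f x : VV M) - (y0 M : SS M)) := by abel
    rw [e]; exact this
  by_cases hev : ∀ x, f (-x) = f x
  · refine ⟨fun x => (1/2:ℝ) • ((g x + (y0 M : SS M)) + (g (-x) + (y0 M : SS M))), ?_, ?_, ?_, ?_⟩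
    · exact ((g1.add contDiff_const).add ((g1.comp contDiff_neg).add contDiff_const)).const_smul _
    · intro x
      have h1 := g2' x
      have h2 := g2' (-x)
      rw [hev x] at h2
      have : (1/2:ℝ) • ((g x + (y0 M : SS M)) + (g (-x) + (y0 M : SS M))) - (f x : VV M)
        = (1/2:ℝ) • ((g x + (y0 M : SS M) - f x) + (g (-x) + (y0 M : SS M) - f x)) := by
        module
      rw [this, norm_smul]
      have := norm_add_le (g x + (y0 M : SS M) - (f x : VV M)) (g (-x) + (y0 M : SS M) - (f x : VV M))
      norm_num; linarith
    · intro x hx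
      simp only [g4 x hx, g4 (-x) (by rwa [norm_neg])]
      module
    · intro _ x
      simp only [neg_neg]; congr 1; exact add_comm _ _
  · exact ⟨fun x => g x + (y0 M : SS M), g1.add contDiff_const, g2', fun x hx => by simp [g4 x hx], fun h => absurd h hev⟩

lemma near_ne {v w : VV M} (hw : ‖w‖ = 1) (h : ‖v - w‖ < 1) {t : ℝ} (ht : t ∈ Icc (0:ℝ) 1) : (1 - t) • w + t • v ≠ 0 := by
  intro h0
  have : w = - (t • (v - w)) := by
    have : (1 - t) • w + t • v = w + t • (v - w) := by module
    rw [this] at h0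
    exact eq_neg_of_add_eq_zero_left h0
  have h1 : ‖w‖ = t * ‖v - w‖ := by
    conv_lhs => rw [this]
    rw [norm_neg, norm_smul, Real.norm_of_nonneg ht.1]
  nlinarith [norm_nonneg (v - w), ht.1, ht.2]

lemma near_HR {f : EE M → SS M} (hf : IsBall (y0 M) f) {F : EE M → VV M} (hF : Continuous F)
    (h : ∀ x, ‖F x - f x‖ < 1) (hb : ∀ x, 1 ≤ ‖x‖ → F x = y0 M) : HR f (fun x => toS (F x)) := by
  have := HR_toS (F := fun x => (f x : VV M)) (G := F) (continuous_subtype_val.comp hf.1) hF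
    (fun t ht x => near_ne (norm_SS _) (h x) ht) (fun x hx => by rw [hf.2 x hx, hb x hx])
  simpa using this

lemma deriv_near {φ : EE M → EE M} {L : EE M →L[ℝ] EE M} {p : EE M} (h : HasFDerivAt φ L p) (h0 : φ p = 0) {A : MM M}
    (hA : ∀ x, A *ᵥ x = L x) (hd : A.det ≠ 0) :
    ∃ ε > 0, ∀ x, ‖x - p‖ ≤ ε → x ≠ p → ‖φ x - A *ᵥ (x - p)‖ < ‖A *ᵥ (x - p)‖ := by
  obtain ⟨s, hs0, hs⟩ := exists_Ex hd
  have h1 := h.isLittleO.def (c := (2 * s)⁻¹) (by positivity)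
  obtain ⟨ε, hε, h2⟩ := Metric.eventually_nhds_iff.1 h1
  refine ⟨ε / 2, by positivity, fun x hx hxp => ?_⟩
  have h3 := h2 (y := x) (by rw [dist_eq_norm]; linarith)
  rw [h0, sub_zero] at h3
  rw [hA]
  have h4 := hs (x - p)
  rw [hA] at h4
  have h5 : 0 < ‖x - p‖ := norm_pos_iff.2 (sub_ne_zero.2 hxp)
  have h6 : (2 * s)⁻¹ * ‖x - p‖ < ‖L (x - p)‖ := by
    rw [inv_mul_lt_iff₀ (by positivity)]
    nlinarith
  linarith

lemma transv {f : EE M → SS M} (hf : IsBall (y0 M) f) :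
    ∃ (F : EE M → VV M) (Z : Finset (EE M)) (L : EE M → EE M →L[ℝ] EE M), Continuous F ∧ (∀ x, F x ≠ 0) ∧
      (∀ x, 1 ≤ ‖x‖ → F x = y0 M) ∧ HR f (fun x => toS (F x)) ∧ (∀ x, x ∈ Z ↔ (F x 0 ≤ 0 ∧ tl (F x) = 0)) ∧
      (∀ p ∈ Z, HasFDerivAt (fun x => tl (F x)) (L p) p ∧ (L p).det ≠ 0) ∧
      ((∀ x, f (-x) = f x) → ∀ x, F (-x) = F x) := by
  obtain ⟨g, g1, g2, g3, g4⟩ := smooth_approx hf (δ := 1/8) (by norm_num)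
  set a : EE M → ℝ := fun x => g x 0 with ha
  set z : EE M → EE M := fun x => tl (g x) with hz
  have hac : ContDiff ℝ 1 a := by simp only [ha]; fun_prop
  have hzc : ContDiff ℝ 1 z := contDiff_tl.comp g1
  set u : EE M → EE M := fun x => (1 - a x)⁻¹ • z x with hu
  have hud : ∀ x, a x < 1 → DifferentiableAt ℝ u x := by
    intro x hx
    have h1 := hac.differentiable (by norm_num) x
    have h2 := hzc.differentiable (by norm_num) x
    exact ((h1.const_sub 1).inv (by linarith)).smul h2
  set s : Set (EE M) := {x | a x < 1 ∧ (fderiv ℝ u x).det = 0} with hs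
  have hsard : MeasureTheory.volume (u '' s) = 0 :=
    MeasureTheory.addHaar_image_eq_zero_of_det_fderivWithin_eq_zero MeasureTheory.volume
      (fun x hx => (hud x hx.1).hasFDerivAt.hasFDerivWithinAt) (fun x hx => hx.2)
  have hdense : Dense (u '' s)ᶜ := by
    have : ∀ᵐ x ∂(MeasureTheory.volume : MeasureTheory.Measure (EE M)), x ∉ u '' s :=
      MeasureTheory.measure_eq_zero_iff_ae_notMem.1 hsard
    exact MeasureTheory.Measure.dense_of_ae this
  have hopen : IsOpen {ζ : EE M | ‖mk 0 (-ζ)‖ < 1/16} :=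
    isOpen_lt (continuous_mk continuous_const continuous_neg).norm continuous_const
  obtain ⟨ζ', hζ1, hζ2⟩ := hdense.inter_open_nonempty _ hopen ⟨0, by
    have : mk 0 (-0 : EE M) = 0 := by rw [mk_eq_iff]; simp
    simp only [mem_ofPred_eq, this]; norm_num⟩
  set ζ := -ζ' with hζ
  simp only [mem_ofPred_eq] at hζ1
  set F : EE M → VV M := fun x => mk (a x) (z x + (1 - a x) • ζ) with hF
  have hFg : ∀ x, F x = g x + (1 - a x) • mk 0 ζ := by
    intro x
    conv_rhs => rw [← mk_tl (g x), mk_smul, mk_add]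
    simp [hF, ha, hz]
  have hFc : Continuous F := continuous_mk hac.continuous (hzc.continuous.add
    ((continuous_const.sub hac.continuous).smul continuous_const))
  have hab : ∀ x, |1 - a x| ≤ 3 := by
    intro x
    have h1 := abs_coord_le (g x) 0
    have h2 : ‖g x‖ ≤ ‖g x - f x‖ + ‖(f x : VV M)‖ := by simpa using norm_add_le (g x - f x) (f x : VV M)
    rw [norm_SS] at h2
    have h3 := g2 x
    have h4 : |a x| ≤ 2 := by simp only [ha]; linarith
    rw [abs_le] at h4 ⊢
    constructor <;> linarith [h4.1, h4.2]
  have hFf : ∀ x, ‖F x - f x‖ < 1 := by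
    intro x
    have h1 : F x - f x = (g x - f x) + (1 - a x) • mk 0 ζ := by rw [hFg]; abel
    rw [h1]
    refine (norm_add_le _ _).trans_lt ?_
    rw [norm_smul, Real.norm_eq_abs]
    have := g2 x
    have := hab x
    nlinarith [norm_nonneg (mk 0 ζ), abs_nonneg (1 - a x)]
  have hFb : ∀ x, 1 ≤ ‖x‖ → F x = y0 M := by
    intro x hx
    have : a x = 1 := by simp [ha, g3 x hx]
    rw [hFg, g3 x hx, this]; simp
  have hFne : ∀ x, F x ≠ 0 := by
    intro x h0
    have h1 := hFf x
    rw [h0, zero_sub, norm_neg, norm_SS] at h1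
    linarith
  have htl : ∀ x, tl (F x) = z x + (1 - a x) • ζ := fun x => by simp [hF]
  have hF0 : ∀ x, F x 0 = a x := fun x => by simp [hF]
  set Zs : Set (EE M) := {x | F x 0 ≤ 0 ∧ tl (F x) = 0} with hZs
  have hder : ∀ p ∈ Zs, ∃ L : EE M →L[ℝ] EE M, HasFDerivAt (fun x => tl (F x)) L p ∧ L.det ≠ 0 := by
    intro p hp
    have hap : a p ≤ 0 := by rw [← hF0]; exact hp.1
    have hzp : z p + (1 - a p) • ζ = 0 := by rw [← htl]; exact hp.2
    have hup : u p = -ζ := by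
      simp only [hu]
      rw [eq_neg_of_add_eq_zero_left hzp, smul_neg, smul_smul, inv_mul_cancel₀ (by linarith), one_smul]
    have hdet : (fderiv ℝ u p).det ≠ 0 := by
      intro h0
      exact hζ2 ⟨p, ⟨by linarith, h0⟩, by rw [hup, hζ, neg_neg]⟩
    have h1 : HasFDerivAt (fun x => (1 - a x) • (u x + ζ)) _ p :=
      HasFDerivAt.smul (((hac.differentiable (by norm_num) p).const_sub 1).hasFDerivAt) (((hud p (by linarith)).hasFDerivAt).add_const ζ)
    rw [hup] at h1
    simp only [neg_add_cancel, ContinuousLinearMap.smulRight_zero, add_zero] at h1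
    refine ⟨_, h1.congr_of_eventuallyEq ?_, ?_⟩
    · have : ∀ᶠ x in nhds p, a x < 1 := hac.continuous.continuousAt.eventually_lt continuousAt_const (by linarith)
      filter_upwards [this] with x hx
      rw [htl, smul_add]
      simp only [hu]
      rw [smul_smul, mul_inv_cancel₀ (by linarith), one_smul]
    · rw [ContinuousLinearMap.det, ContinuousLinearMap.toLinearMap_smul, LinearMap.det_smul]
      exact mul_ne_zero (pow_ne_zero _ (by linarith)) hdet
  choose! L hL using hder
  have hcl : IsClosed Zs := (isClosed_le (continuous_hd.comp hFc) continuous_const).inter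
    (isClosed_eq (continuous_tl.comp hFc) continuous_const)
  have hcpt : IsCompact Zs := by
    refine (isCompact_closedBall (0 : EE M) 1).of_isClosed_subset hcl ?_
    intro x hx
    rw [mem_closedBall_zero_iff]
    by_contra hcon
    have h1 := hx.1
    rw [hFb x (not_le.1 hcon).le, y0_zero] at h1
    linarith
  have hfin : Zs.Finite := by
    have hiso : ∀ p ∈ Zs, ∃ U ∈ nhds p, ∀ x ∈ Zs, x ∈ U → x = p := by
      intro p hp
      have hLp := hL p hp
      obtain ⟨ε, hε, h1⟩ := deriv_near (A := LinearMap.toMatrix' (L p : EE M →ₗ[ℝ] EE M)) hLp.1 hp.2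
        (fun x => by simp [LinearMap.toMatrix'_mulVec]) (by rw [LinearMap.det_toMatrix']; exact hLp.2)
      refine ⟨ball p ε, ball_mem_nhds p hε, fun x hx hxU => ?_⟩
      by_contra hxp
      have h2 := h1 x (by rw [mem_ball, dist_eq_norm] at hxU; exact hxU.le) hxp
      rw [hx.2, zero_sub, norm_neg] at h2
      exact lt_irrefl _ h2
    choose! U hU hU' using hiso
    obtain ⟨t, ht, ht'⟩ := hcpt.elim_nhds_subcover U hU
    refine t.finite_toSet.subset (fun x hx => ?_)
    obtain ⟨p, hp, hxp⟩ := mem_iUnion₂.1 (ht' hx)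
    rw [hU' p (ht p hp) x hx hxp]; exact hp
  refine ⟨F, hfin.toFinset, L, hFc, hFne, hFb, near_HR hf hFc hFf hFb, fun x => by simp [hZs], fun p hp => ?_, ?_⟩
  · exact hL p (by simpa using hp)
  · intro hev x
    rw [hFg, hFg]
    simp only [ha, g4 hev x]

/-- matrix of a derivative -/
noncomputable def mat (L : EE M →L[ℝ] EE M) : MM M := by
  classical exact if L.det = 0 then 1 else LinearMap.toMatrix' (L : EE M →ₗ[ℝ] EE M)

lemma mat_det (L : EE M →L[ℝ] EE M) : (mat L).det ≠ 0 := by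
  unfold mat
  split_ifs with h
  · simp
  · rw [LinearMap.det_toMatrix']; exact h

lemma mat_det_eq {L : EE M →L[ℝ] EE M} (h : L.det ≠ 0) : (mat L).det = L.det := by
  unfold mat
  rw [if_neg h, LinearMap.det_toMatrix']

lemma mat_mulVec {L : EE M →L[ℝ] EE M} (h : L.det ≠ 0) (x : EE M) : mat L *ᵥ x = L x := by
  unfold mat
  rw [if_neg h, LinearMap.toMatrix'_mulVec]; rfl

lemma hopf_sum {f : EE M → SS M} (hf : IsBall (y0 M) f) :
    ∃ (F : EE M → VV M) (Z : Finset (EE M)) (L : EE M → EE M →L[ℝ] EE M),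
      (∀ x, x ∈ Z ↔ (F x 0 ≤ 0 ∧ tl (F x) = 0)) ∧
      (∀ p ∈ Z, HasFDerivAt (fun x => tl (F x)) (L p) p ∧ (L p).det ≠ 0) ∧
      ((∀ x, f (-x) = f x) → ∀ x, F (-x) = F x) ∧
      cls f hf = bb M ^ (∑ p ∈ Z, (SignType.sign (L p).det : ℤ)) := by
  obtain ⟨F, Z, L, h1, h2, h3, h4, h5, h6, h7⟩ := transv hf
  refine ⟨F, Z, L, h5, h6, h7, ?_⟩
  obtain ⟨hb, hc⟩ := hopf_reg h1 h2 h3 Z h5 (fun p => mat (L p)) (fun p => mat_det _) (fun p hp =>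
    deriv_near (h6 p hp).1 ((h5 p).1 hp).2 (mat_mulVec (h6 p hp).2) (mat_det _))
  rw [(cls_eq (hf := hf) (hg := hb)).2 h4, hc]
  congr 1
  refine Finset.sum_congr rfl (fun p hp => ?_)
  rw [mat_det_eq (h6 p hp).2]

theorem hopf (a : Cls M) : ∃ k : ℤ, a = bb M ^ k := by
  induction a using cls_ind with
  | h f hf =>
    obtain ⟨F, Z, L, h1, h2, h3, h4⟩ := hopf_sum hf
    exact ⟨_, h4⟩

theorem hopf_even (hM : Even M) {f : EE M → SS M} (hf : IsBall (y0 M) f) (hev : ∀ x, f (-x) = f x) :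
    ∃ j : ℤ, cls f hf = bb M ^ (2 * j) := by
  obtain ⟨F, Z, L, h1, h2, h3, h4⟩ := hopf_sum hf
  have hFev := h3 hev
  have hnegZ : ∀ p ∈ Z, -p ∈ Z := by
    intro p hp
    rw [h1, hFev p]; exact (h1 p).1 hp
  have hLneg : ∀ p ∈ Z, L (-p) = -L p := by
    intro p hp
    have e1 := (h2 p hp).1
    have e2 := (h2 (-p) (hnegZ p hp)).1
    have e3 : HasFDerivAt (fun x => tl (F (-x))) ((L (-p)).comp (-ContinuousLinearMap.id ℝ (EE M))) p :=
      HasFDerivAt.comp p e2 (hasFDerivAt_id p).neg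
    simp only [hFev] at e3
    have e4 := e1.unique e3
    rw [e4]
    ext x; simp
  have hsgn : ∀ p ∈ Z, (SignType.sign (L (-p)).det : ℤ) = SignType.sign (L p).det := by
    intro p hp
    rw [hLneg p hp]
    have : (-L p).det = (L p).det := by
      rw [← neg_one_smul ℝ (L p)]
      rw [ContinuousLinearMap.det, ContinuousLinearMap.toLinearMap_smul, LinearMap.det_smul]
      rw [Module.finrank_fin_fun, Even.neg_one_pow (hM.add (by decide)), one_mul]
    rw [this]
  have hne : ∀ p ∈ Z, -p ≠ p := by
    intro p hp h
    have e1 := hLneg p hp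
    rw [h] at e1
    have e2 : L p = 0 := by
      have : (2:ℝ) • L p = 0 := by rw [two_smul]; nth_rewrite 1 [e1]; simp
      exact (smul_eq_zero.1 this).resolve_left two_ne_zero
    apply (h2 p hp).2
    rw [e2]
    rw [ContinuousLinearMap.det, ContinuousLinearMap.toLinearMap_zero, LinearMap.det_zero]; simp
  have hsum : ((∑ p ∈ Z, (SignType.sign (L p).det : ℤ) : ℤ) : ZMod 2) = 0 := by
    rw [Int.cast_sum]
    refine Finset.sum_involution (fun p _ => -p) ?_ (fun p hp _ => hne p hp) (fun p hp => hnegZ p hp) (fun p hp => neg_neg p)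
    intro p hp
    rw [hsgn p hp, ← two_mul, show (2 : ZMod 2) = 0 from rfl, zero_mul]
  obtain ⟨j, hj⟩ := (ZMod.intCast_zmod_eq_zero_iff_dvd _ 2).1 hsum
  exact ⟨j, by rw [h4, hj]; rfl⟩
end Transv

end RPX

namespace RPX
open Metric
open Set
set_option linter.unusedSectionVars false
set_option linter.unusedSimpArgs false
set_option linter.unusedVariables false
set_option linter.style.longLine false


section NL
open MeasureTheory
variable {V : Type*} [NormedAddCommGroup V] [InnerProductSpace ℝ V] [FiniteDimensional ℝ V] [MeasurableSpace V] [BorelSpace V]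

lemma det_pos_of {L : V →L[ℝ] V} (h : ∀ w, w ≠ 0 → 0 < inner ℝ (L w) w) : 0 < L.det := by
  by_contra hcon
  push Not at hcon
  let K : ℝ → V →L[ℝ] V := fun t => t • L + (1 - t) • ContinuousLinearMap.id ℝ V
  have hK : Continuous (fun t => (K t).det) := ContinuousLinearMap.continuous_det.comp (by fun_prop)
  have h0 : (K 0).det = 1 := by simp [K, ContinuousLinearMap.det]
  have h1 : (K 1).det = L.det := by simp [K]
  obtain ⟨t, ht, hz⟩ := intermediate_value_Icc' (zero_le_one) hK.continuousOn (show (0:ℝ) ∈ Icc ((K 1).det) ((K 0).det) by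
    rw [h0, h1]; exact ⟨hcon, zero_le_one⟩)
  have hker : ∃ w, w ≠ 0 ∧ K t w = 0 := by
    have : ¬ Function.Injective (K t : V →ₗ[ℝ] V) := by
      intro hinj
      have hu : IsUnit (K t : V →ₗ[ℝ] V) := (LinearMap.isUnit_iff_ker_eq_bot _).2 (LinearMap.ker_eq_bot.2 hinj)
      have := (LinearMap.isUnit_iff_isUnit_det _).1 hu
      exact this.ne_zero hz
    rw [injective_iff_map_eq_zero] at this
    push Not at this
    obtain ⟨w, hw, hw'⟩ := this
    exact ⟨w, hw', hw⟩
  obtain ⟨w, hw, hw0⟩ := hker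
  have e : inner ℝ (K t w) w = t * inner ℝ (L w) w + (1 - t) * inner ℝ w w := by
    simp [K, inner_add_left, inner_smul_left]
  rw [hw0, inner_zero_left] at e
  have p1 := h w hw
  have p2 : 0 < inner ℝ w w := real_inner_self_pos.2 hw
  rcases eq_or_lt_of_le ht.1 with h | h
  · rw [← h] at e; linarith
  · have := mul_pos h p1
    have := mul_nonneg (sub_nonneg.2 ht.2) p2.le
    linarith

lemma det_nonneg_of {L : V →L[ℝ] V} (h : ∀ w, 0 ≤ inner ℝ (L w) w) : 0 ≤ L.det := by
  have hK : Continuous (fun t : ℝ => (L + t • ContinuousLinearMap.id ℝ V).det) :=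
    ContinuousLinearMap.continuous_det.comp (by fun_prop)
  have h1 : Filter.Tendsto (fun t : ℝ => (L + t • ContinuousLinearMap.id ℝ V).det) (nhdsWithin 0 (Ioi 0)) (nhds L.det) := by
    have := hK.tendsto 0
    simp only [zero_smul, add_zero] at this
    exact this.mono_left nhdsWithin_le_nhds
  refine ge_of_tendsto h1 ?_
  filter_upwards [self_mem_nhdsWithin] with t ht
  refine (det_pos_of (fun w hw => ?_)).le
  have := h w
  have p2 : 0 < inner ℝ w w := real_inner_self_pos.2 hw
  simp only [_root_.add_apply, inner_add_left, _root_.smul_apply, inner_smul_left, ContinuousLinearMap.id_apply]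
  have : 0 < t * inner ℝ w w := mul_pos ht p2
  rw [real_inner_self_eq_norm_sq] at this
  simp; linarith

lemma vol_eq {G G' : V → V} (hG : ContDiff ℝ 1 G) (hG' : ContDiff ℝ 1 G') {K : Set V} (hK : IsCompact K)
    (hGG : ∀ v, v ∉ K → G v = G' v) {C : NNReal} (h1 : LipschitzWith C G) (h2 : LipschitzWith C G') {l : ℝ} (hl : C < l) :
    ∫ v in K, (l • ContinuousLinearMap.id ℝ V + fderiv ℝ G v).det = ∫ v in K, (l • ContinuousLinearMap.id ℝ V + fderiv ℝ G' v).det := by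
  have hl0 : 0 < l := lt_of_le_of_lt C.2 hl
  have key : ∀ {G : V → V} (hG : ContDiff ℝ 1 G) (h1 : LipschitzWith C G),
      Function.Bijective (fun v => l • v + G v) ∧
      ENNReal.ofReal (∫ v in K, (l • ContinuousLinearMap.id ℝ V + fderiv ℝ G v).det) = volume ((fun v => l • v + G v) '' K) ∧
      0 ≤ ∫ v in K, (l • ContinuousLinearMap.id ℝ V + fderiv ℝ G v).det := by
    intro G hG h1
    have hinj : Function.Injective (fun v => l • v + G v) := by
      intro v w hvw
      simp only at hvw
      have e : l • (v - w) = -(G v - G w) := by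
        have : l • v + G v - (l • w + G w) = 0 := sub_eq_zero.2 hvw
        rw [← sub_eq_zero, ← this]; module
      have e2 := congrArg norm e
      rw [norm_smul, norm_neg, Real.norm_of_nonneg hl0.le] at e2
      have e3 := h1.norm_sub_le v w
      by_contra hne
      have : 0 < ‖v - w‖ := norm_pos_iff.2 (sub_ne_zero.2 hne)
      have := mul_lt_mul_of_pos_right hl this
      linarith
    have hsurj : Function.Surjective (fun v => l • v + G v) := by
      intro y
      have hc : ContractingWith (C / l.toNNReal) (fun v => l⁻¹ • (y - G v)) := by
        constructor
        · have hl1 : 0 < l.toNNReal := Real.toNNReal_pos.2 hl0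
          rw [div_lt_one hl1]
          exact (Real.lt_toNNReal_iff_coe_lt).2 hl
        · refine LipschitzWith.of_dist_le_mul (fun v w => ?_)
          rw [dist_eq_norm, dist_eq_norm, ← smul_sub, norm_smul, norm_inv, Real.norm_of_nonneg hl0.le]
          have e3 := h1.norm_sub_le w v
          rw [sub_sub_sub_cancel_left]
          push_cast
          rw [Real.coe_toNNReal _ hl0.le, norm_sub_rev v w, div_mul_eq_mul_div, inv_mul_eq_div]
          gcongr
      refine ⟨hc.fixedPoint, ?_⟩
      have := hc.fixedPoint_isFixedPt
      rw [Function.IsFixedPt] at this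
      have e : l • (l⁻¹ • (y - G hc.fixedPoint)) = l • hc.fixedPoint := congrArg (l • ·) this
      rw [smul_smul, mul_inv_cancel₀ hl0.ne', one_smul] at e
      simp only [← e, sub_add_cancel]
    have hder : ∀ v, HasFDerivAt (fun v => l • v + G v) (l • ContinuousLinearMap.id ℝ V + fderiv ℝ G v) v := fun v =>
      ((hasFDerivAt_id v).const_smul l).add (hG.differentiable (by norm_num) v).hasFDerivAt
    have hpos : ∀ v, 0 ≤ (l • ContinuousLinearMap.id ℝ V + fderiv ℝ G v).det := by
      intro v
      refine det_nonneg_of (fun w => ?_)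
      have n1 : ‖fderiv ℝ G v‖ ≤ C := norm_fderiv_le_of_lipschitz ℝ h1
      have n2 : |inner ℝ (fderiv ℝ G v w) w| ≤ C * ‖w‖ * ‖w‖ := by
        refine (abs_real_inner_le_norm _ _).trans ?_
        gcongr
        exact (ContinuousLinearMap.le_opNorm _ _).trans (by gcongr)
      have n3 := (abs_le.1 n2).1
      simp only [_root_.add_apply, inner_add_left, _root_.smul_apply, inner_smul_left, ContinuousLinearMap.id_apply, real_inner_self_eq_norm_sq]
      have : 0 ≤ (l - C) * (‖w‖ * ‖w‖) := mul_nonneg (by linarith) (by positivity)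
      simp only [conj_trivial]
      nlinarith
    have hcont : Continuous (fun v => (l • ContinuousLinearMap.id ℝ V + fderiv ℝ G v).det) :=
      ContinuousLinearMap.continuous_det.comp (continuous_const.add (hG.continuous_fderiv (by norm_num)))
    refine ⟨⟨hinj, hsurj⟩, ?_, integral_nonneg hpos⟩
    rw [← lintegral_abs_det_fderiv_eq_addHaar_image volume hK.measurableSet (fun v _ => (hder v).hasFDerivWithinAt) hinj.injOn]
    rw [ofReal_integral_eq_lintegral_ofReal (hcont.continuousOn.integrableOn_compact hK) (Filter.Eventually.of_forall hpos)]
    simp only [abs_of_nonneg (hpos _)]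
  obtain ⟨a1, a2, a3⟩ := key hG h1
  obtain ⟨b1, b2, b3⟩ := key hG' h2
  have him : (fun v => l • v + G v) '' K = (fun v => l • v + G' v) '' K := by
    have e : (fun v => l • v + G v) '' Kᶜ = (fun v => l • v + G' v) '' Kᶜ :=
      image_congr (fun v hv => by simp only [hGG v hv])
    rw [image_compl_eq a1, image_compl_eq b1] at e
    exact compl_injective e
  rw [him, ← b2] at a2
  exact (ENNReal.ofReal_eq_ofReal_iff a3 b3).1 a2

lemma det_interp (n : ℕ) (hn : Module.finrank ℝ V = n) (C : ℝ) : ∃ w : ℕ → ℝ, ∀ A : V →L[ℝ] V,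
    A.det = ∑ j ∈ Finset.range (n + 1), w j * ((C + 1 + j : ℝ) • ContinuousLinearMap.id ℝ V + A).det := by
  refine ⟨fun j => (Lagrange.basis (Finset.range (n+1)) (fun j : ℕ => C + 1 + j) j).eval 0, fun A => ?_⟩
  set p := LinearMap.charpoly (-A : V →ₗ[ℝ] V) with hp
  have hev : ∀ t : ℝ, p.eval t = (t • ContinuousLinearMap.id ℝ V + A).det := by
    intro t
    rw [hp, LinearMap.eval_charpoly]
    rw [ContinuousLinearMap.det]
    congr 1
    ext v; simp
  have hdeg : p.degree < (Finset.range (n+1)).card := by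
    rw [Polynomial.degree_eq_natDegree (LinearMap.charpoly_monic _).ne_zero, LinearMap.charpoly_natDegree, hn]
    simp; exact_mod_cast Nat.lt_succ_self n
  have := Lagrange.eq_interpolate (s := Finset.range (n+1)) (v := fun j : ℕ => C + 1 + (j:ℝ)) (f := p) (fun a _ b _ h => by simpa using h) hdeg
  have e := hev 0
  rw [this, Lagrange.interpolate_apply, Polynomial.eval_finsetSum] at e
  simp only [zero_smul, zero_add] at e
  rw [← e]
  refine Finset.sum_congr rfl (fun j _ => ?_)
  rw [Polynomial.eval_mul, Polynomial.eval_C, hev, mul_comm]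

theorem null_lagr {G G' : V → V} (hG : ContDiff ℝ 1 G) (hG' : ContDiff ℝ 1 G') {R : ℝ} (hR : 0 < R)
    (hGG : ∀ v, v ∉ closedBall (0:V) R → G v = G' v) :
    ∫ v in closedBall (0:V) R, (fderiv ℝ G v).det = ∫ v in closedBall (0:V) R, (fderiv ℝ G' v).det := by
  let c : ContDiffBump (0:V) := ⟨R + 1, R + 2, by linarith, by linarith⟩
  have core : ∀ {G G' : V → V} (hG : ContDiff ℝ 1 G) (hG' : ContDiff ℝ 1 G') (hs : HasCompactSupport G) (hs' : HasCompactSupport G'),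
    (∀ v, v ∉ closedBall (0:V) R → G v = G' v) →
    ∫ v in closedBall (0:V) R, (fderiv ℝ G v).det = ∫ v in closedBall (0:V) R, (fderiv ℝ G' v).det := by
    intro G G' hG hG' hs hs' hGG
    obtain ⟨C1, hC1⟩ := hG.lipschitzWith_of_hasCompactSupport hs (by norm_num)
    obtain ⟨C2, hC2⟩ := hG'.lipschitzWith_of_hasCompactSupport hs' (by norm_num)
    obtain ⟨w, hw⟩ := det_interp (V := V) _ rfl (max C1 C2 : NNReal)
    have e : ∀ {G : V → V} (hG : ContDiff ℝ 1 G), ∫ v in closedBall (0:V) R, (fderiv ℝ G v).det =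
      ∑ j ∈ Finset.range (Module.finrank ℝ V + 1), w j * ∫ v in closedBall (0:V) R, ((((max C1 C2 : NNReal):ℝ) + 1 + j : ℝ) • ContinuousLinearMap.id ℝ V + fderiv ℝ G v).det := by
      intro G hG
      simp only [← integral_const_mul]
      rw [← integral_finsetSum]
      · exact setIntegral_congr_fun isClosed_closedBall.measurableSet (fun v _ => hw _)
      · intro j _
        have hcont : Continuous (fun v => (((((max C1 C2 : NNReal):ℝ) + 1 + j : ℝ)) • ContinuousLinearMap.id ℝ V + fderiv ℝ G v).det) :=
          ContinuousLinearMap.continuous_det.comp (continuous_const.add (hG.continuous_fderiv (by norm_num)))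
        exact ((continuous_const.mul hcont).continuousOn.integrableOn_compact (isCompact_closedBall _ _))
    rw [e hG, e hG']
    refine Finset.sum_congr rfl (fun j _ => ?_)
    rw [vol_eq hG hG' (isCompact_closedBall _ _) hGG (hC1.weaken (le_max_left _ _)) (hC2.weaken (le_max_right _ _))]
    have : (0:ℝ) ≤ j := Nat.cast_nonneg j
    linarith
  have hloc : ∀ {G : V → V} (hG : ContDiff ℝ 1 G), ∫ v in closedBall (0:V) R, (fderiv ℝ G v).det =
      ∫ v in closedBall (0:V) R, (fderiv ℝ (fun v => c v • G v) v).det := by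
    intro G hG
    refine setIntegral_congr_fun isClosed_closedBall.measurableSet (fun v hv => ?_)
    have : (fun v => c v • G v) =ᶠ[nhds v] G := by
      have hv' : v ∈ ball (0:V) c.rIn := by
        rw [mem_closedBall] at hv; rw [mem_ball]; show _ < R + 1; linarith
      filter_upwards [c.eventuallyEq_one_of_mem_ball hv'] with u hu
      rw [hu]; simp
    simp only [this.fderiv_eq]
  rw [hloc hG, hloc hG']
  refine core (c.contDiff.smul hG) (c.contDiff.smul hG') c.hasCompactSupport.smul_right c.hasCompactSupport.smul_right (fun v hv => by rw [hGG v hv])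

lemma det_zero_of_unit {G : V → V} (hG : ContDiff ℝ 1 G) (h1 : ∀ v, ‖G v‖ = 1) (v : V) : (fderiv ℝ G v).det = 0 := by
  by_contra hne
  have hd := (hG.differentiable (by norm_num) v).hasFDerivAt
  have h2 := hd.norm_sq
  simp only [h1] at h2
  have h3 := (hasFDerivAt_const ((1:ℝ)^2) v).unique h2
  have hu : IsUnit ((fderiv ℝ G v) : V →ₗ[ℝ] V) := by
    rw [LinearMap.isUnit_iff_isUnit_det]; exact isUnit_iff_ne_zero.2 hne
  have hsurj : Function.Surjective ((fderiv ℝ G v) : V →ₗ[ℝ] V) := by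
    rw [← LinearMap.range_eq_top]; exact (LinearMap.isUnit_iff_range_eq_top _).1 hu
  obtain ⟨w, hw⟩ := hsurj (G v)
  have h4 := congrArg (fun L => L w) h3
  simp only [ContinuousLinearMap.coe_coe] at hw
  simp [hw, h1] at h4
end NL

end RPX

namespace RPX
open Metric
open Set
set_option linter.unusedSectionVars false
set_option linter.unusedSimpArgs false
set_option linter.unusedVariables false
set_option linter.style.longLine false


section Gh
open MeasureTheory
variable {M : ℕ}

/-- smooth step -/
noncomputable abbrev sst : ℝ → ℝ := Real.smoothTransition
lemma contDiff_sst : ContDiff ℝ 1 sst := Real.smoothTransition.contDiff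
/-- base vector in the ambient space -/
noncomputable abbrev e0 (M : ℕ) : VV M := ((y0 M : SS M) : VV M)

lemma norm_e0 : ‖e0 M‖ = 1 := norm_SS _

lemma contDiff_mk {X : Type*} [NormedAddCommGroup X] [NormedSpace ℝ X] {a : X → ℝ} {z : X → EE M} (ha : ContDiff ℝ 1 a) (hz : ContDiff ℝ 1 z) :
    ContDiff ℝ 1 (fun x => mk (a x) (z x)) := by
  rw [contDiff_euclidean]
  intro i
  refine Fin.cases ?_ (fun j => ?_) i
  · simpa using ha
  · simpa using (contDiff_pi.1 hz j)

lemma det_zero_dir {G : VV M → VV M} {v e : VV M} (hG : DifferentiableAt ℝ G v) (he : e ≠ 0)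
    (h : (fun s : ℝ => G (v + s • e)) =ᶠ[nhds 0] fun _ => G v) : (fderiv ℝ G v).det = 0 := by
  have h1 : HasDerivAt (fun s : ℝ => G (v + s • e)) (fderiv ℝ G v e) 0 := by
    have a1 : HasDerivAt (fun s : ℝ => v + s • e) e 0 := by
      simpa using ((hasDerivAt_id (0:ℝ)).smul_const e).const_add v
    have a2 : HasFDerivAt G (fderiv ℝ G v) (v + (0:ℝ) • e) := by simpa using hG.hasFDerivAt
    exact a2.comp_hasDerivAt (0:ℝ) a1
  have h2 : HasDerivAt (fun s : ℝ => G (v + s • e)) 0 0 := (hasDerivAt_const (0:ℝ) (G v)).congr_of_eventuallyEq h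
  have h3 := h1.unique h2
  by_contra hne
  have hu : IsUnit ((fderiv ℝ G v) : VV M →ₗ[ℝ] VV M) := by
    rw [LinearMap.isUnit_iff_isUnit_det]; exact isUnit_iff_ne_zero.2 hne
  have := LinearMap.ker_eq_bot.1 ((LinearMap.isUnit_iff_ker_eq_bot _).1 hu)
  exact he (this (by simpa using h3))

/-- cone-off map -/
noncomputable def Gh (F : EE M → VV M) (v : VV M) : VV M := (1 - sst (v 0)) • F (tl v) + sst (v 0) • e0 M

lemma contDiff_hd : ContDiff ℝ 1 (fun w : VV M => w 0) := by fun_prop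

lemma contDiff_Gh {F : EE M → VV M} (hF : ContDiff ℝ 1 F) : ContDiff ℝ 1 (Gh F) := by
  have h1 : ContDiff ℝ 1 (fun v : VV M => sst (v 0)) := contDiff_sst.comp contDiff_hd
  exact ((contDiff_const.sub h1).smul (hF.comp contDiff_tl)).add (h1.smul contDiff_const)

lemma Gh_det_zero {F : EE M → VV M} (hF : ContDiff ℝ 1 F) {v : VV M} (h : v 0 < 0 ∨ 1 < v 0 ∨ F (tl v) = e0 M) :
    (fderiv ℝ (Gh F) v).det = 0 := by
  refine det_zero_dir (e := e0 M) ((contDiff_Gh hF).differentiable (by norm_num) v) (SS_ne _) ?_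
  have hc : Continuous (fun s : ℝ => (v + s • e0 M) 0) := continuous_hd.comp (by fun_prop)
  rcases h with h | h | h
  · have : ∀ᶠ s : ℝ in nhds 0, (v + s • e0 M) 0 < 0 := hc.continuousAt.eventually_lt continuousAt_const (by simpa using h)
    filter_upwards [this] with s hs
    simp only [Gh, sst, tl_add, tl_smul, tl_y0, smul_zero, add_zero, Real.smoothTransition.zero_of_nonpos hs.le,
      Real.smoothTransition.zero_of_nonpos h.le]
  · have : ∀ᶠ s : ℝ in nhds 0, 1 < (v + s • e0 M) 0 := continuousAt_const.eventually_lt hc.continuousAt (by simpa using h)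
    filter_upwards [this] with s hs
    simp only [Gh, sst, tl_add, tl_smul, tl_y0, smul_zero, add_zero, Real.smoothTransition.one_of_one_le hs.le,
      Real.smoothTransition.one_of_one_le h.le]
  · refine Filter.Eventually.of_forall (fun s => ?_)
    simp only [Gh, tl_add, tl_smul, tl_y0, smul_zero, add_zero, h]
    module

lemma norm_le_hd_tl (v : VV M) {a b : ℝ} (h0 : |v 0| ≤ a) (h1 : ‖tl v‖ ≤ b) : ‖v‖ ≤ (M + 3) * (a + b) := by
  have ha : 0 ≤ a := (abs_nonneg _).trans h0
  have hb : 0 ≤ b := (norm_nonneg _).trans h1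
  have : ‖v‖ ≤ ∑ i : Fin (M+3), ‖v i‖ := by
    rw [EuclideanSpace.norm_eq]
    refine Real.sqrt_le_iff.2 ⟨Finset.sum_nonneg (fun i _ => norm_nonneg _), ?_⟩
    exact Finset.sum_sq_le_sq_sum_of_nonneg (fun i _ => norm_nonneg _)
  refine this.trans ?_
  have e : ∀ i : Fin (M+3), ‖v i‖ ≤ a + b := by
    intro i
    refine Fin.cases ?_ (fun j => ?_) i
    · rw [Real.norm_eq_abs]; linarith
    · have := (norm_le_pi_norm (tl v) j).trans h1
      simp only [tl] at this
      linarith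
  refine (Finset.sum_le_sum (fun i _ => e i)).trans ?_
  simp
  exact le_of_eq (by ring)

/-- the integral -/
noncomputable def II (F : EE M → VV M) : ℝ := ∫ v, (fderiv ℝ (Gh F) v).det

lemma continuous_dGh {F : EE M → VV M} (hF : ContDiff ℝ 1 F) : Continuous (fun v => (fderiv ℝ (Gh F) v).det) :=
  ContinuousLinearMap.continuous_det.comp ((contDiff_Gh hF).continuous_fderiv (by norm_num))

lemma II_supp {F : EE M → VV M} (hF : ContDiff ℝ 1 F) {ρ : ℝ} (hρ : ∀ x, ρ ≤ ‖x‖ → F x = e0 M) {v : VV M}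
    (hv : v ∉ closedBall (0 : VV M) ((M+3) * (1 + ρ))) : (fderiv ℝ (Gh F) v).det = 0 := by
  apply Gh_det_zero hF
  by_contra hcon
  push Not at hcon
  obtain ⟨h1, h2, h3⟩ := hcon
  apply hv
  rw [mem_closedBall_zero_iff]
  refine norm_le_hd_tl v (abs_le.2 ⟨by linarith, h2⟩) ?_
  by_contra hlt
  exact h3 (hρ _ (not_le.1 hlt).le)

lemma II_ball {F : EE M → VV M} (hF : ContDiff ℝ 1 F) {ρ : ℝ} (hρ : ∀ x, ρ ≤ ‖x‖ → F x = e0 M) :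
    II F = ∫ v in closedBall (0 : VV M) ((M+3) * (1 + ρ)), (fderiv ℝ (Gh F) v).det :=
  (setIntegral_eq_integral_of_forall_compl_eq_zero (fun v hv => II_supp hF hρ hv)).symm

lemma II_integrable {F : EE M → VV M} (hF : ContDiff ℝ 1 F) {ρ : ℝ} (hρ : ∀ x, ρ ≤ ‖x‖ → F x = e0 M) :
    Integrable (fun v => (fderiv ℝ (Gh F) v).det) :=
  (continuous_dGh hF).integrable_of_hasCompactSupport
    (HasCompactSupport.of_support_subset_isCompact (isCompact_closedBall (0 : VV M) ((M+3) * (1 + ρ)))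
      (fun v hv => by by_contra hcon; exact hv (II_supp hF hρ hcon)))

/-- sum of translates -/
noncomputable def trs (P : Finset (EE M)) (F : EE M → VV M) (x : EE M) : VV M := e0 M + ∑ p ∈ P, (F (x - p) - e0 M)

lemma contDiff_trs {P : Finset (EE M)} {F : EE M → VV M} (hF : ContDiff ℝ 1 F) : ContDiff ℝ 1 (trs P F) :=
  contDiff_const.add (ContDiff.sum fun p _ => (hF.comp (contDiff_id.sub contDiff_const)).sub contDiff_const)

lemma trs_in {P : Finset (EE M)} {F : EE M → VV M} (hF : ∀ x, 1 ≤ ‖x‖ → F x = e0 M)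
    (hP : ∀ p ∈ P, ∀ q ∈ P, p ≠ q → 2 ≤ ‖p - q‖) {p : EE M} (hp : p ∈ P) {x : EE M} (hx : ‖x - p‖ ≤ 1) : trs P F x = F (x - p) := by
  rw [trs, Finset.sum_eq_single_of_mem p hp]
  · abel
  · intro q hq hqp
    rw [hF, sub_self]
    have h1 := hP p hp q hq (Ne.symm hqp)
    have h2 : ‖p - q‖ ≤ ‖x - q‖ + ‖x - p‖ := by
      have := norm_sub_le (x - q) (x - p)
      rwa [sub_sub_sub_cancel_left] at this
    linarith

lemma trs_out {P : Finset (EE M)} {F : EE M → VV M} (hF : ∀ x, 1 ≤ ‖x‖ → F x = e0 M)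
    {x : EE M} (hx : ∀ p ∈ P, 1 ≤ ‖x - p‖) : trs P F x = e0 M := by
  rw [trs, Finset.sum_eq_zero (fun p hp => by rw [hF _ (hx p hp), sub_self]), add_zero]

lemma II_trs {P : Finset (EE M)} {F : EE M → VV M} (hF : ContDiff ℝ 1 F) (hF1 : ∀ x, 1 ≤ ‖x‖ → F x = e0 M)
    (hP : ∀ p ∈ P, ∀ q ∈ P, p ≠ q → 2 ≤ ‖p - q‖) : II (trs P F) = P.card * II F := by
  have key : ∀ v, (fderiv ℝ (Gh (trs P F)) v).det = ∑ p ∈ P, (fderiv ℝ (Gh F) (v - mk 0 p)).det := by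
    intro v
    have htl : ∀ (u : VV M) p, tl (u - mk 0 p) = tl u - p := by intro u p; ext i; simp [tl]
    by_cases h : ∃ p ∈ P, ‖tl v - p‖ < 1
    · obtain ⟨p, hp, hlt⟩ := h
      rw [Finset.sum_eq_single_of_mem p hp]
      · have e1 : Gh (trs P F) =ᶠ[nhds v] fun u => Gh F (u - mk 0 p) := by
          have : ∀ᶠ u in nhds v, ‖tl u - p‖ < 1 :=
            ContinuousAt.eventually_lt (continuous_tl.sub continuous_const).norm.continuousAt continuousAt_const hlt
          filter_upwards [this] with u hu
          simp only [Gh, htl, trs_in hF1 hP hp hu.le]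
          simp
        rw [e1.fderiv_eq, fderiv_comp_sub]
      · intro q hq hqp
        apply Gh_det_zero hF
        right; right
        rw [htl]
        apply hF1
        have h1 := hP p hp q hq (Ne.symm hqp)
        have h2 : ‖p - q‖ ≤ ‖tl v - q‖ + ‖tl v - p‖ := by
          have := norm_sub_le (tl v - q) (tl v - p)
          rwa [sub_sub_sub_cancel_left] at this
        linarith
    · push Not at h
      rw [Gh_det_zero (contDiff_trs hF) (Or.inr (Or.inr (trs_out hF1 h)))]
      symm
      refine Finset.sum_eq_zero (fun p hp => Gh_det_zero hF (Or.inr (Or.inr ?_)))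
      rw [htl]; exact hF1 _ (h p hp)
  unfold II
  simp only [key]
  rw [integral_finsetSum _ (fun p _ => (II_integrable hF hF1).comp_sub_right _)]
  simp only [integral_sub_right_eq_self (fun v => (fderiv ℝ (Gh F) v).det)]
  simp

lemma II_null {F : EE M → VV M} (hF : ContDiff ℝ 1 F) {ρ : ℝ} (hρ0 : 0 < ρ) (hρ : ∀ x, ρ ≤ ‖x‖ → F x = e0 M)
    {f : EE M → SS M} (hf : ∀ x, F x = f x) (hH : HomIn {h | ∀ x, ρ ≤ ‖x‖ → h x = y0 M} f (fun _ => y0 M)) : II F = 0 := by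
  obtain ⟨H, H1, H2, H3, H4⟩ := hH.exists_clamp
  have hGc := contDiff_Gh hF
  have hcont : Continuous (fun v : VV M => ((H (v 0) (tl v) : SS M) : VV M) - Gh F v) :=
    (continuous_subtype_val.comp (H1.comp (continuous_hd.prodMk continuous_tl))).sub hGc.continuous
  obtain ⟨g, g1, g2, g3⟩ := hcont.exists_contDiff_approx 1 (continuous_const (y := (1/2:ℝ))) (fun _ => by norm_num)
  set H' : VV M → VV M := fun v => Gh F v + g v with hH'
  have hne : ∀ v, H' v ≠ 0 := by
    intro v h0
    have h1 := g2 v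
    rw [dist_eq_norm] at h1
    have h2 : g v - (((H (v 0) (tl v) : SS M) : VV M) - Gh F v) = H' v - (H (v 0) (tl v) : SS M) := by simp only [hH']; abel
    rw [h2, h0, zero_sub, norm_neg, norm_SS] at h1
    norm_num at h1
  have hHc : ContDiff ℝ 1 H' := hGc.add g1
  have hout : ∀ v, v ∉ closedBall (0 : VV M) ((M+3) * (1 + ρ)) → H' v = Gh F v ∧ ‖Gh F v‖ = 1 := by
    intro v hv
    have hcase : v 0 < 0 ∨ 1 < v 0 ∨ ρ ≤ ‖tl v‖ := by
      by_contra hcon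
      push Not at hcon
      apply hv
      rw [mem_closedBall_zero_iff]
      exact norm_le_hd_tl v (abs_le.2 ⟨by linarith, hcon.2.1⟩) hcon.2.2.le
    have hGH : Gh F v = (H (v 0) (tl v) : SS M) := by
      rcases hcase with h | h | h
      · rw [H3 _ h.le, Gh, sst, Real.smoothTransition.zero_of_nonpos h.le, hf]; simp
      · rw [H4 _ h.le, Gh, sst, Real.smoothTransition.one_of_one_le h.le]; simp
      · rw [H2 _ _ h, Gh, hρ _ h]; module
    refine ⟨?_, by rw [hGH, norm_SS]⟩
    have : g v = 0 := by
      by_contra hcon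
      have := g3 (Function.mem_support.2 hcon)
      rw [Function.mem_support] at this
      exact this (by rw [hGH, sub_self])
    simp [hH', this]
  have hN : ContDiff ℝ 1 (fun v => ‖H' v‖⁻¹ • H' v) := ((hHc.norm ℝ hne).inv (fun v => norm_ne_zero_iff.2 (hne v))).smul hHc
  rw [II_ball hF hρ, null_lagr hGc hN (by positivity) (fun v hv => by
    rw [(hout v hv).1, (hout v hv).2]; simp)]
  have hz : ∀ v, (fderiv ℝ (fun v => ‖H' v‖⁻¹ • H' v) v).det = 0 := det_zero_of_unit hN (fun v => by
    rw [norm_smul, norm_inv, norm_norm, inv_mul_cancel₀ (norm_ne_zero_iff.2 (hne v))])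
  simp [hz]
end Gh

end RPX

namespace RPX
open Metric
open Set
set_option linter.unusedSectionVars false
set_option linter.unusedSimpArgs false
set_option linter.unusedVariables false
set_option linter.style.longLine false


section Ess
open MeasureTheory
variable {M : ℕ}

/-- smooth normalisation -/
noncomputable def Phi (v : VV M) : VV M := (√(‖v‖ ^ 2 + (1 - sst (‖v‖ ^ 2))))⁻¹ • v

lemma Phi_w_pos (v : VV M) : 0 < ‖v‖ ^ 2 + (1 - sst (‖v‖ ^ 2)) := by
  have h1 := Real.smoothTransition.le_one (‖v‖ ^ 2)
  rcases lt_or_ge (‖v‖^2) 1 with h | h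
  · have := Real.smoothTransition.lt_one_of_lt_one h
    have : 0 ≤ ‖v‖^2 := by positivity
    simp only [sst]; linarith
  · simp only [sst]; linarith

lemma contDiff_Phi : ContDiff ℝ 1 (Phi : VV M → VV M) := by
  have h1 : ContDiff ℝ 1 (fun v : VV M => ‖v‖ ^ 2) := contDiff_norm_sq ℝ
  have h2 : ContDiff ℝ 1 (fun v : VV M => ‖v‖ ^ 2 + (1 - sst (‖v‖ ^ 2))) :=
    h1.add (contDiff_const.sub (contDiff_sst.comp h1))
  exact ((h2.sqrt (fun v => (Phi_w_pos v).ne')).inv (fun v => (Real.sqrt_pos.2 (Phi_w_pos v)).ne')).smul contDiff_id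

lemma Phi_out {v : VV M} (h : 1 ≤ ‖v‖) : Phi v = ‖v‖⁻¹ • v := by
  have : 1 ≤ ‖v‖ ^ 2 := by nlinarith
  rw [Phi, sst, Real.smoothTransition.one_of_one_le this]
  simp

lemma norm_Phi_out {v : VV M} (h : 1 ≤ ‖v‖) : ‖Phi v‖ = 1 := by
  rw [Phi_out h, norm_smul, norm_inv, norm_norm, inv_mul_cancel₀ (by linarith)]

lemma Phi_e0 {c : ℝ} (hc : 1 ≤ c) : Phi (c • e0 M) = e0 M := by
  have : ‖c • e0 M‖ = c := by rw [norm_smul, norm_e0, mul_one, Real.norm_of_nonneg (by linarith)]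
  rw [Phi_out (by rw [this]; exact hc), this, smul_smul, inv_mul_cancel₀ (by linarith), one_smul]

lemma det_Phi_out {v : VV M} (h : 1 ≤ ‖v‖) : (fderiv ℝ Phi v).det = 0 := by
  have hd : HasFDerivAt Phi (fderiv ℝ Phi v) v := (contDiff_Phi.differentiable (by norm_num) v).hasFDerivAt
  have h1 : HasDerivAt (fun s : ℝ => Phi (v + s • v)) (fderiv ℝ Phi v v) 0 := by
    have a1 : HasDerivAt (fun s : ℝ => v + s • v) v 0 := by
      simpa using ((hasDerivAt_id (0:ℝ)).smul_const v).const_add v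
    have a2 : HasFDerivAt Phi (fderiv ℝ Phi v) (v + (0:ℝ) • v) := by simpa using hd
    exact a2.comp_hasDerivAt (0:ℝ) a1
  have h2 : HasDerivWithinAt (fun s : ℝ => Phi (v + s • v)) 0 (Ici 0) 0 := by
    refine (hasDerivWithinAt_const (0:ℝ) (Ici 0) (Phi v)).congr (fun s hs => ?_) (by simp)
    have e : v + s • v = (1 + s) • v := by module
    have hs' : (0:ℝ) ≤ s := hs
    have e2 : ‖(1 + s) • v‖ = (1 + s) * ‖v‖ := by rw [norm_smul, Real.norm_of_nonneg (by linarith)]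
    rw [e, Phi_out h, Phi_out (by rw [e2]; nlinarith), e2, smul_smul]
    congr 1
    have : 1 + s ≠ 0 := by linarith
    field_simp
  have h3 := (uniqueDiffOn_Ici (0:ℝ) 0 self_mem_Ici).eq_deriv _ h1.hasDerivWithinAt h2
  by_contra hne
  have hu : IsUnit ((fderiv ℝ Phi v) : VV M →ₗ[ℝ] VV M) := by
    rw [LinearMap.isUnit_iff_isUnit_det]; exact isUnit_iff_ne_zero.2 hne
  have := LinearMap.ker_eq_bot.1 ((LinearMap.isUnit_iff_ker_eq_bot _).1 hu)
  have : v = 0 := this (by simpa using h3)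
  rw [this] at h; norm_num at h

lemma det_Phi_pos {v : VV M} (h : ‖v‖ < 1) : 0 < (fderiv ℝ Phi v).det := by
  have h1 : HasFDerivAt (fun v : VV M => ‖v‖ ^ 2) (2 • (innerSL ℝ v)) v := (hasStrictFDerivAt_norm_sq v).hasFDerivAt
  have hs : HasDerivAt sst (deriv sst (‖v‖^2)) (‖v‖^2) := (contDiff_sst.differentiable (by norm_num) _).hasDerivAt
  have hs0 : 0 ≤ deriv sst (‖v‖^2) := Real.smoothTransition.monotone.deriv_nonneg
  have h2 := h1.add ((hs.comp_hasFDerivAt v h1).const_sub 1)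
  have h3 := (h2.sqrt (Phi_w_pos v).ne')
  have h4 := (hasDerivAt_inv (Real.sqrt_pos.2 (Phi_w_pos v)).ne').comp_hasFDerivAt v h3
  have h5 := h4.smul (hasFDerivAt_id v)
  have h6 : fderiv ℝ Phi v = _ := HasFDerivAt.fderiv h5
  rw [h6]
  refine det_pos_of (fun w hw => ?_)
  set W := ‖v‖ ^ 2 + (1 - sst (‖v‖ ^ 2)) with hW
  have hW0 : 0 < W := Phi_w_pos v
  have hq := Real.sqrt_pos.2 hW0
  have hqq : √W ^ 2 = W := Real.sq_sqrt hW0.le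
  set q := √W with hqdef
  set d := deriv sst (‖v‖^2) with hd
  have e : inner ℝ ((q⁻¹ • ContinuousLinearMap.id ℝ (VV M) + ((-(q ^ 2)⁻¹) • ((1 / (2 * q)) • (2 • innerSL ℝ v + -(d • 2 • innerSL ℝ v)))).smulRight (id v)) w) w
     = q⁻¹ * ‖w‖^2 - (q^2)⁻¹ * q⁻¹ * (1 - d) * (inner ℝ v w)^2 := by
    simp [inner_add_left, inner_smul_left]
    field_simp
    ring
  refine lt_of_lt_of_eq ?_ e.symm
  have hcs : (inner ℝ v w)^2 ≤ ‖v‖^2 * ‖w‖^2 := by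
    have := abs_real_inner_le_norm v w
    rw [← sq_abs, ← mul_pow]; gcongr
  have hlt : sst (‖v‖^2) < 1 := Real.smoothTransition.lt_one_of_lt_one (by nlinarith [norm_nonneg v])
  have hw2 : 0 < ‖w‖^2 := by have := norm_pos_iff.2 hw; positivity
  have e2 : q⁻¹ * ‖w‖^2 - (q^2)⁻¹ * q⁻¹ * (1 - d) * (inner ℝ v w)^2 = (q^2)⁻¹ * q⁻¹ * (W * ‖w‖^2 - (1-d) * (inner ℝ v w)^2) := by
    rw [← hqq]; field_simp
  rw [e2]
  have hpos : 0 < W * ‖w‖^2 - (1-d) * (inner ℝ v w)^2 := by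
    have : W * ‖w‖^2 = ‖v‖^2 * ‖w‖^2 + (1 - sst (‖v‖^2)) * ‖w‖^2 := by rw [hW]; ring
    have : 0 < (1 - sst (‖v‖^2)) * ‖w‖^2 := mul_pos (by linarith) hw2
    have : 0 ≤ d * (inner ℝ v w)^2 := by positivity
    nlinarith
  positivity

end Ess

end RPX

namespace RPX
open Metric
open Set
set_option linter.unusedSectionVars false
set_option linter.unusedSimpArgs false
set_option linter.unusedVariables false
set_option linter.style.longLine false


section Ess2
open MeasureTheory
variable {M : ℕ}

noncomputable def Aa (t : ℝ) (p : VV M) : VV M :=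
  (2 * (1 - sst (2 * t - 1)) * (1 - sst (4 * ‖p‖ ^ 2 - 2))) • p + (-2 + 4 * sst (2 * t) + 5 * sst (4 * ‖p‖ ^ 2 - 1)) • e0 M

noncomputable def Wm (v : VV M) : VV M := Phi (Aa (v 0) (mk 0 (tl v)))
noncomputable def Fm (x : EE M) : VV M := Phi (Aa 0 (mk 0 x))

lemma contDiff_Aa {X : Type*} [NormedAddCommGroup X] [NormedSpace ℝ X] {t : X → ℝ} {p : X → VV M} (ht : ContDiff ℝ 1 t) (hp : ContDiff ℝ 1 p) :
    ContDiff ℝ 1 (fun x => Aa (t x) (p x)) := by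
  have h1 : ContDiff ℝ 1 (fun x => ‖p x‖ ^ 2) := hp.norm_sq ℝ
  have a1 : ContDiff ℝ 1 (fun x => sst (2 * t x - 1)) := contDiff_sst.comp ((contDiff_const.mul ht).sub contDiff_const)
  have a2 : ContDiff ℝ 1 (fun x => sst (4 * ‖p x‖^2 - 2)) := contDiff_sst.comp ((contDiff_const.mul h1).sub contDiff_const)
  have a3 : ContDiff ℝ 1 (fun x => sst (2 * t x)) := contDiff_sst.comp (contDiff_const.mul ht)
  have a4 : ContDiff ℝ 1 (fun x => sst (4 * ‖p x‖^2 - 1)) := contDiff_sst.comp ((contDiff_const.mul h1).sub contDiff_const)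
  unfold Aa
  exact (((contDiff_const.mul (contDiff_const.sub a1)).mul (contDiff_const.sub a2)).smul hp).add
    (((contDiff_const.add (contDiff_const.mul a3)).add (contDiff_const.mul a4)).smul contDiff_const)

lemma contDiff_AA : ContDiff ℝ 1 (fun v : VV M => Aa (v 0) (mk 0 (tl v))) :=
  contDiff_Aa contDiff_hd (contDiff_mk contDiff_const contDiff_tl)
lemma contDiff_Wm : ContDiff ℝ 1 (Wm : VV M → VV M) := contDiff_Phi.comp contDiff_AA
lemma contDiff_Fm : ContDiff ℝ 1 (Fm : EE M → VV M) :=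
  contDiff_Phi.comp (contDiff_Aa contDiff_const (contDiff_mk contDiff_const contDiff_id))

lemma norm_mk_ge (x : EE M) : ‖x‖ ≤ ‖mk 0 x‖ := by
  refine (pi_norm_le_iff_of_nonneg (norm_nonneg _)).2 (fun i => ?_)
  have := abs_coord_le (mk 0 x) i.succ
  simpa using this

lemma Aa_zero_coord (t : ℝ) (x : EE M) : Aa t (mk 0 x) 0 = -2 + 4 * sst (2 * t) + 5 * sst (4 * ‖mk 0 x‖ ^ 2 - 1) := by
  simp [Aa]

lemma Aa_small {t : ℝ} {x : EE M} (h : ‖Aa t (mk 0 x)‖ < 1) : 0 < t ∧ t < 1/2 ∧ 4 * ‖mk 0 x‖^2 < 1 := by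
  have h0 := abs_coord_le (Aa t (mk 0 x)) 0
  rw [Aa_zero_coord] at h0
  have h1 := abs_lt.1 (h0.trans_lt h)
  have n1 := Real.smoothTransition.nonneg (2*t)
  have n2 := Real.smoothTransition.nonneg (4 * ‖mk 0 x‖ ^ 2 - 1)
  have ht : t < 1/2 := by
    by_contra hcon
    have : sst (2 * t) = 1 := Real.smoothTransition.one_of_one_le (by linarith)
    rw [this] at h1
    simp only [sst] at h1
    linarith [h1.2]
  have hr2 : 4 * ‖mk 0 x‖ ^ 2 < 2 := by
    by_contra hcon
    have : sst (4 * ‖mk 0 x‖ ^ 2 - 1) = 1 := Real.smoothTransition.one_of_one_le (by linarith)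
    rw [this] at h1
    simp only [sst] at h1
    linarith [h1.2]
  have hA : Aa t (mk 0 x) = (2:ℝ) • mk 0 x + (-2 + 4 * sst (2 * t) + 5 * sst (4 * ‖mk 0 x‖ ^ 2 - 1)) • e0 M := by
    rw [Aa]
    have a1 : sst (2 * t - 1) = 0 := Real.smoothTransition.zero_of_nonpos (by linarith)
    have a2 : sst (4 * ‖mk 0 x‖ ^ 2 - 2) = 0 := Real.smoothTransition.zero_of_nonpos (by linarith)
    rw [a1, a2]; simp
  have hr : 4 * ‖mk 0 x‖ ^ 2 < 1 := by
    set c := (-2 + 4 * sst (2 * t) + 5 * sst (4 * ‖mk 0 x‖ ^ 2 - 1)) with hc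
    have hin : inner ℝ (mk 0 x) (e0 M) = 0 := by
      rw [show e0 M = EuclideanSpace.single 0 1 from rfl, EuclideanSpace.inner_single_right]; simp
    have e : ‖Aa t (mk 0 x)‖ ^ 2 = 4 * ‖mk 0 x‖^2 + c^2 := by
      rw [hA, norm_add_sq_real, norm_smul, norm_smul, norm_e0, inner_smul_left, inner_smul_right, hin]
      simp; ring
    have : ‖Aa t (mk 0 x)‖ ^ 2 < 1 := by nlinarith [norm_nonneg (Aa t (mk 0 x))]
    nlinarith [sq_nonneg c]
  refine ⟨?_, ht, hr⟩
  by_contra hcon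
  have z1 : sst (2 * t) = 0 := Real.smoothTransition.zero_of_nonpos (by linarith)
  have z2 : sst (4 * ‖mk 0 x‖ ^ 2 - 1) = 0 := Real.smoothTransition.zero_of_nonpos (by linarith)
  rw [z1, z2] at h1
  linarith [h1.1]

lemma norm_Fm (x : EE M) : ‖Fm x‖ = 1 := by
  apply norm_Phi_out
  by_contra hcon
  have := (Aa_small (not_le.1 hcon)).1
  linarith

lemma Aa_far {t : ℝ} {x : EE M} (h : 1 ≤ ‖x‖) : ∃ c : ℝ, 1 ≤ c ∧ Aa t (mk 0 x) = c • e0 M := by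
  have h1 := norm_mk_ge x
  have h2 : 4 ≤ 4 * ‖mk 0 x‖^2 := by nlinarith
  rw [Aa, show sst (4 * ‖mk 0 x‖ ^ 2 - 2) = 1 from Real.smoothTransition.one_of_one_le (by linarith),
    show sst (4 * ‖mk 0 x‖ ^ 2 - 1) = 1 from Real.smoothTransition.one_of_one_le (by linarith)]
  have n1 := Real.smoothTransition.nonneg (2*t)
  exact ⟨-2 + 4 * sst (2 * t) + 5 * 1, by simp only [sst]; linarith, by simp⟩

lemma Fm_far {x : EE M} (h : 1 ≤ ‖x‖) : Fm x = e0 M := by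
  obtain ⟨c, hc, he⟩ := Aa_far (t := 0) h
  rw [Fm, he, Phi_e0 hc]

lemma Wm_Gh {v : VV M} (h : v 0 < 0 ∨ 1 < v 0 ∨ 1 ≤ ‖tl v‖) : Wm v = Gh Fm v := by
  rcases h with h | h | h
  · rw [Gh, show sst (v 0) = 0 from Real.smoothTransition.zero_of_nonpos h.le, Wm, Fm]
    have : Aa (v 0) (mk 0 (tl v)) = Aa 0 (mk 0 (tl v)) := by
      rw [Aa, Aa]
      rw [show sst (2 * v 0 - 1) = 0 from Real.smoothTransition.zero_of_nonpos (by linarith),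
        show sst (2 * v 0) = 0 from Real.smoothTransition.zero_of_nonpos (by linarith),
        show sst (2 * 0 - 1) = 0 from Real.smoothTransition.zero_of_nonpos (by norm_num),
        show sst (2 * 0) = 0 from Real.smoothTransition.zero_of_nonpos (by norm_num)]
    rw [this]; simp
  · rw [Gh, show sst (v 0) = 1 from Real.smoothTransition.one_of_one_le h.le, Wm, Aa]
    rw [show sst (2 * v 0 - 1) = 1 from Real.smoothTransition.one_of_one_le (by linarith),
        show sst (2 * v 0) = 1 from Real.smoothTransition.one_of_one_le (by linarith)]
    simp only [sub_self, mul_zero, zero_mul, zero_smul, zero_add, one_smul]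
    have n2 := Real.smoothTransition.nonneg (4 * ‖mk 0 (tl v)‖ ^ 2 - 1)
    rw [Phi_e0]
    simp only [sst]; linarith
  · obtain ⟨c, hc, he⟩ := Aa_far (t := v 0) h
    rw [Wm, he, Phi_e0 hc, Gh, Fm_far h]
    module

lemma AA_local {v : VV M} (h : ‖Aa (v 0) (mk 0 (tl v))‖ < 1) :
    HasFDerivAt (fun v : VV M => Aa (v 0) (mk 0 (tl v)))
      ((2:ℝ) • ContinuousLinearMap.id ℝ (VV M) + ((deriv (fun t => -2 + 4 * sst (2 * t)) (v 0) - 2) • (EuclideanSpace.proj 0 : VV M →L[ℝ] ℝ)).smulRight (e0 M)) v := by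
  have hs : HasDerivAt (fun t => -2 + 4 * sst (2 * t)) (deriv (fun t => -2 + 4 * sst (2 * t)) (v 0)) (v 0) := by
    apply DifferentiableAt.hasDerivAt
    have : Differentiable ℝ sst := contDiff_sst.differentiable (by norm_num)
    fun_prop
  have hp : HasFDerivAt (fun v : VV M => v 0) (EuclideanSpace.proj 0 : VV M →L[ℝ] ℝ) v :=
    (EuclideanSpace.proj 0 : VV M →L[ℝ] ℝ).hasFDerivAt
  have h1 := (hs.comp_hasFDerivAt v hp).sub (hp.const_mul 2)
  have h2 := ((hasFDerivAt_id v).const_smul (2:ℝ)).add (h1.smul_const (e0 M))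
  rw [← sub_smul] at h2
  refine h2.congr_of_eventuallyEq ?_
  obtain ⟨q1, q2, q3⟩ := Aa_small h
  have o1 : ∀ᶠ u : VV M in nhds v, u 0 < 1/2 := continuous_hd.continuousAt.eventually_lt continuousAt_const q2
  have o2 : ∀ᶠ u : VV M in nhds v, 4 * ‖mk 0 (tl u)‖^2 < 1 :=
    ContinuousAt.eventually_lt (continuous_const.mul ((continuous_mk continuous_const continuous_tl).norm.pow 2)).continuousAt continuousAt_const q3
  filter_upwards [o1, o2] with u u1 u2
  rw [Aa, show sst (2 * u 0 - 1) = 0 from Real.smoothTransition.zero_of_nonpos (by linarith),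
    show sst (4 * ‖mk 0 (tl u)‖ ^ 2 - 2) = 0 from Real.smoothTransition.zero_of_nonpos (by linarith),
    show sst (4 * ‖mk 0 (tl u)‖ ^ 2 - 1) = 0 from Real.smoothTransition.zero_of_nonpos (by linarith)]
  have : mk 0 (tl u) = u - (u 0) • e0 M := by
    conv_rhs => rw [← mk_tl u]
    rw [show e0 M = mk 1 0 from mk_one_zero.symm, mk_eq_iff]; simp
  rw [this]
  simp only [Function.comp, id]
  simp
  module

lemma det_AA {v : VV M} (h : ‖Aa (v 0) (mk 0 (tl v))‖ < 1) :
    0 ≤ (fderiv ℝ (fun v : VV M => Aa (v 0) (mk 0 (tl v))) v).det ∧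
    (0 < deriv (fun t => -2 + 4 * sst (2 * t)) (v 0) → 0 < (fderiv ℝ (fun v : VV M => Aa (v 0) (mk 0 (tl v))) v).det) := by
  rw [(AA_local h).fderiv]
  set d := deriv (fun t => -2 + 4 * sst (2 * t)) (v 0) with hd
  have hd0 : 0 ≤ d := by
    apply Monotone.deriv_nonneg
    intro a b hab
    have := Real.smoothTransition.monotone (show 2 * a ≤ 2 * b by linarith)
    simp only [sst]; linarith
  have e : ∀ w : VV M, inner ℝ (((2:ℝ) • ContinuousLinearMap.id ℝ (VV M) + ((d - 2) • (EuclideanSpace.proj 0 : VV M →L[ℝ] ℝ)).smulRight (e0 M)) w) w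
      = 2 * (‖w‖^2 - (w 0)^2) + d * (w 0)^2 := by
    intro w
    have : inner ℝ (e0 M) w = w 0 := by rw [show e0 M = EuclideanSpace.single 0 1 from rfl, EuclideanSpace.inner_single_left]; simp
    simp [inner_add_left, inner_smul_left, this]
    ring
  have hw : ∀ w : VV M, (w 0)^2 ≤ ‖w‖^2 := fun w => by
    rw [← sq_abs]; have := abs_coord_le w 0; gcongr
  refine ⟨det_nonneg_of (fun w => ?_), fun hp => det_pos_of (fun w hw0 => ?_)⟩
  · rw [e]
    have := hw w
    have : 0 ≤ d * (w 0)^2 := by positivity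
    linarith
  · rw [e]
    have h1 := hw w
    have h3 : 0 < ‖w‖^2 := by have := norm_pos_iff.2 hw0; positivity
    rcases eq_or_lt_of_le (sq_nonneg (w 0)) with h2 | h2
    · rw [← h2]; linarith
    · have := mul_pos hp h2; linarith

lemma det_Wm (v : VV M) : (fderiv ℝ Wm v).det = (fderiv ℝ Phi (Aa (v 0) (mk 0 (tl v)))).det * (fderiv ℝ (fun v : VV M => Aa (v 0) (mk 0 (tl v))) v).det := by
  have h1 : fderiv ℝ Wm v = (fderiv ℝ Phi (Aa (v 0) (mk 0 (tl v)))).comp (fderiv ℝ (fun v : VV M => Aa (v 0) (mk 0 (tl v))) v) :=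
    fderiv_comp v (contDiff_Phi.differentiable (by norm_num) _) (contDiff_AA.differentiable (by norm_num) v)
  rw [h1]
  exact LinearMap.det_comp _ _

lemma det_Wm_nonneg (v : VV M) : 0 ≤ (fderiv ℝ Wm v).det := by
  rw [det_Wm]
  rcases lt_or_ge ‖Aa (v 0) (mk 0 (tl v))‖ 1 with h | h
  · exact mul_nonneg (det_Phi_pos h).le (det_AA h).1
  · rw [det_Phi_out h, zero_mul]

lemma det_Wm_pos : ∃ v : VV M, v 0 ∈ Ioo (0:ℝ) 1 ∧ tl v = 0 ∧ 0 < (fderiv ℝ Wm v).det := by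
  set σ : ℝ → ℝ := fun t => -2 + 4 * sst (2 * t) with hσ
  have hmono : Monotone σ := by
    intro a b hab
    have := Real.smoothTransition.monotone (show 2 * a ≤ 2 * b by linarith)
    simp only [hσ, sst]; linarith
  have hdiff : Differentiable ℝ σ := by
    have : Differentiable ℝ sst := contDiff_sst.differentiable (by norm_num)
    fun_prop
  have s0 : σ 0 = -2 := by simp [hσ]
  have s1 : σ 1 = 2 := by
    simp only [hσ]; rw [show sst (2 * 1) = 1 from Real.smoothTransition.one_of_one_le (by norm_num)]; norm_num
  obtain ⟨a, ha, ha'⟩ := intermediate_value_Icc zero_le_one hdiff.continuous.continuousOn (show (-(1/4):ℝ) ∈ Icc (σ 0) (σ 1) by rw [s0, s1]; constructor <;> norm_num)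
  obtain ⟨b, hb, hb'⟩ := intermediate_value_Icc zero_le_one hdiff.continuous.continuousOn (show (1/4:ℝ) ∈ Icc (σ 0) (σ 1) by rw [s0, s1]; constructor <;> norm_num)
  have hab : a < b := by
    by_contra hcon
    have := hmono (not_lt.1 hcon)
    rw [ha', hb'] at this; norm_num at this
  obtain ⟨c, hc, hc'⟩ := exists_deriv_eq_slope σ hab hdiff.continuous.continuousOn hdiff.differentiableOn
  have hcpos : 0 < deriv σ c := by
    rw [hc', ha', hb']; have : 0 < b - a := by linarith
    positivity
  have hAc : Aa c (mk 0 (0 : EE M)) = σ c • e0 M := by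
    have z : mk 0 (0 : EE M) = 0 := by rw [mk_eq_iff]; simp
    rw [Aa, z]
    rw [show sst (4 * ‖(0 : VV M)‖ ^ 2 - 1) = 0 from Real.smoothTransition.zero_of_nonpos (by norm_num)]
    simp [hσ]
  have hsm : ‖Aa c (mk 0 (0 : EE M))‖ < 1 := by
    rw [hAc, norm_smul, norm_e0, mul_one, Real.norm_eq_abs, abs_lt]
    have h1 := hmono hc.1.le
    have h2 := hmono hc.2.le
    rw [ha'] at h1; rw [hb'] at h2
    constructor <;> linarith
  refine ⟨mk c 0, ⟨by simpa using ha.1.trans_lt hc.1, by simpa using hc.2.trans_le hb.2⟩, by simp, ?_⟩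
  rw [det_Wm]
  have hsm' : ‖Aa ((mk c (0 : EE M)) 0) (mk 0 (tl (mk c (0 : EE M))))‖ < 1 := by simpa using hsm
  exact mul_pos (det_Phi_pos hsm') ((det_AA hsm').2 (by have e : (mk c (0:EE M)) 0 = c := mk_zero _ _; rw [e]; exact hcpos))

lemma II_Fm : 0 < II (Fm : EE M → VV M) := by
  rw [II_ball contDiff_Fm (fun x hx => Fm_far hx)]
  set R : ℝ := (M + 3) * (1 + 1) with hR
  rw [← null_lagr (R := R) contDiff_Wm (contDiff_Gh contDiff_Fm) (by positivity) (fun v hv => ?_)]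
  · obtain ⟨v, hv0, hv1, hv2⟩ := det_Wm_pos (M := M)
    have hc : Continuous (fun v : VV M => (fderiv ℝ Wm v).det) :=
      ContinuousLinearMap.continuous_det.comp (contDiff_Wm.continuous_fderiv (by norm_num))
    have hsupp : Function.support (fun v : VV M => (fderiv ℝ Wm v).det) ⊆ closedBall 0 R := by
      intro u hu
      by_contra hcon
      have hcase : u 0 < 0 ∨ 1 < u 0 ∨ 1 < ‖tl u‖ := by
        by_contra hc
        push Not at hc
        apply hcon
        rw [mem_closedBall_zero_iff]
        exact norm_le_hd_tl u (abs_le.2 ⟨by linarith, hc.2.1⟩) hc.2.2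
      apply hu
      have hev : Wm =ᶠ[nhds u] Gh Fm := by
        have c0 : Continuous (fun u : VV M => u 0) := continuous_hd
        have c1 : Continuous (fun u : VV M => ‖tl u‖) := continuous_tl.norm
        have : ∀ᶠ w : VV M in nhds u, w 0 < 0 ∨ 1 < w 0 ∨ 1 < ‖tl w‖ :=
          ((isOpen_lt c0 continuous_const).union ((isOpen_lt continuous_const c0).union (isOpen_lt continuous_const c1))).mem_nhds hcase
        filter_upwards [this] with w hw
        exact Wm_Gh (by rcases hw with h | h | h <;> simp [h, h.le])
      simp only [hev.fderiv_eq]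
      refine Gh_det_zero contDiff_Fm ?_
      rcases hcase with h | h | h
      · exact Or.inl h
      · exact Or.inr (Or.inl h)
      · exact Or.inr (Or.inr (Fm_far h.le))
    rw [setIntegral_eq_integral_of_forall_compl_eq_zero (fun u hu => by
      by_contra hcon; exact hu (hsupp hcon))]
    exact hc.integral_pos_of_hasCompactSupport_nonneg_nonzero
      (HasCompactSupport.of_support_subset_isCompact (isCompact_closedBall (0 : VV M) R) hsupp) det_Wm_nonneg hv2.ne'
  · refine Wm_Gh ?_
    by_contra hcon
    push Not at hcon
    apply hv
    rw [mem_closedBall_zero_iff]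
    exact norm_le_hd_tl v (abs_le.2 ⟨by linarith, hcon.2.1⟩) hcon.2.2.le

theorem bb_pow_ne {k : ℕ} (hk : 0 < k) : bb M ^ k ≠ 1 := by
  intro h1
  have hF1 : ∀ x : EE M, 1 ≤ ‖x‖ → Fm x = e0 M := fun x hx => Fm_far hx
  have hFne : ∀ x : EE M, Fm x ≠ 0 := fun x h0 => by have := norm_Fm x; rw [h0] at this; simp at this
  have hfball : IsBall (y0 M) (fun x => toS (Fm x)) :=
    ⟨continuous_toS contDiff_Fm.continuous hFne, fun x hx => by simp only; rw [hF1 x hx, toS_self]⟩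
  obtain ⟨j, hj⟩ := hopf (cls _ hfball)
  let pt : ℕ → EE M := fun i => (2 * i : ℝ) • v0 M
  have hptinj : Function.Injective pt := by
    intro a b hab
    have h2 := congrFun hab 0
    simpa [pt, v0] using h2
  let P : Finset (EE M) := (Finset.range k).map ⟨pt, hptinj⟩
  have hPcard : P.card = k := by simp [P]
  have hmem : ∀ p ∈ P, ∃ i < k, p = pt i := by
    intro p hp
    simp only [P, Finset.mem_map, Finset.mem_range] at hp
    obtain ⟨i, hi, rfl⟩ := hp
    exact ⟨i, hi, rfl⟩
  have hPsep : ∀ p ∈ P, ∀ q ∈ P, p ≠ q → 2 ≤ ‖p - q‖ := by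
    intro p hp q hq hpq
    obtain ⟨a, ha, rfl⟩ := hmem p hp
    obtain ⟨b, hb, rfl⟩ := hmem q hq
    have hab : a ≠ b := fun h => hpq (by rw [h])
    simp only [pt]
    rw [← sub_smul, norm_smul, norm_v0, mul_one, ← mul_sub, norm_mul, Real.norm_two]
    have : (1:ℝ) ≤ ‖(a:ℝ) - b‖ := by
      have h3 : (1:ℤ) ≤ |(a:ℤ) - b| := Int.one_le_abs (sub_ne_zero.2 (by exact_mod_cast hab))
      rw [Real.norm_eq_abs]; exact_mod_cast h3
    linarith
  set ρ : ℝ := 2 * k + 1 with hρ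
  have hρ0 : 0 < ρ := by positivity
  have hPn : ∀ p ∈ P, ‖p‖ + 1 ≤ ρ := by
    intro p hp
    obtain ⟨a, ha, rfl⟩ := hmem p hp
    simp only [pt]
    rw [norm_smul, norm_v0, mul_one, norm_mul, Real.norm_two, Real.norm_of_nonneg (Nat.cast_nonneg a)]
    have : (a:ℝ) ≤ k := by exact_mod_cast ha.le
    linarith
  have hfar : ∀ x, ρ ≤ ‖x‖ → ∀ p ∈ P, 1 ≤ ‖x - p‖ := by
    intro x hx p hp
    have := hPn p hp
    have := norm_sub_norm_le x p
    linarith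
  have hT1 : ∀ x, ‖trs P Fm x‖ = 1 := by
    intro x
    by_cases h : ∃ p ∈ P, ‖x - p‖ ≤ 1
    · obtain ⟨p, hp, hx⟩ := h
      rw [trs_in hF1 hPsep hp hx, norm_Fm]
    · push Not at h
      rw [trs_out hF1 (fun p hp => (h p hp).le), norm_e0]
  have hTne : ∀ x, trs P Fm x ≠ 0 := fun x h0 => by have := hT1 x; rw [h0] at this; simp at this
  have hcT : Continuous (fun x => toS (trs P Fm x)) := continuous_toS (contDiff_trs contDiff_Fm).continuous hTne
  have hcoe : ∀ x, trs P Fm x = (toS (trs P Fm x) : SS M) := by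
    intro x; rw [toS_coe (hTne x), hT1]; simp
  -- the scaled function
  let P' : Finset (EE M) := P.image (fun p => ρ⁻¹ • p)
  have hinjs : Function.Injective (fun p : EE M => ρ⁻¹ • p) := smul_right_injective _ (inv_ne_zero hρ0.ne')
  have hsc : ∀ x p : EE M, ‖x - ρ⁻¹ • p‖ = ρ⁻¹ * ‖ρ • x - p‖ := by
    intro x p
    have : x - ρ⁻¹ • p = ρ⁻¹ • (ρ • x - p) := by rw [smul_sub, smul_smul, inv_mul_cancel₀ hρ0.ne', one_smul]
    rw [this, norm_smul, norm_inv, Real.norm_of_nonneg hρ0.le]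
  have hMB : IsMB P' ρ⁻¹ (fun _ x => toS (Fm x)) (fun x => toS (trs P Fm (ρ • x))) := by
    refine ⟨hcT.comp (continuous_const_smul ρ), ?_, ?_⟩
    · intro q hq x hx
      obtain ⟨p, hp, rfl⟩ := Finset.mem_image.1 hq
      rw [hsc] at hx
      have : ‖ρ • x - p‖ ≤ 1 := by
        have := mul_le_mul_of_nonneg_left hx hρ0.le
        rwa [← mul_assoc, mul_inv_cancel₀ hρ0.ne', one_mul] at this
      rw [trs_in hF1 hPsep hp this, inv_inv, smul_sub, smul_smul, mul_inv_cancel₀ hρ0.ne', one_smul]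
    · intro x hx
      rw [trs_out hF1, toS_self]
      intro p hp
      have := hx _ (Finset.mem_image_of_mem _ hp)
      rw [hsc] at this
      have := mul_le_mul_of_nonneg_left this hρ0.le
      rwa [← mul_assoc, mul_inv_cancel₀ hρ0.ne', one_mul] at this
  obtain ⟨hb, hcls⟩ := multiball (σ := ρ⁻¹) (by positivity) (β := fun _ x => toS (Fm x)) (fun _ => hfball) (fun _ => j) P'
    (fun _ _ => hj)
    (by
      intro q hq
      obtain ⟨p, hp, rfl⟩ := Finset.mem_image.1 hq
      have := hPn p hp
      rw [norm_smul, norm_inv, Real.norm_of_nonneg hρ0.le]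
      have : ρ⁻¹ * ‖p‖ + ρ⁻¹ = ρ⁻¹ * (‖p‖ + 1) := by ring
      rw [this, inv_mul_le_iff₀ hρ0]; linarith)
    (by
      intro q hq q' hq' hne
      obtain ⟨p, hp, rfl⟩ := Finset.mem_image.1 hq
      obtain ⟨p', hp', rfl⟩ := Finset.mem_image.1 hq'
      have := hPsep p hp p' hp' (fun h => hne (by rw [h]))
      rw [← smul_sub, norm_smul, norm_inv, Real.norm_of_nonneg hρ0.le, mul_comm]
      gcongr) hMB
  rw [Finset.sum_const, Finset.card_image_of_injective _ hinjs, hPcard, nsmul_eq_mul, zpow_mul, zpow_natCast, h1, one_zpow, cls_one, cls_eq] at hcls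
  have hH : HomIn {h : EE M → SS M | ∀ x, ρ ≤ ‖x‖ → h x = y0 M} (fun x => toS (trs P Fm x)) (fun _ => y0 M) := by
    have := HomIn.pre (B := {h : EE M → SS M | ∀ x, ρ ≤ ‖x‖ → h x = y0 M}) hcls (φ := fun x : EE M => ρ⁻¹ • x) (continuous_const_smul _) ?_
    · have e : (fun x => toS (trs P Fm (ρ • x))) ∘ (fun x : EE M => ρ⁻¹ • x) = fun x => toS (trs P Fm x) := by
        funext x; simp only [Function.comp]; rw [smul_smul, mul_inv_cancel₀ hρ0.ne', one_smul]
      rw [e] at this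
      exact this
    · intro h hh x hx
      simp only [Function.comp]
      have hx' : 1 ≤ ‖ρ⁻¹ • x‖ := by
        rw [norm_smul, norm_inv, Real.norm_of_nonneg hρ0.le, inv_mul_eq_div, le_div_iff₀ hρ0]; linarith
      rw [hh _ hx']
      exact hb.2 _ hx'
  have h0 := II_null (contDiff_trs contDiff_Fm) hρ0 (fun x hx => trs_out hF1 (hfar x hx)) hcoe hH
  rw [II_trs contDiff_Fm hF1 hPsep, hPcard] at h0
  have := II_Fm (M := M)
  have hk' : (0:ℝ) < k := by exact_mod_cast hk
  have := mul_pos hk' this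
  linarith

theorem bb_zpow_inj {a b : ℤ} (h : bb M ^ a = bb M ^ b) : a = b := by
  have hnf : ¬ IsOfFinOrder (bb M) := by
    rw [isOfFinOrder_iff_pow_eq_one]
    rintro ⟨n, hn, h1⟩
    exact bb_pow_ne hn h1
  exact injective_zpow_iff_not_isOfFinOrder.2 hnf h
end Ess2

end RPX

namespace RPX
open Metric
open Set
set_option linter.unusedSectionVars false
set_option linter.unusedSimpArgs false
set_option linter.unusedVariables false
set_option linter.style.longLine false


section Charts
variable {M : ℕ}

/-- antipode -/
noncomputable def ng (y : SS M) : SS M := Sph.antipode (M + 2) y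
lemma ng_coe (y : SS M) : ((ng y : SS M) : VV M) = -(y : VV M) := rfl
lemma ng_ng (y : SS M) : ng (ng y) = y := Subtype.ext (by simp [ng_coe])
lemma continuous_ng : Continuous (ng : SS M → SS M) :=
  Continuous.subtype_mk (continuous_subtype_val.neg) _
lemma ng_ne (y : SS M) : ng y ≠ y := by
  intro h
  have h1 := congrArg (Subtype.val) h
  rw [ng_coe, neg_eq_iff_add_eq_zero, ← two_smul ℝ, smul_eq_zero] at h1
  rcases h1 with h1 | h1
  · norm_num at h1
  · exact SS_ne y h1
lemma toS_neg {w : VV M} (h : w ≠ 0) : toS (-w) = ng (toS w) := by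
  apply Subtype.ext
  rw [toS_coe (neg_ne_zero.2 h), ng_coe, toS_coe h, norm_neg, smul_neg]

/-- sign action, `true` is the antipode -/
noncomputable def sg (o : Bool) (y : SS M) : SS M := if o then ng y else y
lemma sg_true (y : SS M) : sg true y = ng y := rfl
lemma sg_false (y : SS M) : sg false y = y := rfl
lemma continuous_sg (o : Bool) : Continuous (sg o : SS M → SS M) := by
  cases o
  · exact continuous_id
  · exact continuous_ng
lemma sg_sg (o : Bool) (y : SS M) : sg o (sg o y) = y := by
  cases o
  · rfl
  · exact ng_ng y
lemma sg_ng (o : Bool) (y : SS M) : sg o (ng y) = ng (sg o y) := by cases o <;> rfl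

noncomputable def ini (w : VV M) : EE M := fun i => w i.castSucc
noncomputable def las (w : VV M) : ℝ := w (Fin.last _)
noncomputable def sn (x : EE M) (h : ℝ) : VV M := WithLp.toLp 2 (Fin.snoc x h)
@[simp] lemma ini_sn (x : EE M) (h : ℝ) : ini (sn x h) = x := by funext i; simp [ini, sn]
@[simp] lemma las_sn (x : EE M) (h : ℝ) : las (sn x h) = h := by simp [las, sn]
lemma sn_ext {v w : VV M} (h1 : ini v = ini w) (h2 : las v = las w) : v = w := by
  ext i
  refine Fin.lastCases ?_ (fun j => ?_) i
  · exact h2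
  · exact congrFun h1 j
lemma ini_smul (c : ℝ) (w : VV M) : ini (c • w) = c • ini w := rfl
lemma las_smul (c : ℝ) (w : VV M) : las (c • w) = c * las w := rfl
lemma ini_neg (w : VV M) : ini (-w) = -ini w := rfl
lemma las_neg (w : VV M) : las (-w) = -las w := rfl
lemma continuous_ini : Continuous (ini : VV M → EE M) := by unfold ini; fun_prop
lemma continuous_las : Continuous (las : VV M → ℝ) := by unfold las; fun_prop
lemma continuous_sn {X : Type*} [TopologicalSpace X] {a : X → EE M} {h : X → ℝ} (ha : Continuous a) (hh : Continuous h) :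
    Continuous (fun x => sn (a x) (h x)) := by
  unfold sn
  refine (PiLp.continuous_toLp 2 _).comp ?_
  exact Continuous.finSnoc ha hh
lemma sn_zero_iff {x : EE M} {h : ℝ} : sn x h = 0 ↔ x = 0 ∧ h = 0 := by
  constructor
  · intro e
    have h1 := congrArg ini e
    have h2 := congrArg las e
    rw [ini_sn] at h1; rw [las_sn] at h2
    exact ⟨h1, h2⟩
  · rintro ⟨rfl, rfl⟩
    apply sn_ext
    · rw [ini_sn]; rfl
    · rw [las_sn]; rfl
lemma sn_smul (c : ℝ) (x : EE M) (h : ℝ) : c • sn x h = sn (c • x) (c * h) :=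
  sn_ext (by rw [ini_smul, ini_sn, ini_sn]) (by rw [las_smul, las_sn, las_sn])
lemma sn_neg (x : EE M) (h : ℝ) : - sn x h = sn (-x) (-h) :=
  sn_ext (by rw [ini_neg, ini_sn, ini_sn]) (by rw [las_neg, las_sn, las_sn])

noncomputable def dn (w : VV M) : ℝ := ‖ini w‖ + |las w|
lemma dn_pos {w : VV M} (h : w ≠ 0) : 0 < dn w := by
  have h1 := norm_nonneg (ini w)
  have h2 := abs_nonneg (las w)
  rcases eq_or_lt_of_le h1 with h1' | h1'
  · rcases eq_or_lt_of_le h2 with h2' | h2'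
    · exfalso; apply h
      apply sn_ext
      · exact norm_eq_zero.1 h1'.symm
      · exact abs_eq_zero.1 h2'.symm
    · unfold dn; linarith
  · unfold dn; linarith
lemma continuous_dn : Continuous (dn : VV M → ℝ) := continuous_ini.norm.add continuous_las.abs

noncomputable def ivm (y : SS M) : EE M := (dn (y : VV M))⁻¹ • ini (y : VV M)
lemma continuous_ivm : Continuous (ivm : SS M → EE M) := by
  unfold ivm
  exact ((continuous_dn.comp continuous_subtype_val).inv₀ (fun y => (dn_pos (SS_ne y)).ne')).smul
    (continuous_ini.comp continuous_subtype_val)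
lemma norm_ivm (y : SS M) : ‖ivm y‖ = 1 - |las (y : VV M)| / dn (y : VV M) := by
  have h := dn_pos (SS_ne y)
  rw [ivm, norm_smul, norm_inv, Real.norm_of_nonneg h.le]
  field_simp
  unfold dn; ring
lemma norm_ivm_le (y : SS M) : ‖ivm y‖ ≤ 1 := by
  rw [norm_ivm]
  have := div_nonneg (abs_nonneg (las (y : VV M))) (dn_pos (SS_ne y)).le
  linarith
lemma norm_ivm_eq {y : SS M} (h : las (y : VV M) = 0) : ‖ivm y‖ = 1 := by rw [norm_ivm, h]; simp
lemma ivm_ng (y : SS M) : ivm (ng y) = - ivm y := by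
  rw [ivm, ivm, ng_coe, ini_neg, smul_neg, dn, dn, ini_neg, las_neg, norm_neg, abs_neg]

noncomputable def clm (x : EE M) : EE M := (max 1 ‖x‖)⁻¹ • x
lemma clm_pos (x : EE M) : 0 < max 1 ‖x‖ := lt_of_lt_of_le one_pos (le_max_left _ _)
lemma continuous_clm : Continuous (clm : EE M → EE M) := by
  unfold clm
  exact ((continuous_const.max continuous_norm).inv₀ (fun x => (clm_pos x).ne')).smul continuous_id
lemma clm_in {x : EE M} (h : ‖x‖ ≤ 1) : clm x = x := by simp [clm, h]
lemma norm_clm_out {x : EE M} (h : 1 ≤ ‖x‖) : ‖clm x‖ = 1 := by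
  rw [clm, max_eq_right h, norm_smul, norm_inv, norm_norm, inv_mul_cancel₀ (by linarith)]
lemma norm_clm_le (x : EE M) : ‖clm x‖ ≤ 1 := by
  rcases le_total ‖x‖ 1 with h | h
  · rwa [clm_in h]
  · exact (norm_clm_out h).le
lemma clm_neg (x : EE M) : clm (-x) = - clm x := by simp [clm]
lemma clm_clm (x : EE M) : clm (clm x) = clm x := clm_in (norm_clm_le x)
lemma clm_v0 : clm (v0 M) = v0 M := clm_in norm_v0.le

/-- hemisphere charts -/
noncomputable def th (s : ℝ) (x : EE M) : SS M := toS (sn x (s * max (1 - ‖x‖) 0))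
lemma th_ne (s : ℝ) (hs : s ≠ 0) (x : EE M) : sn x (s * max (1 - ‖x‖) 0) ≠ 0 := by
  intro h
  rw [sn_zero_iff] at h
  obtain ⟨rfl, h2⟩ := h
  simp at h2
  exact hs h2
lemma continuous_th {s : ℝ} (hs : s ≠ 0) : Continuous (th s : EE M → SS M) :=
  continuous_toS (continuous_sn continuous_id (by fun_prop)) (th_ne s hs)
lemma th_out {s : ℝ} {x : EE M} (h : 1 ≤ ‖x‖) : th s x = toS (sn x 0) := by
  rw [th, max_eq_right (by linarith), mul_zero]
lemma sn_v0 : sn (v0 M) 0 = (y0 M : VV M) := by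
  apply sn_ext
  · rw [ini_sn]; funext i
    rw [y0_coe]
    simp only [ini, v0, Pi.single_apply, PiLp.single_apply]
    by_cases h : i = 0
    · simp [h]
    · rw [if_neg h, if_neg]
      intro h'; apply h
      exact Fin.castSucc_injective _ h'
  · rw [las_sn, y0_coe]
    simp [las]
lemma th_v0 {s : ℝ} : th s (v0 M) = y0 M := by
  rw [th_out norm_v0.ge, sn_v0, toS_self]
lemma th_neg {s : ℝ} (hs : s ≠ 0) (x : EE M) : th (-s) x = ng (th s (-x)) := by
  rw [th, th, ← toS_neg (th_ne s hs _), sn_neg, norm_neg, neg_neg, neg_mul]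
lemma ivm_th {s : ℝ} (hs : |s| = 1) (x : EE M) : ivm (th s x) = clm x := by
  have hs0 : s ≠ 0 := fun h => by rw [h] at hs; simp at hs
  have h0 := th_ne s hs0 x
  rw [ivm, th, toS_coe h0, dn, ini_smul, las_smul, ini_sn, las_sn, clm, smul_smul]
  congr 1
  have hc : 0 < ‖sn x (s * max (1 - ‖x‖) 0)‖⁻¹ := inv_pos.2 (norm_pos_iff.2 h0)
  set c := ‖sn x (s * max (1 - ‖x‖) 0)‖⁻¹
  have e : ‖c • x‖ + |c * (s * max (1 - ‖x‖) 0)| = c * max 1 ‖x‖ := by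
    rw [norm_smul, Real.norm_of_nonneg hc.le, abs_mul, abs_mul, hs, abs_of_pos hc, abs_of_nonneg (le_max_right _ _), one_mul, ← mul_add]
    congr 1
    rcases le_total ‖x‖ 1 with h | h
    · rw [max_eq_left (by linarith), max_eq_left h]; ring
    · rw [max_eq_right (by linarith), max_eq_right h]; ring
  rw [e, mul_inv, mul_assoc, mul_comm, mul_assoc, mul_inv_cancel₀ hc.ne', mul_one]
lemma th_ivm {s : ℝ} (hs : |s| = 1) {y : SS M} (hy : 0 ≤ s * las (y : VV M)) : th s (ivm y) = y := by
  have hd := dn_pos (SS_ne y)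
  have hss : s * s = 1 := by rw [← abs_mul_abs_self, hs, one_mul]
  have e1 : s * max (1 - ‖ivm y‖) 0 = (dn (y : VV M))⁻¹ * las (y : VV M) := by
    rw [max_eq_left (by linarith [norm_ivm_le y]), norm_ivm]
    have : |las (y : VV M)| = s * las (y : VV M) := by
      rw [← abs_of_nonneg hy, abs_mul, hs, one_mul]
    rw [this]
    have : s * (1 - (1 - s * las (y : VV M) / dn (y : VV M))) = (s * s) * las (y : VV M) / dn (y : VV M) := by ring
    rw [this, hss, one_mul, div_eq_inv_mul]
  rw [th, e1]
  have : sn (ivm y) ((dn (y : VV M))⁻¹ * las (y : VV M)) = (dn (y : VV M))⁻¹ • (y : VV M) := by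
    apply sn_ext
    · rw [ini_sn, ini_smul]; rfl
    · rw [las_sn, las_smul]
  rw [this, toS_smul (inv_pos.2 hd), toS_self]
lemma las_th {s : ℝ} (hs : |s| = 1) (x : EE M) : 0 ≤ s * las (th s x : VV M) ∧ (las (th s x : VV M) = 0 → 1 ≤ ‖x‖) := by
  have hs0 : s ≠ 0 := fun h => by rw [h] at hs; simp at hs
  have h0 := th_ne s hs0 x
  have hc : 0 < ‖sn x (s * max (1 - ‖x‖) 0)‖⁻¹ := inv_pos.2 (norm_pos_iff.2 h0)
  have hss : s * s = 1 := by rw [← abs_mul_abs_self, hs, one_mul]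
  rw [th, toS_coe h0, las_smul, las_sn]
  set c := ‖sn x (s * max (1 - ‖x‖) 0)‖⁻¹
  constructor
  · have : s * (c * (s * max (1 - ‖x‖) 0)) = (s * s) * (c * max (1 - ‖x‖) 0) := by ring
    rw [this, hss, one_mul]
    exact mul_nonneg hc.le (le_max_right _ _)
  · intro h
    rcases mul_eq_zero.1 h with h | h
    · exact absurd h hc.ne'
    · rcases mul_eq_zero.1 h with h | h
      · exact absurd h hs0
      · by_contra hcon
        push Not at hcon
        rw [max_eq_left (by linarith)] at h
        linarith

/-- gluing two hemispheres -/
noncomputable def tot2 (f g : EE M → SS M) (y : SS M) : SS M := by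
  classical exact if 0 ≤ las (y : VV M) then f (ivm y) else g (ivm y)
lemma continuous_tot2 {X : Type*} [TopologicalSpace X] {f g : X → EE M → SS M}
    (hf : Continuous (fun p : X × EE M => f p.1 p.2)) (hg : Continuous (fun p : X × EE M => g p.1 p.2))
    (hfg : ∀ t x, ‖x‖ = 1 → f t x = g t x) : Continuous (fun p : X × SS M => tot2 (f p.1) (g p.1) p.2) := by
  unfold tot2
  refine Continuous.if_le ?_ ?_ continuous_const (continuous_las.comp (continuous_subtype_val.comp continuous_snd)) ?_
  · exact hf.comp (continuous_fst.prodMk (continuous_ivm.comp continuous_snd))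
  · exact hg.comp (continuous_fst.prodMk (continuous_ivm.comp continuous_snd))
  · intro p hp
    exact hfg _ _ (norm_ivm_eq hp.symm)
lemma tot2_pos (f g : EE M → SS M) (x : EE M) : tot2 f g (th 1 x) = f (clm x) := by
  have h := (las_th (s := 1) (by simp) x).1
  rw [one_mul] at h
  simp only [tot2, if_pos h]
  rw [ivm_th (by simp)]
lemma tot2_neg {f g : EE M → SS M} (hfg : ∀ x, ‖x‖ = 1 → f x = g x) (x : EE M) : tot2 f g (th (-1) x) = g (clm x) := by
  have h := las_th (s := -1) (by simp) x
  simp only [tot2]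
  split_ifs with h1
  · have : las (th (-1) x : VV M) = 0 := by linarith [h.1]
    rw [ivm_th (by simp), hfg _ (norm_clm_out (h.2 this))]
  · rw [ivm_th (by simp)]

lemma th_clm (s : ℝ) (x : EE M) : th s (clm x) = th s x := by
  rcases le_total ‖x‖ 1 with h | h
  · rw [clm_in h]
  · rw [th_out h, th_out (norm_clm_out h).ge, clm]
    have : sn ((max 1 ‖x‖)⁻¹ • x) 0 = (max 1 ‖x‖)⁻¹ • sn x 0 := by rw [sn_smul, mul_zero]
    rw [this, toS_smul (inv_pos.2 (clm_pos x))]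
end Charts

end RPX

namespace RPX
open Metric
open Set
set_option linter.unusedSectionVars false
set_option linter.unusedSimpArgs false
set_option linter.unusedVariables false
set_option linter.style.longLine false


section Sym
variable {M : ℕ}

def Asy (o : Bool) : Set (EE M → SS M) := {h | h (v0 M) = y0 M ∧ ∀ x, ‖x‖ = 1 → h (-x) = sg o (h x)}
def Qsy (o : Bool) : Set (SS M → SS M) := {F | F (y0 M) = y0 M ∧ ∀ y, F (ng y) = sg o (F y)}
noncomputable def tot (o : Bool) (f : EE M → SS M) : SS M → SS M := tot2 f (fun x => sg o (f (-x)))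

lemma asy_compat {o : Bool} {f : EE M → SS M} (hf : f ∈ Asy o) (x : EE M) (hx : ‖x‖ = 1) : f x = sg o (f (-x)) := by
  rw [hf.2 x hx, sg_sg]
lemma ivm_y0 : ivm (y0 M) = v0 M := by
  rw [← th_v0 (s := 1), ivm_th (by simp), clm_v0]
lemma las_y0 : las (y0 M : VV M) = 0 := by rw [← sn_v0, las_sn]
lemma tot_mem {o : Bool} {f : EE M → SS M} (hf : f ∈ Asy o) : tot o f ∈ Qsy o := by
  refine ⟨?_, fun y => ?_⟩
  · simp only [tot, tot2, las_y0, le_refl, if_true, ivm_y0]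
    exact hf.1
  · simp only [tot, tot2, ng_coe, las_neg, ivm_ng, neg_neg]
    rcases lt_trichotomy (las (y : VV M)) 0 with h | h | h
    · rw [if_pos (by linarith), if_neg (by linarith), sg_sg]
    · rw [h, neg_zero, if_pos le_rfl, if_pos le_rfl]
      exact hf.2 _ (norm_ivm_eq h)
    · rw [if_neg (by linarith), if_pos h.le]
lemma tot_th (o : Bool) (f : EE M → SS M) (x : EE M) : tot o f (th 1 x) = f (clm x) := tot2_pos _ _ _
lemma tot_thm {o : Bool} {f : EE M → SS M} (hf : f ∈ Asy o) (x : EE M) : tot o f (th (-1) x) = sg o (f (- clm x)) :=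
  tot2_neg (asy_compat hf) _
lemma tot_of {o : Bool} {F : SS M → SS M} (hF : F ∈ Qsy o) : tot o (F ∘ th 1) = F := by
  funext y
  simp only [tot, tot2, Function.comp]
  split_ifs with h
  · rw [th_ivm (by simp) (by simpa using h)]
  · push Not at h
    rw [← ivm_ng, th_ivm (by simp) (by rw [ng_coe, las_neg]; linarith), hF.2, sg_sg]
lemma th_neg_out {x : EE M} (hx : 1 ≤ ‖x‖) : th 1 (-x) = ng (th 1 x) := by
  have h1 := th_neg (s := 1) one_ne_zero (-x)
  rw [neg_neg] at h1
  rw [← h1, th_out (by rwa [norm_neg]), th_out (by rwa [norm_neg])]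
lemma th_mem {o : Bool} {F : SS M → SS M} (hF : F ∈ Qsy o) : F ∘ th 1 ∈ Asy o := by
  refine ⟨?_, fun x hx => ?_⟩
  · simp only [Function.comp, th_v0]; exact hF.1
  · simp only [Function.comp]; rw [th_neg_out hx.ge, hF.2]
lemma tot_homIn {o : Bool} {f g : EE M → SS M} (h : HomIn (Asy o) f g) : HomIn (Qsy o) (tot o f) (tot o g) := by
  obtain ⟨H, h1, h2, h3, h4⟩ := h.exists_clamp
  rw [← h3 0 le_rfl, ← h4 1 le_rfl]
  refine HomIn.mk_family (fun t => tot o (H t)) ?_ (fun t _ => tot_mem (h2 t))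
  refine continuous_tot2 (f := H) (g := fun t x => sg o (H t (-x))) h1 ?_ (fun t x hx => asy_compat (h2 t) x hx)
  exact (continuous_sg o).comp (h1.comp (continuous_fst.prodMk continuous_snd.neg))
lemma th_homIn {o : Bool} {F G : SS M → SS M} (h : HomIn (Qsy o) F G) : HomIn (Asy o) (F ∘ th 1) (G ∘ th 1) :=
  h.pre (continuous_th one_ne_zero) (fun k hk => th_mem hk)
lemma continuous_tot {o : Bool} {f : EE M → SS M} (hf : f ∈ Asy o) (hc : Continuous f) : Continuous (tot o f) :=
  (tot_homIn (HomIn.refl hc hf)).left_cont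
lemma clm_homIn {o : Bool} {f : EE M → SS M} (hf : f ∈ Asy o) (hc : Continuous f) : HomIn (Asy o) f (f ∘ clm) := by
  have := HomIn.mk_family (A := Asy o) (fun t x => f ((1 - t) • x + t • clm x)) ?_ ?_
  · have e : (fun x => f (clm x)) = f ∘ clm := rfl
    simp only [sub_zero, one_smul, zero_smul, add_zero, sub_self, zero_add] at this
    exact this
  · exact hc.comp (((continuous_const.sub continuous_fst).smul continuous_snd).add (continuous_fst.smul (continuous_clm.comp continuous_snd)))
  · intro t ht
    have key : ∀ x : EE M, ‖x‖ = 1 → (1 - t) • x + t • clm x = x := fun x hx => by rw [clm_in hx.le]; module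
    refine ⟨?_, fun x hx => ?_⟩
    · simp only [key _ norm_v0]; exact hf.1
    · simp only [key _ hx, key (-x) (by rwa [norm_neg])]; exact hf.2 x hx
lemma HR.asy {o : Bool} {f g : EE M → SS M} (h : HR f g) (hf : f ∈ Asy o) : HomIn (Asy o) f g := by
  refine HomIn.mono h (fun k hk => ⟨?_, fun x hx => ?_⟩)
  · rw [hk _ norm_v0.ge]; exact hf.1
  · rw [hk x hx.ge, hk (-x) (by rw [norm_neg, hx]), hf.2 x hx]
lemma ball_asy {β : EE M → SS M} (hβ : IsBall (y0 M) β) : β ∈ Asy (M := M) false :=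
  ⟨hβ.2 _ norm_v0.ge, fun x hx => by rw [hβ.2 _ hx.ge, hβ.2 _ (by rw [norm_neg, hx])]; rfl⟩
lemma th_asy : th 1 ∈ Asy (M := M) true := ⟨th_v0, fun x hx => th_neg_out hx.ge⟩
lemma st_asy {o : Bool} {f β : EE M → SS M} (hf : f ∈ Asy o) (hβ : IsBall (y0 M) β) : st f β ∈ Asy o := by
  refine ⟨?_, fun x hx => ?_⟩
  · rw [st, star_bd hβ norm_v0.ge]; exact hf.1
  · simp only [st]
    rw [star_bd hβ hx.ge, star_bd hβ (by rw [norm_neg, hx]), hf.2 x hx]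

/-! degree of a pointed map -/
lemma dg_ex (G : SS M → SS M) : ∃ d : ℤ, ∀ (hG : Continuous G) (h0 : G (y0 M) = y0 M), postHom G hG h0 (bb M) = bb M ^ d := by
  by_cases h : Continuous G ∧ G (y0 M) = y0 M
  · obtain ⟨k, hk⟩ := hopf (postHom G h.1 h.2 (bb M))
    exact ⟨k, fun _ _ => hk⟩
  · exact ⟨0, fun h1 h2 => absurd ⟨h1, h2⟩ h⟩
noncomputable def dg (G : SS M → SS M) : ℤ := (dg_ex G).choose
lemma dg_cls {G : SS M → SS M} (hG : Continuous G) (h0 : G (y0 M) = y0 M) {β : EE M → SS M} {hβ : IsBall (y0 M) β} {k : ℤ}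
    (h : cls β hβ = bb M ^ k) : cls (G ∘ β) (hβ.postc hG h0) = bb M ^ (dg G * k) := by
  rw [← postHom_cls G hG h0 β hβ, h, map_zpow, (dg_ex G).choose_spec hG h0, ← zpow_mul]; rfl
lemma dg_eq {G : SS M → SS M} (hG : Continuous G) (h0 : G (y0 M) = y0 M) {d : ℤ}
    (h : cls (G ∘ c0) (c0_ball.postc hG h0) = bb M ^ d) : dg G = d := by
  have := dg_cls hG h0 (β := c0) (hβ := c0_ball) (k := 1) (by rw [zpow_one]; rfl)
  rw [h, mul_one] at this
  exact (bb_zpow_inj this).symm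
lemma dg_id : dg (id : SS M → SS M) = 1 := dg_eq continuous_id rfl (by rw [zpow_one]; rfl)
lemma dg_comp {G H : SS M → SS M} (hG : Continuous G) (h0 : G (y0 M) = y0 M) (hH : Continuous H) (h1 : H (y0 M) = y0 M) :
    dg (G ∘ H) = dg G * dg H := by
  refine dg_eq (hG.comp hH) (by simp [h0, h1]) ?_
  have := dg_cls hH h1 (β := c0) (hβ := c0_ball) (k := 1) (by rw [zpow_one]; rfl)
  have := dg_cls hG h0 this
  rw [mul_one] at this
  exact this
lemma dg_homIn {o : Bool} {G H : SS M → SS M} (h : HomIn (Qsy o) G H) : dg G = dg H := by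
  have hH := h.right_mem
  have hG := h.left_mem
  refine dg_eq h.left_cont hG.1 ?_
  have := dg_cls h.right_cont hH.1 (β := c0) (hβ := c0_ball) (k := 1) (by rw [zpow_one]; rfl)
  rw [mul_one] at this
  rw [← this, cls_eq]
  refine h.pre c0_ball.1 (fun k hk x hx => ?_)
  simp only [Function.comp, c0_ball.2 x hx]
  rw [hk.1, hG.1]

lemma hemi : ∃ d : ℤ, d * d = 1 ∧ ∀ G : SS M → SS M, Continuous G → G (y0 M) = y0 M →
    ∃ (β : EE M → SS M) (hβ : IsBall (y0 M) β), cls β hβ = bb M ^ (dg G * d) ∧ HR (G ∘ th 1) (st (G ∘ th (-1)) β) := by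
  have hm1 : (-1:ℝ) ≠ 0 := by norm_num
  have hff : ∀ x : EE M, 1 ≤ ‖x‖ → th 1 x = th (-1) x := fun x hx => by rw [th_out hx, th_out hx]
  have hb : IsBall (y0 M) (dif (v0 M) (th (-1)) (th 1)) := dif_isBall (continuous_th hm1) (continuous_th one_ne_zero) hff th_v0
  have ht := torsor (y0 := y0 M) (continuous_th hm1) (continuous_th one_ne_zero) th_v0 hff
  obtain ⟨d, hd⟩ := hopf (cls _ hb)
  have key : ∀ G : SS M → SS M, Continuous G → G (y0 M) = y0 M →
    ∃ (β : EE M → SS M) (hβ : IsBall (y0 M) β), cls β hβ = bb M ^ (dg G * d) ∧ HR (G ∘ th 1) (st (G ∘ th (-1)) β) := by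
    intro G hG h0
    refine ⟨_, _, dg_cls hG h0 hd, ?_⟩
    rw [st, ← post_star th_v0 hb h0]
    exact ht.post hG
  refine ⟨d, ?_, key⟩
  let G : SS M → SS M := tot2 c0 (fun _ => y0 M)
  have hcomp : ∀ x : EE M, ‖x‖ = 1 → c0 x = y0 M := fun x hx => c0_ball.2 x hx.ge
  have hG : Continuous G := by
    have := continuous_tot2 (X := Unit) (f := fun _ => c0) (g := fun _ _ => y0 M) (c0_ball.1.comp continuous_snd) continuous_const (fun _ => hcomp)
    exact this.comp (continuous_const (y := ()) |>.prodMk continuous_id)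
  have h0 : G (y0 M) = y0 M := by
    rw [← th_v0 (s := 1)]; simp only [G]; rw [tot2_pos, clm_v0, hcomp _ norm_v0, th_v0]
  obtain ⟨β, hβ, h1, h2⟩ := key G hG h0
  have e1 : G ∘ th 1 = c0 := by
    funext x; simp only [G, Function.comp, tot2_pos]
    rcases le_total ‖x‖ 1 with h | h
    · rw [clm_in h]
    · rw [c0_ball.2 x h, hcomp _ (norm_clm_out h)]
  have e2 : G ∘ th (-1) = fun _ => y0 M := by
    funext x; simp only [G, Function.comp]; rw [tot2_neg hcomp]
  rw [e1, e2] at h2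
  have h3 := h2.trans (const_star hβ)
  have h4 : cls c0 c0_ball = cls β hβ := cls_eq.2 h3
  rw [h1] at h4
  have h5 : (1:ℤ) = dg G * d := bb_zpow_inj (M := M) (by rw [zpow_one]; exact h4)
  rcases Int.isUnit_iff.1 (IsUnit.of_mul_eq_one (dg G) (by rw [mul_comm]; exact h5.symm) : IsUnit d) with h | h <;> rw [h] <;> rfl
end Sym

end RPX

namespace RPX
open Metric
open Set
set_option linter.unusedSectionVars false
set_option linter.unusedSimpArgs false
set_option linter.unusedVariables false
set_option linter.style.longLine false


section GenPos
variable {M : ℕ}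

/-- parametrised bad set -/
noncomputable def Psi (G T : EE M → VV M) (e : ℕ) (j : Fin (M+2)) (s : ℝ) (k : Fin (M+1)) (p : EE M × (Fin M → VV M)) : Fin (M+1) → VV M :=
  k.insertNth (-(((Function.update p.1 j s) k.succ) ^ e)⁻¹ • (G (Function.update p.1 j s) + p.1 j • T (Function.update p.1 j s)
    + ∑ i, ((Function.update p.1 j s) (k.succAbove i).succ) ^ e • p.2 i)) p.2

lemma contDiff_upd (j : Fin (M+2)) (s : ℝ) : ContDiff ℝ 1 (fun y : EE M => Function.update y j s) := by
  rw [contDiff_pi]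
  intro i
  by_cases h : i = j
  · subst h; simp only [Function.update_self]; exact contDiff_const
  · simp only [Function.update_of_ne h]; exact contDiff_apply ℝ ℝ i

lemma Psi_smooth {G T : EE M → VV M} (hG : ContDiff ℝ 1 G) (hT : ContDiff ℝ 1 T) (e : ℕ) (j : Fin (M+2)) (s : ℝ) (k : Fin (M+1))
    {p : EE M × (Fin M → VV M)} (hp : (Function.update p.1 j s) k.succ ≠ 0) : ContDiffAt ℝ 1 (Psi G T e j s k) p := by
  have hu : ContDiff ℝ 1 (fun p : EE M × (Fin M → VV M) => Function.update p.1 j s) := (contDiff_upd j s).comp contDiff_fst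
  have hc : ∀ i, ContDiff ℝ 1 (fun p : EE M × (Fin M → VV M) => (Function.update p.1 j s) i) := fun i => (contDiff_apply ℝ ℝ i).comp hu
  have hy : ∀ i, ContDiff ℝ 1 (fun p : EE M × (Fin M → VV M) => p.1 i) := fun i => (contDiff_apply ℝ ℝ i).comp contDiff_fst
  have he : ∀ i, ContDiff ℝ 1 (fun p : EE M × (Fin M → VV M) => p.2 i) := fun i => (contDiff_apply ℝ (VV M) i).comp contDiff_snd
  rw [contDiffAt_pi]
  intro i
  rcases Fin.eq_self_or_eq_succAbove k i with h | ⟨i', h⟩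
  · subst h
    simp only [Psi, Fin.insertNth_apply_same]
    have h1 : ContDiffAt ℝ 1 (fun p : EE M × (Fin M → VV M) => -(((Function.update p.1 j s) i.succ) ^ e)⁻¹) p :=
      (ContDiffAt.inv ((hc _).pow e).contDiffAt (pow_ne_zero _ hp)).neg
    have h2 : ContDiff ℝ 1 (fun p : EE M × (Fin M → VV M) => G (Function.update p.1 j s) + p.1 j • T (Function.update p.1 j s)
        + ∑ i', ((Function.update p.1 j s) (i.succAbove i').succ) ^ e • p.2 i') :=
      ((hG.comp hu).add ((hy j).smul (hT.comp hu))).add (ContDiff.sum (fun i _ => ((hc _).pow e).smul (he i)))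
    exact h1.smul h2.contDiffAt
  · subst h
    simp only [Psi, Fin.insertNth_apply_succAbove]
    exact (he i').contDiffAt

lemma gen_pos {G T : EE M → VV M} (hG : ContDiff ℝ 1 G) (hT : ContDiff ℝ 1 T) {e : ℕ} (he : e ≠ 0)
    (hv : ∀ x, (x = v0 M ∨ x = -v0 M) → ∀ l : ℝ, 0 ≤ l → G x + l • T x ≠ 0) {δ : ℝ} (hδ : 0 < δ) :
    ∃ ξ : Fin (M+1) → VV M, ‖ξ‖ < δ ∧ ∀ x : EE M, ‖x‖ = 1 → ∀ l : ℝ, 0 ≤ l →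
      G x + l • T x + ∑ k, (x k.succ) ^ e • ξ k ≠ 0 := by
  let U : Fin (M+2) × Bool × Fin (M+1) → Set (Fin (M+1) → VV M) := fun q =>
    Psi G T e q.1 (if q.2.1 then 1 else -1) q.2.2 '' {p | (Function.update p.1 q.1 (if q.2.1 then 1 else -1)) q.2.2.succ ≠ 0}
  have hdim : dimH (⋃ q, U q) < Module.finrank ℝ (Fin (M+1) → VV M) := by
    rw [dimH_iUnion]
    refine lt_of_le_of_lt (b := (((M+2) + M * (M+3) : ℕ) : ENNReal)) (iSup_le (fun q => ?_)) ?_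
    · refine (dimH_image_le_of_locally_lipschitzOn (fun p hp => ?_)).trans ?_
      · obtain ⟨K, t, ht, hK⟩ := (Psi_smooth hG hT e q.1 _ q.2.2 hp).exists_lipschitzOnWith
        exact ⟨K, t, mem_nhdsWithin_of_mem_nhds ht, hK⟩
      · refine (dimH_mono (subset_univ _)).trans ?_
        rw [Real.dimH_univ_eq_finrank]
        simp [Module.finrank_prod, Module.finrank_pi_fintype]
    · rw [Nat.cast_lt]
      simp [Module.finrank_pi_fintype]
      nlinarith
  obtain ⟨ξ, hξ, hξδ⟩ := (dense_compl_of_dimH_lt_finrank hdim).exists_dist_lt 0 hδ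
  refine ⟨ξ, by rwa [dist_zero_left] at hξδ, fun x hx l hl hzero => ?_⟩
  by_cases hk : ∃ k : Fin (M+1), x k.succ ≠ 0
  · obtain ⟨k, hk⟩ := hk
    apply hξ
    have hj : ∃ j, ‖x j‖ = 1 := by
      by_contra hcon
      push Not at hcon
      have : ‖x‖ < 1 := (pi_norm_lt_iff one_pos).2 (fun j => lt_of_le_of_ne (hx ▸ norm_le_pi_norm x j) (hcon j))
      linarith
    obtain ⟨j, hj⟩ := hj
    have hs : ∃ b : Bool, x j = if b then 1 else -1 := by
      rcases eq_or_eq_neg_of_abs_eq (show |x j| = 1 from hj) with h | h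
      · exact ⟨true, h⟩
      · exact ⟨false, h⟩
    obtain ⟨b, hb⟩ := hs
    refine mem_iUnion.2 ⟨(j, b, k), ⟨(Function.update x j l, fun i => ξ (k.succAbove i)), ?_, ?_⟩⟩
    · simp only [mem_ofPred_eq, Function.update_idem]
      rw [← hb, Function.update_eq_self]; exact hk
    · simp only [Psi, Function.update_idem, Function.update_self]
      rw [← hb, Function.update_eq_self]
      rw [Fin.sum_univ_succAbove _ k] at hzero
      have hz : G x + l • T x + ∑ i, x (k.succAbove i).succ ^ e • ξ (k.succAbove i) = - (x k.succ ^ e • ξ k) := by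
        rw [eq_neg_iff_add_eq_zero, ← hzero]; abel
      rw [hz, smul_neg, neg_smul, neg_neg, smul_smul, inv_mul_cancel₀ (pow_ne_zero _ hk), one_smul]
      exact Fin.insertNth_self_removeNth k ξ
  · push Not at hk
    have hxv : x = x 0 • v0 M := by
      funext i
      refine Fin.cases ?_ (fun i => ?_) i
      · simp [v0]
      · rw [hk i]; simp [v0]
    have hx0 : |x 0| = 1 := by
      rw [hxv, norm_smul, norm_v0, mul_one] at hx; exact hx
    have hx' : x = v0 M ∨ x = -v0 M := by
      rcases eq_or_eq_neg_of_abs_eq hx0 with h | h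
      · left; rw [hxv, h, one_smul]
      · right; rw [hxv, h, neg_smul, one_smul]
    apply hv x hx' l hl
    rw [← hzero, Finset.sum_eq_zero, add_zero]
    intro k _
    rw [hk k, zero_pow he, zero_smul]
end GenPos

end RPX

namespace RPX
open Metric
open Set
set_option linter.unusedSectionVars false
set_option linter.unusedSimpArgs false
set_option linter.unusedVariables false
set_option linter.style.longLine false

section Collar
variable {M : ℕ}

noncomputable def ep (o : Bool) : ℝ := if o then -1 else 1
lemma ep_sq (o : Bool) : ep o * ep o = 1 := by cases o <;> simp [ep]
lemma ep_ne (o : Bool) : ep o ≠ 0 := by cases o <;> simp [ep]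
lemma toS_ep (o : Bool) {w : VV M} (h : w ≠ 0) : toS (ep o • w) = sg o (toS w) := by
  cases o
  · simp [ep, sg_false]
  · simp only [ep, if_true, neg_smul, one_smul]; exact toS_neg h
lemma sg_coe (o : Bool) (y : SS M) : ((sg o y : SS M) : VV M) = ep o • (y : VV M) := by
  cases o
  · simp [ep, sg_false]
  · simp [ep, sg_true, ng_coe]

noncomputable def rho (x : EE M) : EE M := (max (1/2) ‖x‖)⁻¹ • x
lemma continuous_rho : Continuous (rho : EE M → EE M) := by
  unfold rho
  exact ((continuous_const.max continuous_norm).inv₀ (fun x => ne_of_gt (lt_of_lt_of_le (by norm_num) (le_max_left _ _)))).smul continuous_id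
lemma rho_out {x : EE M} (h : 1/2 ≤ ‖x‖) : rho x = ‖x‖⁻¹ • x := by rw [rho, max_eq_right h]
lemma norm_rho {x : EE M} (h : 1/2 ≤ ‖x‖) : ‖rho x‖ = 1 := by
  rw [rho_out h, norm_smul, norm_inv, norm_norm, inv_mul_cancel₀ (by linarith)]
lemma rho_one {x : EE M} (h : ‖x‖ = 1) : rho x = x := by rw [rho_out (by rw [h]; norm_num), h]; simp
lemma rho_clm {x : EE M} (h : 1 ≤ ‖x‖) : rho x = clm x := by
  rw [rho_out (by linarith), clm, max_eq_right h]

lemma collar {o : Bool} {f : EE M → SS M} (hf : f ∈ Asy o) (hc : Continuous f) {A B : EE M → VV M} (hA : Continuous A) (hB : Continuous B)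
    (hAf : ∀ x, ‖x‖ = 1 → toS (A x) = f x) (hne : ∀ x, ‖x‖ = 1 → ∀ t ∈ Icc (0:ℝ) 1, (1 - t) • A x + t • B x ≠ 0)
    (hAs : ∀ x, ‖x‖ = 1 → A (-x) = ep o • A x) (hBs : ∀ x, ‖x‖ = 1 → B (-x) = ep o • B x)
    (hA0 : A (v0 M) = (y0 M : VV M)) (hB0 : B (v0 M) = (y0 M : VV M)) :
    ∃ f', HomIn (Asy o) f f' ∧ ∀ x, ‖x‖ = 1 → f' x = toS (B x) := by
  let W : ℝ → EE M → VV M := fun t x => (1 - t) • A x + t • B x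
  have hW : Continuous (fun q : ℝ × EE M => W q.1 q.2) := by
    exact ((continuous_const.sub continuous_fst).smul (hA.comp continuous_snd)).add (continuous_fst.smul (hB.comp continuous_snd))
  let H : ℝ → EE M → SS M := fun s x => if (1 + c01 s) * ‖x‖ ≤ 1 then f ((1 + c01 s) • x) else
    toS (W (min ((1 + c01 s) * ‖x‖ - 1) (c01 s)) (rho x))
  have h01 : ∀ s, c01 s ∈ Icc (0:ℝ) 1 := fun s => c01_mem s
  have hhalf : ∀ s (x : EE M), 1 ≤ (1 + c01 s) * ‖x‖ → 1/2 ≤ ‖x‖ := by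
    intro s x h
    have := (h01 s).2
    nlinarith [norm_nonneg x]
  have hmin : ∀ s (x : EE M), 1 ≤ (1 + c01 s) * ‖x‖ → min ((1 + c01 s) * ‖x‖ - 1) (c01 s) ∈ Icc (0:ℝ) 1 := by
    intro s x h
    exact ⟨le_min (by linarith) (h01 s).1, (min_le_right _ _).trans (h01 s).2⟩
  have hcs : Continuous (fun q : ℝ × EE M => c01 q.1) := continuous_c01.comp continuous_fst
  have hcn : Continuous (fun q : ℝ × EE M => (1 + c01 q.1) * ‖q.2‖) := (continuous_const.add hcs).mul continuous_snd.norm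
  have hHc : Continuous (fun q : ℝ × EE M => H q.1 q.2) := by
    refine continuous_if_le hcn continuous_const ?_ ?_ ?_
    · exact (hc.comp ((continuous_const.add hcs).smul continuous_snd)).continuousOn
    · rw [continuousOn_iff_continuous_domRestrict]
      have h1 : Continuous (fun q : ℝ × EE M => W (min ((1 + c01 q.1) * ‖q.2‖ - 1) (c01 q.1)) (rho q.2)) :=
        hW.comp (((hcn.sub continuous_const).min hcs).prodMk (continuous_rho.comp continuous_snd))
      refine continuous_toS (F := fun q : {q : ℝ × EE M | 1 ≤ (1 + c01 q.1) * ‖q.2‖} => W (min ((1 + c01 q.1.1) * ‖q.1.2‖ - 1) (c01 q.1.1)) (rho q.1.2))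
        (h1.comp continuous_subtype_val) (fun q => ?_)
      exact hne _ (norm_rho (hhalf _ _ q.2)) _ (hmin _ _ q.2)
    · rintro ⟨s, x⟩ h
      simp only at h ⊢
      have hx := hhalf s x h.ge
      rw [h, sub_self, min_eq_left (h01 s).1]
      simp only [W, sub_zero, one_smul, zero_smul, add_zero]
      rw [hAf _ (norm_rho hx), rho_out hx]
      congr 2
      exact eq_inv_of_mul_eq_one_left h
  have hH1 : ∀ s x, ‖x‖ = 1 → H s x = toS (W (c01 s) x) := by
    intro s x hx
    simp only [H, hx, mul_one]
    split_ifs with h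
    · have : c01 s = 0 := le_antisymm (by linarith) (h01 s).1
      rw [this]; simp only [add_zero, one_smul, W, sub_zero, zero_smul]
      rw [hAf x hx]
    · rw [rho_one hx, show 1 + c01 s - 1 = c01 s by ring, min_self]
  refine ⟨H 1, (clm_homIn hf hc).trans ?_, fun x hx => ?_⟩
  · have e0 : f ∘ clm = H 0 := by
      funext x
      simp only [H, Function.comp]
      rw [show c01 0 = 0 by simp [c01]]
      simp only [add_zero, one_mul, one_smul]
      split_ifs with h
      · rw [clm_in h]
      · push Not at h
        rw [min_eq_right (by linarith)]
        simp only [W, sub_zero, one_smul, zero_smul, add_zero]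
        rw [hAf _ (norm_rho (by linarith)), rho_clm h.le]
    rw [e0]
    refine HomIn.mk_family H hHc (fun t _ => ⟨?_, fun x hx => ?_⟩)
    · rw [hH1 _ _ norm_v0]
      simp only [W, hA0, hB0]
      rw [← add_smul, sub_add_cancel, one_smul, toS_self]
    · rw [hH1 _ _ hx, hH1 _ _ (by rwa [norm_neg]), ← toS_ep o (hne x hx _ (h01 t))]
      simp only [W, hAs x hx, hBs x hx]
      congr 1
      module
  · rw [hH1 _ _ hx, show c01 1 = 1 by simp [c01]]
    simp [W]

noncomputable def Tt (o : Bool) (x : EE M) : VV M := if o then sn x 0 else (y0 M : VV M)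
lemma Tt_ne (o : Bool) {x : EE M} (hx : ‖x‖ = 1) : Tt o x ≠ 0 := by
  cases o
  · exact SS_ne _
  · intro h
    have := (sn_zero_iff.1 h).1
    rw [this] at hx; simp at hx
lemma Tt_v0 (o : Bool) : Tt o (v0 M) = (y0 M : VV M) := by
  cases o
  · rfl
  · exact sn_v0
lemma Tt_neg (o : Bool) (x : EE M) : Tt o (-x) = ep o • Tt o x := by
  cases o
  · simp [Tt, ep]
  · simp [Tt, ep, sn_neg]
lemma Tt_smooth (o : Bool) : ContDiff ℝ 1 (Tt o : EE M → VV M) := by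
  cases o
  · exact contDiff_const
  · refine contDiff_euclidean.2 (fun i => ?_)
    refine Fin.lastCases ?_ (fun i => ?_) i
    · simp [Tt, sn]; exact contDiff_const
    · simp [Tt, sn]; exact contDiff_apply ℝ ℝ i

lemma straighten {o : Bool} {f : EE M → SS M} (hf : f ∈ Asy o) (hc : Continuous f) :
    ∃ f', HomIn (Asy o) f f' ∧ ∀ x, 1 ≤ ‖x‖ → f' x = if o then th 1 x else y0 M := by
  have hfc : Continuous (fun x => (f x : VV M)) := continuous_subtype_val.comp hc
  obtain ⟨G0, hG0, hG0f, -⟩ := hfc.exists_contDiff_approx 1 (continuous_const (y := (1/8:ℝ))) (fun _ => by norm_num)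
  have hfs : ∀ x, ‖x‖ = 1 → (f (-x) : VV M) = ep o • (f x : VV M) := fun x hx => by rw [hf.2 x hx, sg_coe]
  have hnep : |ep o| = 1 := by cases o <;> simp [ep]
  let e : ℕ := if o then 1 else 2
  have he : e ≠ 0 := by cases o <;> simp [e]
  have hpow : ∀ a : ℝ, (-a) ^ e = ep o * a ^ e := by intro a; cases o <;> simp [e, ep]
  let Gs : EE M → VV M := fun x => (1/2:ℝ) • (G0 x + ep o • G0 (-x))
  have hGs : ContDiff ℝ 1 Gs := by
    have h0 : ContDiff ℝ 1 G0 := hG0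
    exact (h0.add ((h0.comp contDiff_neg).const_smul (ep o))).const_smul (1/2:ℝ)
  have hGsn : ∀ x, Gs (-x) = ep o • Gs x := by
    intro x
    simp only [Gs, neg_neg]
    rw [smul_comm (ep o), smul_add (ep o), smul_smul, ep_sq, one_smul]; congr 1; exact add_comm (G0 (-x)) _
  have hGsf : ∀ x, ‖x‖ = 1 → ‖Gs x - f x‖ < 1/8 := by
    intro x hx
    have e1 : Gs x - f x = (1/2:ℝ) • ((G0 x - f x) + ep o • (G0 (-x) - f (-x))) := by
      rw [hfs x hx]
      simp only [Gs, smul_sub (ep o), smul_smul, ep_sq]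
      module
    have h1 := hG0f x
    have h2 := hG0f (-x)
    rw [dist_eq_norm] at h1 h2
    rw [e1, norm_smul]
    have h3 := norm_add_le (G0 x - f x) (ep o • (G0 (-x) - f (-x)))
    rw [norm_smul (ep o), Real.norm_eq_abs, hnep, one_mul] at h3
    rw [Real.norm_eq_abs, abs_of_pos (by norm_num)]
    linarith
  have hab : ∀ (x : EE M) i, ‖x‖ = 1 → |x i ^ e| ≤ 1 := by
    intro x i hx
    rw [abs_pow]
    exact pow_le_one₀ (abs_nonneg _) (hx ▸ norm_le_pi_norm x i)
  let G1 : EE M → VV M := fun x => Gs x + (x 0) ^ e • ((y0 M : VV M) - Gs (v0 M))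
  have hG1 : ContDiff ℝ 1 G1 := hGs.add (((contDiff_apply ℝ ℝ 0).pow e).smul contDiff_const)
  have hG1n : ∀ x, G1 (-x) = ep o • G1 x := by
    intro x
    simp only [G1, hGsn, Pi.neg_apply, hpow]
    rw [smul_add (ep o) (Gs x), mul_smul]
  have hG1v : G1 (v0 M) = (y0 M : VV M) := by simp [G1, v0]
  have hG1f : ∀ x, ‖x‖ = 1 → ‖G1 x - f x‖ < 1/4 := by
    intro x hx
    have h1 := hGsf x hx
    have h2 := hGsf _ norm_v0
    rw [hf.1, norm_sub_rev] at h2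
    have h3 := norm_add_le (Gs x - f x) ((x 0) ^ e • ((y0 M : VV M) - Gs (v0 M)))
    rw [norm_smul, Real.norm_eq_abs] at h3
    have h4 := mul_le_mul_of_nonneg_right (hab x 0 hx) (norm_nonneg ((y0 M : VV M) - Gs (v0 M)))
    have e1 : G1 x - f x = (Gs x - f x) + (x 0) ^ e • ((y0 M : VV M) - Gs (v0 M)) := by simp only [G1]; abel
    rw [e1]; linarith
  have hδ : (0:ℝ) < 1 / (4 * (M + 1)) := by positivity
  obtain ⟨ξ, hξ, hgen⟩ := gen_pos hG1 (Tt_smooth o) he (by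
    have hp : ∀ l : ℝ, 0 ≤ l → G1 (v0 M) + l • Tt o (v0 M) ≠ 0 := by
      intro l hl
      rw [hG1v, Tt_v0]
      have : (y0 M : VV M) + l • (y0 M : VV M) = (1 + l) • (y0 M : VV M) := by module
      rw [this]
      exact smul_ne_zero (by linarith) (SS_ne _)
    rintro x (h | h) l hl
    · rw [h]; exact hp l hl
    · rw [h, hG1n, Tt_neg, smul_comm, ← smul_add]
      exact smul_ne_zero (ep_ne o) (hp l hl)) hδ
  let B : EE M → VV M := fun x => G1 x + ∑ k : Fin (M+1), (x k.succ) ^ e • ξ k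
  have hB : Continuous B := by
    have h1 : ∀ i : Fin (M+2), Continuous (fun x : EE M => x i) := fun i => continuous_apply i
    exact hG1.continuous.add (continuous_finsetSum _ (fun k _ => ((h1 _).pow e).smul continuous_const))
  have hBn : ∀ x, B (-x) = ep o • B x := by
    intro x
    simp only [B, Pi.neg_apply, hpow]
    rw [hG1n, smul_add (ep o) (G1 x), Finset.smul_sum]
    congr 1
    exact Finset.sum_congr rfl (fun k _ => mul_smul _ _ _)
  have hBv : B (v0 M) = (y0 M : VV M) := by
    simp only [B]; rw [hG1v]; simp [v0, he]
  have hBf : ∀ x, ‖x‖ = 1 → ‖B x - f x‖ < 1 := by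
    intro x hx
    have h1 := hG1f x hx
    have h2 : ‖∑ k : Fin (M+1), (x k.succ) ^ e • ξ k‖ ≤ ∑ k : Fin (M+1), 1 / (4 * ((M:ℝ) + 1)) := by
      refine norm_sum_le_of_le _ (fun k _ => ?_)
      rw [norm_smul, Real.norm_eq_abs]
      calc _ ≤ 1 * ‖ξ k‖ := mul_le_mul_of_nonneg_right (hab x _ hx) (norm_nonneg _)
        _ = ‖ξ k‖ := one_mul _
        _ ≤ ‖ξ‖ := norm_le_pi_norm ξ k
        _ ≤ _ := hξ.le
    have h3 : ∑ k : Fin (M+1), 1 / (4 * ((M:ℝ) + 1)) = 1/4 := by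
      simp; field_simp
    have e1 : B x - f x = (G1 x - f x) + ∑ k : Fin (M+1), (x k.succ) ^ e • ξ k := by simp only [B]; abel
    have h4 := norm_add_le (G1 x - f x) (∑ k : Fin (M+1), (x k.succ) ^ e • ξ k)
    rw [e1]; linarith
  have hline : ∀ x, ‖x‖ = 1 → ∀ t ∈ Icc (0:ℝ) 1, (1 - t) • (f x : VV M) + t • B x ≠ 0 := by
    intro x hx t ht h
    have e1 : (f x : VV M) = - (t • (B x - f x)) := by
      refine sub_eq_zero.1 (Eq.trans ?_ h); module
    have h1 := norm_SS (f x)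
    rw [e1, norm_neg, norm_smul, Real.norm_eq_abs, abs_of_nonneg ht.1] at h1
    have h2 := hBf x hx
    have := ht.2
    nlinarith [norm_nonneg (B x - f x), ht.1]
  have hlineT : ∀ x, ‖x‖ = 1 → ∀ t ∈ Icc (0:ℝ) 1, (1 - t) • B x + t • Tt o x ≠ 0 := by
    intro x hx t ht h
    rcases eq_or_lt_of_le ht.2 with h1 | h1
    · rw [h1] at h; simp at h; exact Tt_ne o hx h
    · refine hgen x hx (t / (1 - t)) (div_nonneg ht.1 (by linarith)) ?_
      have h2 : (1 - t) ≠ 0 := by linarith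
      have e1 : G1 x + (t / (1 - t)) • Tt o x + ∑ k : Fin (M+1), (x k.succ) ^ e • ξ k = (1 - t)⁻¹ • ((1 - t) • B x + t • Tt o x) := by
        rw [smul_add, smul_smul, smul_smul, inv_mul_cancel₀ h2, one_smul, inv_mul_eq_div]
        simp only [B]; abel
      rw [e1, h, smul_zero]
  obtain ⟨f1, hf1, hf1B⟩ := collar hf hc (A := fun x => (f x : VV M)) (B := B) hfc hB (fun x _ => toS_self _) hline hfs (fun x _ => hBn x)
    (by rw [hf.1]) hBv
  obtain ⟨f2, hf2, hf2T⟩ := collar hf1.right_mem hf1.right_cont (A := B) (B := Tt o) hB (Tt_smooth o).continuous (fun x hx => (hf1B x hx).symm)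
    hlineT (fun x _ => hBn x) (fun x _ => Tt_neg o x) hBv (Tt_v0 o)
  refine ⟨f2 ∘ clm, (hf1.trans hf2).trans (clm_homIn hf2.right_mem hf2.right_cont), fun x hx => ?_⟩
  simp only [Function.comp]
  rw [hf2T _ (norm_clm_out hx)]
  cases o
  · simp [Tt]
  · simp only [Tt, if_true]
    rw [← th_clm 1 x, th_out (norm_clm_out hx).ge]
end Collar

end RPX

namespace RPX
open Metric
open Set
set_option linter.unusedSectionVars false
set_option linter.unusedSimpArgs false
set_option linter.unusedVariables false
set_option linter.style.longLine false

section Odd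
variable {M : ℕ}

noncomputable def Lr (t : ℝ) (w : VV M) : VV M := WithLp.toLp 2 (fun i =>
  if i = 0 then -(Real.cos (Real.pi * t) * w 0 - Real.sin (Real.pi * t) * w 1) else
  if i = 1 then -(Real.sin (Real.pi * t) * w 0 + Real.cos (Real.pi * t) * w 1) else -w i)
lemma Lr_apply (t : ℝ) (w : VV M) (i : Fin (M+3)) : Lr t w i =
  if i = 0 then -(Real.cos (Real.pi * t) * w 0 - Real.sin (Real.pi * t) * w 1) else
  if i = 1 then -(Real.sin (Real.pi * t) * w 0 + Real.cos (Real.pi * t) * w 1) else -w i := rfl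
lemma Lr_smul (t c : ℝ) (w : VV M) : Lr t (c • w) = c • Lr t w := by
  ext i
  rw [PiLp.smul_apply, Lr_apply, Lr_apply]
  simp only [PiLp.smul_apply, smul_eq_mul]
  split_ifs <;> ring
lemma Lr_ne (t : ℝ) {w : VV M} (h : w ≠ 0) : Lr t w ≠ 0 := by
  intro h0
  apply h
  have hi : ∀ i, Lr t w i = 0 := fun i => by rw [h0]; rfl
  have h10 : (1 : Fin (M+3)) ≠ 0 := by simp
  have e0 := hi 0
  have e1 := hi 1
  rw [Lr_apply, if_pos rfl] at e0
  rw [Lr_apply, if_neg h10, if_pos rfl] at e1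
  have hcs := Real.sin_sq_add_cos_sq (Real.pi * t)
  set c := Real.cos (Real.pi * t)
  set s := Real.sin (Real.pi * t)
  have w0 : w 0 = 0 := by linear_combination (-c) * e0 - s * e1 - w 0 * hcs
  have w1 : w 1 = 0 := by linear_combination (s) * e0 - c * e1 - w 1 * hcs
  ext i
  by_cases hi0 : i = 0
  · rw [hi0, w0]; rfl
  by_cases hi1 : i = 1
  · rw [hi1, w1]; rfl
  have := hi i
  rw [Lr_apply, if_neg hi0, if_neg hi1] at this
  simpa using this
lemma continuous_Lr : Continuous (fun q : ℝ × VV M => Lr q.1 q.2) := by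
  unfold Lr
  refine (PiLp.continuous_toLp 2 _).comp (continuous_pi (fun i => ?_))
  split_ifs <;> fun_prop
attribute [irreducible] Lr
noncomputable def Rt (t : ℝ) (y : SS M) : SS M := toS (Lr t (y : VV M))
lemma continuous_Rt : Continuous (fun q : ℝ × SS M => Rt q.1 q.2) := by
  have h1 : Continuous (fun q : ℝ × SS M => (q.1, (q.2 : VV M))) := continuous_fst.prodMk (continuous_subtype_val.comp continuous_snd)
  have h2 : Continuous (fun q : ℝ × SS M => Lr q.1 (q.2 : VV M)) := Continuous.comp (g := fun q : ℝ × VV M => Lr q.1 q.2) continuous_Lr h1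
  exact continuous_toS h2 (fun q => Lr_ne _ (SS_ne _))
lemma Rt_zero (y : SS M) : Rt 0 y = ng y := by
  have : Lr 0 (y : VV M) = -(y : VV M) := by
    ext i
    rw [Lr_apply]
    split_ifs with h h
    · subst h; simp
    · subst h; simp
    · simp
  rw [Rt, this, toS_neg (SS_ne y), toS_self]
lemma Rt_toS (t : ℝ) {w : VV M} (h : w ≠ 0) : Rt t (toS w) = toS (Lr t w) := by
  rw [Rt, toS_coe h, Lr_smul, toS_smul (inv_pos.2 (norm_pos_iff.2 h))]

attribute [irreducible] Rt
noncomputable def ut (t : ℝ) : EE M := fun i => if i = 0 then -Real.cos (Real.pi * t) else if i = 1 then -Real.sin (Real.pi * t) else 0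
lemma ut_ne (t : ℝ) : (ut t : EE M) ≠ 0 := by
  intro h
  have e0 : (ut t : EE M) 0 = 0 := by rw [h]; rfl
  have e1 : (ut t : EE M) 1 = 0 := by rw [h]; rfl
  simp [ut] at e0 e1
  have := Real.sin_sq_add_cos_sq (Real.pi * t)
  rw [e0, e1] at this; norm_num at this
lemma sn_ut (t : ℝ) : sn (ut t : EE M) 0 = Lr t (y0 M : VV M) := by
  rw [y0_coe]
  ext i
  rw [Lr_apply]
  refine Fin.lastCases ?_ (fun i => ?_) i
  · have h0 : Fin.last (M+2) ≠ 0 := by simp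
    have h1 : Fin.last (M+2) ≠ 1 := by
      intro h; have := congrArg Fin.val h; simp at this
    simp [sn, h0, h1]
  · have h0 : i.castSucc = 0 ↔ i = 0 := Fin.castSucc_eq_zero_iff
    have h1 : i.castSucc = 1 ↔ i = 1 := by rw [Fin.ext_iff, Fin.ext_iff]; simp
    simp only [sn, Fin.snoc_castSucc, ut, h0, h1]
    split_ifs with h h <;> simp [h]
    intro h'; exact absurd h' (by assumption)
lemma continuous_ut : Continuous (ut : ℝ → EE M) := by
  unfold ut
  refine continuous_pi (fun i => ?_)
  split_ifs <;> fun_prop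
noncomputable def wt (t : ℝ) : EE M := ‖(ut t : EE M)‖⁻¹ • ut t
lemma norm_wt (t : ℝ) : ‖(wt t : EE M)‖ = 1 := by
  rw [wt, norm_smul, norm_inv, norm_norm, inv_mul_cancel₀ (norm_ne_zero_iff.2 (ut_ne t))]
lemma continuous_wt : Continuous (wt : ℝ → EE M) :=
  (continuous_ut.norm.inv₀ (fun t => norm_ne_zero_iff.2 (ut_ne t))).smul continuous_ut
lemma th_wt (t : ℝ) {s : ℝ} : th s (wt t : EE M) = Rt t (y0 M) := by
  rw [th_out (norm_wt t).ge, Rt, ← sn_ut, wt, ← toS_smul (M := M) (w := sn (ut t) 0) (inv_pos.2 (norm_pos_iff.2 (ut_ne (M := M) t))), sn_smul, mul_zero]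
lemma wt_zero : (wt 0 : EE M) = - v0 M := by
  have : (ut 0 : EE M) = - v0 M := by
    funext i
    simp only [ut, v0, mul_zero, Real.cos_zero, Real.sin_zero, neg_zero, Pi.neg_apply, Pi.single_apply]
    split_ifs <;> simp
  rw [wt, this, norm_neg, norm_v0]; simp
lemma wt_one : (wt 1 : EE M) = v0 M := by
  have : (ut 1 : EE M) = v0 M := by
    funext i
    simp only [ut, v0, mul_one, Real.cos_pi, Real.sin_pi, neg_zero, Pi.single_apply]
    split_ifs <;> simp
  rw [wt, this, norm_v0]; simp
attribute [irreducible] ut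
attribute [irreducible] wt
lemma continuous_qm_wt : Continuous (fun q : ℝ × EE M => qm (wt q.1 : EE M) q.2) := by
  have h0 : Continuous (fun q : ℝ × EE M => (wt q.1 : EE M)) := continuous_wt.comp continuous_fst
  have h1 : Continuous (fun q : ℝ × EE M => kap q.2) := continuous_kap.comp continuous_snd
  have h2 : Continuous (fun q : ℝ × EE M => uh q.2) := continuous_uh.comp continuous_snd
  unfold qm
  exact ((continuous_const.sub h1).smul h2).add (h1.smul h0)
lemma qm_neg (p x : EE M) : - qm p (-x) = qm (-p) x := by
  simp only [qm, kap, uh, norm_neg]; module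

lemma Rt_one_y0 : Rt 1 (y0 M) = y0 M := by rw [← th_wt 1 (s := 1), wt_one, th_v0]
lemma cont_Rt_one : Continuous (Rt 1 : SS M → SS M) :=
  Continuous.comp (g := fun q : ℝ × SS M => Rt q.1 q.2) (f := fun y : SS M => ((1:ℝ), y)) continuous_Rt (continuous_const.prodMk continuous_id)

open Matrix in
noncomputable def Jm : MM M := Matrix.diagonal (fun i => if i = 0 then (1:ℝ) else -1)
open Matrix in
lemma Jm_apply (x : EE M) (i) : (Jm *ᵥ x) i = (if i = 0 then (1:ℝ) else -1) * x i := by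
  rw [Jm, Matrix.mulVec_diagonal]
open Matrix in
lemma norm_Jm (x : EE M) : ‖Jm *ᵥ x‖ = ‖x‖ := by
  simp only [Pi.norm_def]
  congr 2
  funext i
  rw [Jm_apply]
  split_ifs <;> simp
lemma det_Jm (hM : Even M) : (Jm : MM M).det = -1 := by
  rw [Jm, Matrix.det_diagonal, Fin.prod_univ_succ]
  simp [hM.add_one.neg_one_pow]
lemma dg_Rt (hM : Even M) : dg (Rt 1 : SS M → SS M) = -1 := by
  refine dg_eq cont_Rt_one Rt_one_y0 ?_
  have hE : Ex (Jm : MM M) 1 := ⟨one_pos, fun x => by rw [norm_Jm, one_mul]⟩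
  have h := cls_lin (A := (Jm : MM M)) (by rw [det_Jm hM]; norm_num) hE c0_ball
  have e : (fun x : EE M => (c0 ((1:ℝ) • (Matrix.mulVec Jm x)) : SS M)) = Rt 1 ∘ c0 := by
    funext x
    simp only [Function.comp, one_smul, c0]
    rw [Rt_toS 1 (c0v_ne x)]
    congr 1
    rw [c0v, mk_eq_iff]
    simp only [Lr_apply, mul_one, Real.cos_pi, Real.sin_pi, norm_Jm]
    refine ⟨by simp [c0v], fun i => ?_⟩
    rw [if_neg (Fin.succ_ne_zero i)]
    simp only [Pi.smul_apply, Jm_apply, smul_eq_mul]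
    have h1 : i.succ = 1 ↔ i = 0 := by rw [← Fin.succ_zero_eq_one, Fin.succ_inj]
    simp only [h1]
    split_ifs with h
    · subst h; rw [c0v, show (1 : Fin (M+3)) = Fin.succ 0 from rfl, mk_succ]; simp
    · simp [c0v]
  have h2 : cls (Rt 1 ∘ c0) (c0_ball.postc cont_Rt_one Rt_one_y0) = cls (fun x : EE M => (c0 ((1:ℝ) • (Matrix.mulVec Jm x)) : SS M)) (hE.ball c0_ball) := by
    rw [cls_eq, e]; exact HR.refl (c0_ball.postc cont_Rt_one Rt_one_y0).1
  rw [h2, h, det_Jm hM]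
  simp [bb]

lemma neg_half (hM : Even M) {β : EE M → SS M} (hβ : IsBall (y0 M) β) {k : ℤ} (hk : cls β hβ = bb M ^ k) :
    ∃ (γ : EE M → SS M) (hγ : IsBall (y0 M) γ), cls γ hγ = bb M ^ (-k) ∧ HR (fun x => ng (st (th 1) β (-x))) (st (th (-1)) γ) := by
  have hβn : IsBall (y0 M) (fun x => β (-x)) := ⟨hβ.1.comp continuous_neg, fun x hx => hβ.2 _ (by rwa [norm_neg])⟩
  have hkn : cls _ hβn = bb M ^ k := by rw [← hk, cls_eq]; exact ball_neg hM hβ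
  refine ⟨Rt 1 ∘ (fun x => β (-x)), hβn.postc cont_Rt_one Rt_one_y0, ?_, ?_⟩
  · rw [dg_cls cont_Rt_one Rt_one_y0 hkn, dg_Rt hM]; simp
  have hm1 : (-1:ℝ) ≠ 0 := by norm_num
  let H : ℝ → EE M → SS M := fun t x => if ‖x‖ ≤ 1/2 then Rt t (β (-(2:ℝ) • x)) else th (-1) (qm (wt t) x)
  have hHc : Continuous (fun q : ℝ × EE M => H q.1 q.2) := by
    refine Continuous.if_le ?_ ?_ continuous_snd.norm continuous_const ?_
    · have h1 : Continuous (fun q : ℝ × EE M => -(2:ℝ) • q.2) := by fun_prop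
      have h2 : Continuous (fun q : ℝ × EE M => (q.1, β (-(2:ℝ) • q.2))) := continuous_fst.prodMk (hβ.1.comp h1)
      exact Continuous.comp (g := fun q : ℝ × SS M => Rt q.1 q.2) continuous_Rt h2
    · exact (continuous_th hm1).comp continuous_qm_wt
    · rintro ⟨t, x⟩ h
      simp only at h ⊢
      rw [qm_in h.le, th_wt, hβ.2]
      rw [norm_smul, h]; norm_num
  have hout : ∀ t x, 1 ≤ ‖x‖ → H t x = th (-1) x := by
    intro t x hx
    simp only [H]
    rw [if_neg (by linarith), qm_out hx]
  have e0 : (fun x => ng (st (th 1) β (-x))) = H 0 := by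
    funext x
    simp only [H, st]
    split_ifs with h
    · rw [star_in th_v0 (by rwa [norm_neg]), Rt_zero, smul_neg, neg_smul]
    · push Not at h
      rw [star_out hβ (by rw [norm_neg]; exact h.le), wt_zero, ← qm_neg, th_neg one_ne_zero, neg_neg]
  have e1 : st (th (-1)) (Rt 1 ∘ (fun x => β (-x))) = H 1 := by
    funext x
    simp only [H, st]
    split_ifs with h
    · rw [star_in th_v0 h]; simp
    · push Not at h
      rw [star_out (hβn.postc cont_Rt_one Rt_one_y0) h.le, wt_one]
  rw [e0, e1]
  exact HomIn.mk_family H hHc (fun t _ x hx => by rw [hout t x hx, hout 0 x hx])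

noncomputable def oddT (β : EE M → SS M) : SS M → SS M := tot true (st (th 1) β)

lemma st_th_mem {β : EE M → SS M} (hβ : IsBall (y0 M) β) : st (th 1) β ∈ Asy (M := M) true := st_asy th_asy hβ
lemma st_th_cont {β : EE M → SS M} (hβ : IsBall (y0 M) β) : Continuous (st (th 1) β) := continuous_star (continuous_th one_ne_zero) th_v0 hβ
lemma oddT_mem {β : EE M → SS M} (hβ : IsBall (y0 M) β) : oddT β ∈ Qsy (M := M) true := tot_mem (st_th_mem hβ)
lemma oddT_cont {β : EE M → SS M} (hβ : IsBall (y0 M) β) : Continuous (oddT β) := continuous_tot (st_th_mem hβ) (st_th_cont hβ)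

lemma st_th_clm {β : EE M → SS M} (hβ : IsBall (y0 M) β) (x : EE M) : st (th 1) β (clm x) = st (th 1) β x := by
  rcases le_total ‖x‖ 1 with h | h
  · rw [clm_in h]
  · simp only [st]; rw [star_bd hβ h, star_bd hβ (norm_clm_out h).ge, th_clm]

/-- every odd map is homotopic to a standard one -/
lemma odd_std {F : SS M → SS M} (hF : F ∈ Qsy (M := M) true) (hc : Continuous F) :
    ∃ (β : EE M → SS M) (hβ : IsBall (y0 M) β), HomIn (Qsy true) F (oddT β) := by
  obtain ⟨f', h1, h2⟩ := straighten (th_mem hF) (hc.comp (continuous_th one_ne_zero))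
  simp only [if_true] at h2
  have ht := torsor (y0 := y0 M) (continuous_th one_ne_zero) h1.right_cont th_v0 h2
  refine ⟨_, dif_isBall (continuous_th one_ne_zero) h1.right_cont h2 th_v0, ?_⟩
  have := tot_homIn (h1.trans (ht.asy h1.right_mem))
  rw [tot_of hF] at this
  exact this
lemma odd_hr {β β' : EE M → SS M} (hβ : IsBall (y0 M) β) (h : HR β β') : HomIn (Qsy true) (oddT β) (oddT β') :=
  tot_homIn ((star_HR norm_v0 (HR.refl (continuous_th one_ne_zero)) th_v0 h hβ).asy (st_th_mem hβ))

lemma odd_dg (hM : Even M) : ∃ d : ℤ, d * d = 1 ∧ ∀ (β : EE M → SS M) (hβ : IsBall (y0 M) β) (k : ℤ), cls β hβ = bb M ^ k →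
    dg (oddT β) = 1 + 2 * k * d := by
  obtain ⟨d, hd, hh⟩ := hemi (M := M)
  have hm1 : (-1:ℝ) ≠ 0 := by norm_num
  refine ⟨d, hd, fun β hβ k hk => ?_⟩
  obtain ⟨δ, hδ, hδk, hδh⟩ := hh id continuous_id rfl
  rw [dg_id, one_mul] at hδk
  simp only [Function.id_comp] at hδh
  obtain ⟨ε, hε, hεk, hεh⟩ := hh (oddT β) (oddT_cont hβ) (oddT_mem hβ).1
  obtain ⟨γ, hγ, hγk, hγh⟩ := neg_half hM hβ hk
  have e1 : oddT β ∘ th 1 = st (th 1) β := by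
    funext x; simp only [Function.comp, oddT, tot_th]; exact st_th_clm hβ x
  have e2 : oddT β ∘ th (-1) = fun x => ng (st (th 1) β (-x)) := by
    funext x; simp only [Function.comp, oddT]; rw [tot_thm (st_th_mem hβ), sg_true, ← clm_neg, st_th_clm hβ]
  rw [e1, e2] at hεh
  have hL : HR (st (th 1) β) (st (th (-1)) (st δ β)) :=
    (star_HR norm_v0 hδh th_v0 (HR.refl hβ.1) hβ).trans (star_assoc norm_v0 (continuous_th hm1) th_v0 hδ hβ)
  have hv : ng (st (th 1) β (-v0 M)) = y0 M := by
    have := hγh.eqOn (v0 M) norm_v0.ge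
    rw [st, star_bd hγ norm_v0.ge, th_v0] at this
    first | exact this | exact this.symm
  have hR : HR (st (th 1) β) (st (th (-1)) (st γ ε)) :=
    (hεh.trans (star_HR norm_v0 hγh hv (HR.refl hε.1) hε)).trans (star_assoc norm_v0 (continuous_th hm1) th_v0 hγ hε)
  have hfr := star_free norm_v0 (continuous_th hm1) th_v0 (st_ball hδ hβ) (st_ball hγ hε) (hL.symm.trans hR)
  have hcl : cls _ (st_ball hδ hβ) = cls _ (st_ball hγ hε) := cls_eq.2 hfr
  rw [← cls_mul hδ hβ, ← cls_mul hγ hε, hδk, hk, hγk, hεk, ← zpow_add, ← zpow_add] at hcl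
  have h3 := bb_zpow_inj hcl
  have h4 : dg (oddT β) * (d * d) = (d + 2 * k) * d := by linear_combination -d * h3
  rw [hd, mul_one] at h4
  rw [h4, add_mul, hd]
end Odd

end RPX

namespace RPX
open Metric
open Set
set_option linter.unusedSectionVars false
set_option linter.unusedSimpArgs false
set_option linter.unusedVariables false
set_option linter.style.longLine false

section Even
variable {M : ℕ}

lemma ball_clm {β : EE M → SS M} (hβ : IsBall (y0 M) β) (x : EE M) : β (clm x) = β x := by
  rcases le_total ‖x‖ 1 with h | h
  · rw [clm_in h]
  · rw [hβ.2 _ h, hβ.2 _ (norm_clm_out h).ge]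

lemma even_std {F : SS M → SS M} (hF : F ∈ Qsy (M := M) false) (hc : Continuous F) :
    ∃ (β : EE M → SS M) (hβ : IsBall (y0 M) β), HomIn (Qsy false) F (tot false β) := by
  obtain ⟨f', h1, h2⟩ := straighten (th_mem hF) (hc.comp (continuous_th one_ne_zero))
  simp only [if_false, Bool.false_eq_true] at h2
  refine ⟨f', ⟨h1.right_cont, h2⟩, ?_⟩
  have := tot_homIn h1
  rwa [tot_of hF] at this

lemma even_dg (hM : Even M) {F : SS M → SS M} (hF : F ∈ Qsy (M := M) false) (hc : Continuous F) : dg F = 0 := by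
  obtain ⟨β, hβ, h⟩ := even_std hF hc
  rw [dg_homIn h]
  obtain ⟨d, hd, hh⟩ := hemi (M := M)
  obtain ⟨ε, hε, hk, hR⟩ := hh (tot false β) h.right_cont h.right_mem.1
  have e1 : tot false β ∘ th 1 = β := by
    funext x; simp only [Function.comp, tot_th]; exact ball_clm hβ x
  have e2 : tot false β ∘ th (-1) = fun x => β (-x) := by
    funext x; simp only [Function.comp]; rw [tot_thm (ball_asy hβ), sg_false, ← clm_neg, ball_clm hβ]
  rw [e1, e2] at hR
  have hβn : IsBall (y0 M) (fun x => β (-x)) := ⟨hβ.1.comp continuous_neg, fun x hx => hβ.2 _ (by rwa [norm_neg])⟩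
  have hR2 : HR β (st β ε) := hR.trans (star_HR norm_v0 (ball_neg hM hβ) (hβn.2 _ norm_v0.ge) (HR.refl hε.1) hε)
  have hcl : cls β hβ = cls (st β ε) (st_ball hβ hε) := cls_eq.2 hR2
  rw [← cls_mul hβ hε] at hcl
  have h1 : cls ε hε = 1 := (mul_eq_left (a := cls β hβ)).1 hcl.symm
  rw [hk, ← zpow_zero (bb M)] at h1
  have h2 := bb_zpow_inj h1
  have : dg (tot false β) * (d * d) = 0 := by rw [← mul_assoc, h2, zero_mul]
  rwa [hd, mul_one] at this

lemma even_parity (hM : Even M) {β β' : EE M → SS M} (hβ : IsBall (y0 M) β) (hβ' : IsBall (y0 M) β')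
    (h : HomIn (Asy false) β β') {k k' : ℤ} (hk : cls β hβ = bb M ^ k) (hk' : cls β' hβ' = bb M ^ k') : ∃ j, k' = 2 * j + k := by
  obtain ⟨H, h1, h2, h3, h4⟩ := h.exists_clamp
  have hH1 : Continuous (fun q : ℝ × EE M => H q.1 q.2) := h1
  let N : ℝ → EE M → EE M := fun t x => (max ((1 + c01 t) / 2) ‖x‖)⁻¹ • x
  have hpos : ∀ t (x : EE M), 0 < max ((1 + c01 t) / 2) ‖x‖ := fun t x => lt_of_lt_of_le (by linarith [c01_nonneg t]) (le_max_left _ _)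
  have hN : Continuous (fun q : ℝ × EE M => N q.1 q.2) := by
    have hc := continuous_c01
    refine Continuous.smul (Continuous.inv₀ ?_ (fun q => (hpos q.1 q.2).ne')) continuous_snd
    fun_prop
  let K : ℝ → EE M → SS M := fun t x => H (max (c01 t) (2 * ‖x‖ - 1)) (N t x)
  have hK : Continuous (fun q : ℝ × EE M => K q.1 q.2) := by
    have hc := continuous_c01
    have h5 : Continuous (fun q : ℝ × EE M => (max (c01 q.1) (2 * ‖q.2‖ - 1), N q.1 q.2)) := Continuous.prodMk (by fun_prop) hN
    exact Continuous.comp (g := fun q : ℝ × EE M => H q.1 q.2) hH1 h5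
  have hKout : ∀ t x, 1 ≤ ‖x‖ → K t x = y0 M := by
    intro t x hx
    simp only [K]
    rw [h4 _ (le_max_of_le_right (by linarith)), hβ'.2]
    simp only [N]
    rw [max_eq_right (by linarith [c01_le_one t]), norm_smul, norm_inv, norm_norm, inv_mul_cancel₀ (by linarith)]
  have hK1 : K 1 = β' := by
    funext x
    simp only [K, N, c01_one]
    rw [h4 _ (le_max_left _ _), ← ball_clm hβ' x, clm]
    norm_num
  let G : EE M → SS M := fun x => if ‖x‖ ≤ 1/2 then y0 M else H (2 * ‖x‖ - 1) (rho x)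
  have hG : Continuous G := by
    refine Continuous.if_le continuous_const ?_ continuous_norm continuous_const ?_
    · have h5 : Continuous (fun x : EE M => (2 * ‖x‖ - 1, rho x)) := Continuous.prodMk (by fun_prop) continuous_rho
      exact Continuous.comp (g := fun q : ℝ × EE M => H q.1 q.2) hH1 h5
    · intro x hx
      rw [h3 _ (by rw [hx]; norm_num), hβ.2 _ (norm_rho hx.ge).ge]
  have hGe : ∀ x, G (-x) = G x := by
    intro x
    simp only [G, norm_neg]
    split_ifs with h
    · rfl
    · push Not at h
      have : rho (-x) = - rho x := by simp [rho]
      rw [this, (h2 _).2 _ (norm_rho h.le), sg_false]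
  have hGb : IsBall (y0 M) G := by
    refine ⟨hG, fun x hx => ?_⟩
    simp only [G]
    rw [if_neg (by linarith), h4 _ (by linarith), hβ'.2 _ (norm_rho (by linarith)).ge]
  have hK0 : K 0 = ov (y0 M) G (fun x => β ((2:ℝ) • x)) := by
    funext x
    rcases le_total ‖x‖ (1/2) with h | h
    · rw [ov_of_left (by simp only [G]; rw [if_pos h])]
      simp only [K, N, c01_zero]
      rw [h3 _ (by rw [max_eq_left]; linarith), max_eq_left (by linarith)]
      norm_num
    · rw [ov_of_right (h := fun x => β ((2:ℝ) • x)) (hβ.two h)]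
      simp only [K, N, c01_zero, G, add_zero]
      rw [max_eq_right (show (0:ℝ) ≤ 2 * ‖x‖ - 1 by linarith)]
      split_ifs with h'
      · have h6 : ‖x‖ = 1/2 := le_antisymm h' h
        rw [h3 _ (by linarith), hβ.2]
        have := norm_rho h
        rw [rho] at this
        exact this.ge
      · rw [rho]
  have hpeel : HR (ov (y0 M) G (fun x => β ((2:ℝ) • x))) (star (y0 M) (v0 M) G (fun x => β ((2:ℝ) • ((0 : EE M) + (1/2:ℝ) • x)))) := by
    refine peel (γ := fun t => t • v0 M) hG (hβ.1.comp (by fun_prop)) (by norm_num) (by simp; norm_num) ?_ ?_ (by fun_prop) (by simp) (by simp) ?_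
    · intro x hx; rw [sub_zero] at hx; simp only [G]; rw [if_pos hx]
    · intro x hx; rw [sub_zero] at hx; exact hβ.two hx
    · intro t ht
      simp only [G]
      split_ifs with h
      · rfl
      · push Not at h
        rw [norm_smul, norm_v0, mul_one, Real.norm_of_nonneg ht.1] at h
        rw [rho_out (by rw [norm_smul, norm_v0, mul_one, Real.norm_of_nonneg ht.1]; exact h.le), norm_smul, norm_v0, mul_one,
          Real.norm_of_nonneg ht.1, smul_smul, inv_mul_cancel₀ (by linarith), one_smul]
        exact (h2 _).1
  have e1 : (fun x => β ((2:ℝ) • ((0 : EE M) + (1/2:ℝ) • x))) = β := by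
    funext x; rw [zero_add, smul_smul]; norm_num
  rw [e1, ← hK0] at hpeel
  have hfam : HR (K 0) (K 1) := HomIn.mk_family K hK (fun t _ x hx => by rw [hKout t x hx, hKout 0 x hx])
  rw [hK1] at hfam
  have hfin : HR β' (st G β) := hfam.symm.trans hpeel
  have hcl : cls β' hβ' = cls (st G β) (st_ball hGb hβ) := cls_eq.2 hfin
  obtain ⟨j, hj⟩ := hopf_even hM hGb hGe
  rw [← cls_mul hGb hβ, hj, hk, hk', ← zpow_add] at hcl
  exact ⟨j, bb_zpow_inj hcl⟩
end Even

end RPX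

namespace RPX
open Metric
open Set
set_option linter.unusedSectionVars false
set_option linter.unusedSimpArgs false
set_option linter.unusedVariables false
set_option linter.style.longLine false

section Face
variable {M : ℕ}

lemma asy_agree {o : Bool} {f g : EE M → SS M} (hf : f ∈ Asy o) (hg : g ∈ Asy o) (hfc : Continuous f) (hgc : Continuous g)
    (h : ∀ x, ‖x‖ ≤ 1 → f x = g x) : HomIn (Asy o) f g := by
  have e : f ∘ clm = g ∘ clm := funext fun x => h _ (norm_clm_le x)
  exact (clm_homIn hf hfc).trans (e ▸ (clm_homIn hg hgc).symm)

/-- first coordinate direction along which balls are pushed -/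
noncomputable def e1 (M : ℕ) : EE M := Pi.single 1 1
lemma norm_e1 : ‖e1 M‖ = 1 := by simp [e1, Pi.norm_single]
lemma e1_one : e1 M 1 = 1 := by simp [e1]
lemma e1_ne {i : Fin (M+2)} (h : i ≠ 1) : e1 M i = 0 := by simp [e1, h]
lemma Rr_e1 : Rr (e1 M) = - e1 M := by
  funext i
  by_cases h : i = 1
  · subst h; simp [Rr, e1]
  · simp [Rr, e1, h]
lemma Rr_one (x : EE M) : Rr x 1 = - x 1 := by simp [Rr]
lemma Rr_of_ne (x : EE M) {i : Fin (M+2)} (h : i ≠ 1) : Rr x i = x i := by simp [Rr, h]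

/-- position of the moving ball -/
noncomputable def pp (t : ℝ) : ℝ := 3/4 + c01 t / 2
lemma pp_mem (t : ℝ) : 3/4 ≤ pp t ∧ pp t ≤ 5/4 := by
  have := c01_nonneg t; have := c01_le_one t; unfold pp; constructor <;> linarith
noncomputable def fA (t : ℝ) (x : EE M) : SS M := c0 ((8:ℝ) • (x - pp t • e1 M))
noncomputable def fB (t : ℝ) (x : EE M) : SS M := c0 ((8:ℝ) • ((2:ℝ) • e1 M - Rr x - pp t • e1 M))
lemma continuous_pp : Continuous pp := by unfold pp; have := continuous_c01; fun_prop
lemma continuous_fA : Continuous (fun q : ℝ × EE M => fA q.1 q.2) := by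
  have := continuous_pp
  exact c0_ball.1.comp (by fun_prop)
lemma continuous_fB : Continuous (fun q : ℝ × EE M => fB q.1 q.2) := by
  have := continuous_pp
  have := continuous_Rr (M := M)
  exact c0_ball.1.comp (by fun_prop)
lemma c0_eight {z : EE M} (i : Fin (M+2)) (h : 1/8 ≤ |z i|) : c0 ((8:ℝ) • z) = y0 M := by
  refine c0_ball.2 _ ?_
  rw [norm_smul]
  have := norm_le_pi_norm z i
  rw [Real.norm_eq_abs] at this
  norm_num
  linarith
lemma fA_one {t : ℝ} {x : EE M} (h : 1/8 ≤ |x 1 - pp t|) : fA t x = y0 M := by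
  refine c0_eight 1 ?_
  simpa [e1_one] using h
lemma fA_ne {t : ℝ} {x : EE M} {i : Fin (M+2)} (hi : i ≠ 1) (h : 1/8 ≤ |x i|) : fA t x = y0 M := by
  refine c0_eight i ?_
  simpa [e1_ne hi] using h
lemma fB_one {t : ℝ} {x : EE M} (h : 1/8 ≤ |2 + x 1 - pp t|) : fB t x = y0 M := by
  refine c0_eight 1 ?_
  simpa [e1_one, Rr_one] using h
lemma fB_ne {t : ℝ} {x : EE M} {i : Fin (M+2)} (hi : i ≠ 1) (h : 1/8 ≤ |x i|) : fB t x = y0 M := by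
  refine c0_eight i ?_
  simpa [e1_ne hi, Rr_of_ne _ hi] using h
lemma fA_low {t : ℝ} {x : EE M} (h : x 1 ≤ 1/2) : fA t x = y0 M :=
  fA_one (by rw [abs_of_nonpos (by linarith [(pp_mem t).1])]; linarith [(pp_mem t).1])
lemma fB_high {t : ℝ} {x : EE M} (h : -1/2 ≤ x 1) : fB t x = y0 M :=
  fB_one (by rw [abs_of_nonneg (by linarith [(pp_mem t).2])]; linarith [(pp_mem t).2])
lemma fB_neg {t : ℝ} {x : EE M} (hx : ‖x‖ = 1) (h0 : 0 ≤ x 1) : fB t (-x) = fA t x := by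
  by_cases h1 : x 1 = 1
  · unfold fB fA
    congr 3
    funext i
    by_cases h : i = 1
    · subst h; simp [Rr_one, e1_one, h1]; norm_num
    · simp [Rr_of_ne _ h, e1_ne h]
  · have : ∃ i, i ≠ 1 ∧ |x i| = 1 := by
      obtain ⟨i, hi⟩ := Finite.exists_max (fun i => |x i|)
      have h2 : ‖x‖ ≤ |x i| := (pi_norm_le_iff_of_nonneg (abs_nonneg _)).2 hi
      have h3 : |x i| ≤ ‖x‖ := norm_le_pi_norm x i
      refine ⟨i, ?_, by linarith⟩
      rintro rfl
      rw [abs_of_nonneg h0] at h2 h3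
      exact h1 (by linarith)
    obtain ⟨i, hi, hxi⟩ := this
    rw [fB_ne hi (by rw [Pi.neg_apply, abs_neg, hxi]; norm_num), fA_ne hi (by rw [hxi]; norm_num)]

variable {α : EE M → SS M}
lemma eight (hα : IsBall (y0 M) α) {x : EE M} (h : 1/8 ≤ ‖x‖) : α ((8:ℝ) • x) = y0 M :=
  hα.2 _ (by rw [norm_smul]; norm_num; linarith)

lemma face_peel (hα : IsBall (y0 M) α) {h : EE M → SS M} (hh : Continuous h) {s : ℝ} (hs : |s| = 3/4)
    (hhp : ∀ x, 1/8 ≤ ‖x - s • e1 M‖ → h x = y0 M) :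
    HR (ov (y0 M) (fun x => α ((8:ℝ) • x)) h) (st (fun x => α ((8:ℝ) • x)) (fun x => h (s • e1 M + (1/8:ℝ) • x))) := by
  have hn : ‖s • e1 M‖ = 3/4 := by rw [norm_smul, norm_e1, mul_one, Real.norm_eq_abs, hs]
  refine peel (γ := fun t => t • v0 M + (1 - t) • s • e1 M) (hα.comp_scale (by norm_num)).1 hh (by norm_num) (by rw [hn]; norm_num) ?_ hhp (by fun_prop) (by simp) (by simp) ?_
  · intro x hx
    refine eight hα ?_
    have := norm_sub_norm_le (s • e1 M) x
    rw [norm_sub_rev] at this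
    linarith
  · intro t ht
    refine eight hα ?_
    rcases le_total t (1/2) with h | h
    · have := norm_le_pi_norm (t • v0 M + (1 - t) • s • e1 M) 1
      have e : (t • v0 M + (1 - t) • s • e1 M) 1 = (1 - t) * s := by simp [v0, e1_one]
      rw [e, Real.norm_eq_abs, abs_mul, hs, abs_of_nonneg (by linarith)] at this
      linarith
    · have := norm_le_pi_norm (t • v0 M + (1 - t) • s • e1 M) 0
      have e : (t • v0 M + (1 - t) • s • e1 M) 0 = t := by simp [v0, e1]
      rw [e, Real.norm_eq_abs, abs_of_nonneg ht.1] at this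
      linarith

/-- the moving family -/
noncomputable def fT (α : EE M → SS M) (t : ℝ) : EE M → SS M := ov (y0 M) (ov (y0 M) (fun x => α ((8:ℝ) • x)) (fA t)) (fB t)
/-- the inner part -/
noncomputable def fI (α : EE M → SS M) (t : ℝ) : EE M → SS M := ov (y0 M) (fun x => α ((8:ℝ) • x)) (fA t)
lemma fI_right {t : ℝ} {x : EE M} (h : fA t x = y0 M) : fI α t x = α ((8:ℝ) • x) := ov_of_right h
lemma fI_left {t : ℝ} {x : EE M} (h : α ((8:ℝ) • x) = y0 M) : fI α t x = fA t x := ov_of_left (g := fun x => α ((8:ℝ) • x)) h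
lemma fT_right {t : ℝ} {x : EE M} (h : fB t x = y0 M) : fT α t x = fI α t x := ov_of_right h
lemma fT_left {t : ℝ} {x : EE M} (h : fI α t x = y0 M) : fT α t x = fB t x := ov_of_left (g := fI α t) h

lemma fI_cont (hα : IsBall (y0 M) α) : Continuous (fun q : ℝ × EE M => fI α q.1 q.2) := by
  have hα8 : IsBall (y0 M) (fun x => α ((8:ℝ) • x)) := hα.comp_scale (by norm_num)
  have : Continuous (ov (y0 M) (fun q : ℝ × EE M => α ((8:ℝ) • q.2)) (fun q : ℝ × EE M => fA q.1 q.2)) := by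
    refine continuous_ov (K := {q | 1/8 ≤ ‖q.2‖}) (L := {q | q.2 1 ≤ 1/2}) (hα8.1.comp continuous_snd) continuous_fA
      (isClosed_le continuous_const (by fun_prop)) (isClosed_le (by fun_prop) continuous_const) ?_ (fun q hq => eight hα hq) (fun q hq => fA_low hq)
    intro q
    rcases le_total (1/8) ‖q.2‖ with h | h
    · exact Or.inl h
    · refine Or.inr ?_
      have := norm_le_pi_norm q.2 1
      rw [Real.norm_eq_abs] at this
      have := le_abs_self (q.2 1)
      show q.2 1 ≤ 1/2
      linarith
  exact this
lemma fI_low (hα : IsBall (y0 M) α) (t : ℝ) (x : EE M) (hx : x 1 ≤ -1/2) : fI α t x = y0 M := by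
  rw [fI_right (fA_low (by linarith))]
  refine eight hα ?_
  have := norm_le_pi_norm x 1
  rw [Real.norm_eq_abs, abs_of_nonpos (by linarith)] at this
  linarith
lemma fT_cont (hα : IsBall (y0 M) α) : Continuous (fun q : ℝ × EE M => fT α q.1 q.2) := by
  have : Continuous (ov (y0 M) (fun q : ℝ × EE M => fI α q.1 q.2) (fun q : ℝ × EE M => fB q.1 q.2)) := by
    refine continuous_ov (K := {q | q.2 1 ≤ -1/2}) (L := {q | -1/2 ≤ q.2 1}) (fI_cont hα) continuous_fB
      (isClosed_le (by fun_prop) continuous_const) (isClosed_le continuous_const (by fun_prop)) (fun q => le_total (q.2 1) (-1/2)) (fun q hq => ?_) (fun q hq => fB_high hq)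
    exact fI_low hα q.1 q.2 hq
  exact this
lemma fT_pos (hα : IsBall (y0 M) α) (t : ℝ) (x : EE M) (hx : ‖x‖ = 1) (h0 : 0 ≤ x 1) : fT α t x = fA t x := by
  rw [fT_right (fB_high (by linarith)), fI_left (eight hα (by rw [hx]; norm_num))]
lemma fT_neg (hα : IsBall (y0 M) α) (t : ℝ) (x : EE M) (hx : ‖x‖ = 1) (h0 : x 1 ≤ 0) : fT α t x = fB t x := by
  rw [fT_left]
  rw [fI_right (fA_low (by linarith))]
  exact eight hα (by rw [hx]; norm_num)
lemma fT_asy (hα : IsBall (y0 M) α) (t : ℝ) : fT α t ∈ Asy (M := M) false := by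
  refine ⟨?_, fun x hx => ?_⟩
  · rw [fT_pos hα t _ norm_v0 (by simp [v0])]
    exact fA_ne (i := 0) (by simp) (by simp [v0]; norm_num)
  · rw [sg_false]
    rcases le_total 0 (x 1) with h | h
    · rw [fT_pos hα t x hx h, fT_neg hα t (-x) (by rwa [norm_neg]) (by simpa using h), fB_neg hx h]
    · rw [fT_neg hα t x hx h, fT_pos hα t (-x) (by rwa [norm_neg]) (by simpa using h), ← fB_neg (by rwa [norm_neg]) (by simpa using h), neg_neg]
lemma pp_zero : pp 0 = 3/4 := by simp [pp]
lemma pp_one : pp 1 = 5/4 := by simp [pp]; norm_num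
lemma cont_fA (t : ℝ) : Continuous (fA t : EE M → SS M) := by
  have h0 := continuous_Rr (M := M)
  have h : Continuous fun x : EE M => (8:ℝ) • (x - pp t • e1 M) := by fun_prop
  exact c0_ball.1.comp h
lemma cont_fB (t : ℝ) : Continuous (fB t : EE M → SS M) := by
  have h0 := continuous_Rr (M := M)
  have h : Continuous fun x : EE M => (8:ℝ) • ((2:ℝ) • e1 M - Rr x - pp t • e1 M) := by fun_prop
  exact c0_ball.1.comp h
lemma fB1_eq (x : EE M) : fB 1 x = c0 ((8:ℝ) • (- Rr (x - (-(3/4):ℝ) • e1 M))) := by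
  unfold fB
  rw [pp_one, sub_eq_add_neg x, Rr_add, ← neg_smul, Rr_smul, Rr_e1]
  congr 2
  module
lemma face0 (hα : IsBall (y0 M) α) : HR (ov (y0 M) (fun x => α ((8:ℝ) • x)) (fA 0)) (st (fun x => α ((8:ℝ) • x)) c0) := by
  have q0 := face_peel hα (cont_fA 0) (s := 3/4) (by rw [abs_of_pos]; norm_num) (fun x hx => by
    unfold fA; rw [pp_zero]; exact eight c0_ball hx)
  have i0 : (fun x : EE M => fA 0 ((3/4:ℝ) • e1 M + (1/8:ℝ) • x)) = c0 := by
    funext x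
    unfold fA
    rw [pp_zero]
    congr 1
    module
  rwa [i0] at q0
lemma face1 (hα : IsBall (y0 M) α) : HR (ov (y0 M) (fun x => α ((8:ℝ) • x)) (fB 1)) (st (fun x => α ((8:ℝ) • x)) (fun x => c0 (Rr (-x)))) := by
  have q1 := face_peel hα (cont_fB 1) (s := -(3/4)) (by rw [abs_neg, abs_of_pos]; norm_num) (fun x hx => by
    rw [fB1_eq]; refine eight c0_ball ?_; rwa [norm_neg, norm_Rr])
  have i1 : (fun x : EE M => fB 1 ((-(3/4):ℝ) • e1 M + (1/8:ℝ) • x)) = fun x => c0 (Rr (-x)) := by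
    funext x
    rw [fB1_eq]
    congr 1
    rw [add_sub_cancel_left, Rr_smul, ← neg_one_smul ℝ x, Rr_smul]
    module
  rwa [i1] at q1
lemma Rrn_ball : IsBall (y0 M) (fun x : EE M => c0 (Rr (-x))) :=
  ⟨c0_ball.1.comp (continuous_Rr.comp continuous_neg), fun x hx => c0_ball.2 _ (by rwa [norm_Rr, norm_neg])⟩
lemma face_push (hα : IsBall (y0 M) α) : HomIn (Asy false) (st (fun x => α ((8:ℝ) • x)) c0)
    (st (fun x => α ((8:ℝ) • x)) (fun x => c0 (Rr (-x)))) := by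
  have hα8 : IsBall (y0 M) (fun x => α ((8:ℝ) • x)) := hα.comp_scale (by norm_num)
  have hfam : HomIn (Asy false) (fT α 0) (fT α 1) := HomIn.mk_family (fT α) (fT_cont hα) (fun t _ => fT_asy hα t)
  have b0 := (face0 hα).symm.asy (ball_asy (st_ball hα8 c0_ball))
  have b1 := (face1 hα).symm.asy (ball_asy (st_ball hα8 Rrn_ball))
  have a0 : HomIn (Asy false) (ov (y0 M) (fun x => α ((8:ℝ) • x)) (fA 0)) (fT α 0) := by
    refine asy_agree b0.right_mem (fT_asy hα 0) b0.right_cont hfam.left_cont (fun x hx => ?_)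
    rw [fT_right]
    · rfl
    refine fB_one ?_
    have h := norm_le_pi_norm x 1
    rw [Real.norm_eq_abs] at h
    have := neg_abs_le (x 1)
    rw [pp_zero, abs_of_nonneg (by linarith)]
    linarith
  have a1 : HomIn (Asy false) (ov (y0 M) (fun x => α ((8:ℝ) • x)) (fB 1)) (fT α 1) := by
    refine asy_agree b1.right_mem (fT_asy hα 1) b1.right_cont hfam.right_cont (fun x hx => ?_)
    have h := norm_le_pi_norm x 1
    rw [Real.norm_eq_abs] at h
    have := le_abs_self (x 1)
    have hz : fA 1 x = y0 M := fA_one (by rw [pp_one, abs_of_nonpos (by linarith)]; linarith)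
    have h3 : fI α 1 x = α ((8:ℝ) • x) := fI_right hz
    by_cases h4 : α ((8:ℝ) • x) = y0 M
    · rw [fT_left (h3.trans h4), ov_of_left (g := fun x => α ((8:ℝ) • x)) h4]
    · have h5 : fB 1 x = y0 M := by
        refine fB_high ?_
        by_contra h6
        push Not at h6
        refine h4 (eight hα ?_)
        have := neg_le_abs (x 1)
        linarith
      rw [fT_right h5, h3, ov_of_right h5]
  exact b0.trans (a0.trans (hfam.trans (a1.symm.trans b1.symm)))

lemma face_step (hM : Even M) (hα : IsBall (y0 M) α) {β β' : EE M → SS M} (hβ : IsBall (y0 M) β) (hβ' : IsBall (y0 M) β')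
    (h : cls β hβ = cls α hα * bb M) (h' : cls β' hβ' = cls α hα * (bb M)⁻¹) : HomIn (Asy false) β β' := by
  have hα8 : IsBall (y0 M) (fun x => α ((8:ℝ) • x)) := hα.comp_scale (by norm_num)
  have e : cls _ hα8 = cls α hα := cls_eq.2 (hα.scale (by norm_num))
  have hRb : IsBall (y0 M) (fun x => c0 (Rr (-x))) := ⟨c0_ball.1.comp (continuous_Rr.comp continuous_neg), fun x hx => c0_ball.2 _ (by rwa [norm_Rr, norm_neg])⟩
  have e2 : cls _ hRb = (bb M)⁻¹ := by
    rw [bb, inv_cls]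
    exact cls_eq.2 (ball_neg hM c0_ball.Rr)
  rw [← e, bb, cls_mul hα8 c0_ball] at h
  rw [← e, ← e2, cls_mul hα8 hRb] at h'
  have k1 := (cls_eq.1 h).asy (ball_asy hβ)
  have k2 := (cls_eq.1 h').symm.asy (ball_asy (st_ball hα8 hRb))
  exact k1.trans ((face_push hα).trans k2)

lemma cls_surj (a : Cls M) : ∃ β hβ, cls β hβ = a := by
  refine cls_ind (P := fun a => ∃ β hβ, cls β hβ = a) (fun f hf => ⟨f, hf, rfl⟩) a

lemma even_nat (hM : Even M) (j : ℕ) : ∀ {β β' : EE M → SS M} (hβ : IsBall (y0 M) β) (hβ' : IsBall (y0 M) β') (k : ℤ),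
    cls β hβ = bb M ^ (k + 2 * j) → cls β' hβ' = bb M ^ k → HomIn (Asy false) β β' := by
  induction j with
  | zero =>
    intro β β' hβ hβ' k h h'
    have e : cls β hβ = cls β' hβ' := by rw [h, h']; simp
    exact (cls_eq.1 e).asy (ball_asy hβ)
  | succ j ih =>
    intro β β' hβ hβ' k h h'
    obtain ⟨γ, hγ, hγc⟩ := cls_surj (bb M ^ (k + 2 * (j:ℤ)))
    obtain ⟨α, hα, hαc⟩ := cls_surj (bb M ^ (k + 2 * (j:ℤ) + 1))
    refine HomIn.trans (face_step hM hα hβ hγ ?_ ?_) (ih hγ hβ' k hγc h')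
    · rw [h, hαc, ← zpow_add_one]; congr 1; push_cast; ring
    · rw [hγc, hαc, ← zpow_sub_one]; congr 1; ring

lemma even_iff (hM : Even M) {β β' : EE M → SS M} (hβ : IsBall (y0 M) β) (hβ' : IsBall (y0 M) β') {k k' : ℤ}
    (hk : cls β hβ = bb M ^ k) (hk' : cls β' hβ' = bb M ^ k') : HomIn (Asy false) β β' ↔ ∃ j, k' = 2 * j + k := by
  constructor
  · intro h; exact even_parity hM hβ hβ' h hk hk'
  · rintro ⟨j, hj⟩
    rcases le_total 0 j with h | h
    · obtain ⟨n, rfl⟩ := Int.eq_ofNat_of_zero_le h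
      exact (even_nat hM n hβ' hβ k (by rw [hk', hj, add_comm]) hk).symm
    · obtain ⟨n, hn⟩ := Int.eq_ofNat_of_zero_le (neg_nonneg.2 h)
      refine even_nat hM n hβ hβ' k' ?_ hk'
      rw [hk]; congr 1; omega
end Face

end RPX

namespace RPX
open Metric
open Set
set_option linter.unusedSectionVars false
set_option linter.unusedSimpArgs false
set_option linter.unusedVariables false
set_option linter.style.longLine false

section Proj
variable {M : ℕ}
open Topology

/-- the projection -/
noncomputable abbrev pr (M : ℕ) : SS M → RP (M + 2) := RP.proj (M + 2)

lemma pr_ng (y : SS M) : pr M (ng y) = pr M y := by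
  symm
  exact Quot.sound (r := fun x y : Sph (M + 2) => y = x ∨ y = Sph.antipode (M + 2) x) (Or.inr rfl)
lemma pr_sg (o : Bool) (y : SS M) : pr M (sg o y) = pr M y := by
  cases o
  · rfl
  · exact pr_ng y
lemma pr_eq {x y : SS M} (h : pr M x = pr M y) : y = x ∨ y = ng x := by
  let S : RP (M + 2) → Set (SS M) := Quot.lift (fun z => {z, ng z}) (by
    rintro a b (rfl | rfl)
    · rfl
    · show ({a, ng a} : Set (SS M)) = {ng a, ng (ng a)}
      rw [ng_ng, Set.pair_comm])
  have h1 : S (pr M x) = S (pr M y) := by rw [h]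
  have h2 : ({x, ng x} : Set (SS M)) = {y, ng y} := h1
  have : y ∈ ({x, ng x} : Set (SS M)) := by rw [h2]; exact Set.mem_insert _ _
  simpa using this
lemma pr_surj : Function.Surjective (pr M) := fun q => Quot.exists_rep q
lemma pr_cont : Continuous (pr M) := (RP.proj (M + 2)).continuous

lemma pr_quot : IsQuotientMap (pr M) := isQuotientMap_quot_mk

/-- the action of the two element group -/
@[reducible] noncomputable def actU : MulAction ℤˣ (SS M) where
  smul u y := if u = 1 then y else ng y
  one_smul y := if_pos rfl
  mul_smul u v y := by
    show (if u * v = 1 then y else ng y) = (if u = 1 then (if v = 1 then y else ng y) else ng (if v = 1 then y else ng y))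
    rcases Int.units_eq_one_or u with rfl | rfl <;> rcases Int.units_eq_one_or v with rfl | rfl <;> simp [ng_ng]

lemma dist_ng (z : SS M) : dist z (ng z) = 2 := by
  rw [Subtype.dist_eq, ng_coe, dist_eq_norm, sub_neg_eq_add, ← two_smul ℝ, norm_smul, norm_SS]; norm_num

lemma cov : IsCoveringMap (pr M) := by
  letI : MulAction ℤˣ (SS M) := actU
  have hs : ∀ (u : ℤˣ) (y : SS M), u • y = if u = 1 then y else ng y := fun _ _ => rfl
  have : IsQuotientCoveringMap (pr M) ℤˣ := by
    refine { toIsQuotientMap := pr_quot, continuous_const_smul := ?_, apply_eq_iff_mem_orbit := ?_, disjoint := ?_ }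
    · intro u
      simp only [hs]
      split_ifs
      · exact continuous_id
      · exact continuous_ng
    · intro a b
      constructor
      · intro h
        rcases pr_eq h.symm with h | h
        · exact ⟨1, by simp [h]⟩
        · refine ⟨-1, ?_⟩
          show (-1 : ℤˣ) • b = a
          rw [hs, if_neg (by decide), h]
      · rintro ⟨u, rfl⟩
        show pr M (u • b) = pr M b
        rw [hs]
        split_ifs
        · rfl
        · exact pr_ng b
    · intro e
      refine ⟨ball e 1, ball_mem_nhds e one_pos, ?_⟩
      rintro u ⟨z, ⟨w, hw, hwz⟩, hz⟩
      by_contra hu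
      have h1 : ng w = z := by
        rw [← hwz]; show ng w = u • w; rw [hs, if_neg hu]
      subst h1
      have := dist_ng w
      have h2 := dist_triangle_right w (ng w) e
      rw [mem_ball] at hw hz
      linarith
  exact this.isCoveringMap

lemma pr_open : IsOpenMap (pr M) := cov.isLocalHomeomorph.isOpenMap

lemma pr_oq : IsOpenQuotientMap (pr M) := ⟨pr_surj, pr_cont, pr_open⟩

lemma isPreconn_sph : IsPreconnected (sphere (0 : EE M) 1) := by
  refine isPreconnected_sphere ?_ 0 1
  rw [rank_fin_fun]
  exact_mod_cast (by omega : 1 < M + 2)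

lemma sg_inj {o o' : Bool} {y : SS M} (h : sg o y = sg o' y) : o = o' := by
  cases o <;> cases o' <;> simp only [sg_true, sg_false] at h ⊢
  · exact absurd h.symm (ng_ne y)
  · exact absurd h (ng_ne y)

lemma lift_ex (fb : RP (M+2) → RP (M+2)) (hc : Continuous fb) (h0 : fb (RP.pt (M+2)) = RP.pt (M+2)) :
    ∃ (o : Bool) (F : SS M → SS M), F ∈ Qsy o ∧ Continuous F ∧ ∀ y, pr M (F y) = fb (pr M y) := by
  let φ : C(EE M, RP (M+2)) := ⟨fun x => fb (pr M (th 1 x)), hc.comp (pr_cont.comp (continuous_th one_ne_zero))⟩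
  obtain ⟨f, ⟨hf0, hf⟩, -⟩ := (cov (M := M)).existsUnique_continuousMap_lifts φ (v0 M) (y0 M) (by
    show pr M (y0 M) = fb (pr M (th 1 (v0 M)))
    rw [th_v0]; exact h0.symm)
  have hf' : ∀ x, pr M (f x) = fb (pr M (th 1 x)) := fun x => congrFun hf x
  have hneg : ∀ x : EE M, ‖x‖ = 1 → pr M (f (-x)) = pr M (f x) := by
    intro x hx; rw [hf', hf', th_neg_out hx.ge, pr_ng]
  obtain ⟨o, ho⟩ : ∃ o, f (-(v0 M)) = sg o (f (v0 M)) := by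
    rcases pr_eq (hneg _ norm_v0).symm with h | h
    · exact ⟨false, h⟩
    · exact ⟨true, h⟩
  have key : EqOn (fun x => f (-x)) (fun x => sg o (f x)) (sphere (0 : EE M) 1) := by
    refine (cov (M := M)).eqOn_of_comp_eqOn isPreconn_sph (f.continuous.comp continuous_neg).continuousOn
      ((continuous_sg o).comp f.continuous).continuousOn ?_ (a := v0 M) (by simp [norm_v0]) ho
    intro x hx
    show pr M (f (-x)) = pr M (sg o (f x))
    rw [pr_sg, hneg x (by simpa using hx)]
  have hA : (f : EE M → SS M) ∈ Asy o := ⟨hf0, fun x hx => key (by simpa using hx)⟩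
  refine ⟨o, tot o f, tot_mem hA, continuous_tot hA f.continuous, fun y => ?_⟩
  rcases le_total 0 (las (y : VV M)) with h | h
  · rw [← th_ivm (s := 1) (by simp) (y := y) (by simpa using h), tot_th, hf', th_clm]
  · rw [← th_ivm (s := -1) (by simp) (y := y) (by simpa using h), tot_thm hA, pr_sg, hf', th_neg one_ne_zero, pr_ng, ← clm_neg, th_clm]

lemma lift_homotopy {fb gb : C(RP (M+2), RP (M+2))} (h : ContinuousMap.HomotopicRel fb gb {RP.pt (M+2)})
    (h0 : fb (RP.pt (M+2)) = RP.pt (M+2))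
    {o o' : Bool} {F G : SS M → SS M} (hF : F ∈ Qsy o) (hG : G ∈ Qsy o') (hFc : Continuous F) (hGc : Continuous G)
    (hFl : ∀ y, pr M (F y) = fb (pr M y)) (hGl : ∀ y, pr M (G y) = gb (pr M y)) : o = o' ∧ HomIn (Qsy o) F G := by
  obtain ⟨H⟩ := h
  let j : ℝ → unitInterval := fun t => ⟨c01 t, c01_mem t⟩
  have hj : Continuous j := continuous_c01.subtype_mk _
  have j0 : j 0 = 0 := Subtype.ext c01_zero
  have j1 : j 1 = 1 := Subtype.ext c01_one
  have hφc : Continuous (fun q : ℝ × EE M => H (j q.1, pr M (th 1 q.2))) :=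
    H.continuous.comp ((hj.comp continuous_fst).prodMk (pr_cont.comp ((continuous_th one_ne_zero).comp continuous_snd)))
  let φ : C(ℝ × EE M, RP (M+2)) := ⟨fun q => H (j q.1, pr M (th 1 q.2)), hφc⟩
  have hpt : ∀ t, H (t, RP.pt (M+2)) = RP.pt (M+2) := fun t => (H.eq_fst t (by simp)).trans h0
  obtain ⟨K, ⟨hK0, hK⟩, -⟩ := (cov (M := M)).existsUnique_continuousMap_lifts φ ((0:ℝ), v0 M) (y0 M) (by
    show pr M (y0 M) = H (j 0, pr M (th 1 (v0 M)))
    rw [th_v0]; exact (hpt _).symm)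
  have hK' : ∀ t x, pr M (K (t, x)) = H (j t, pr M (th 1 x)) := fun t x => congrFun hK (t, x)
  have hKv : ∀ t, K (t, v0 M) = y0 M := by
    intro t
    have := (cov (M := M)).eq_of_comp_eq (g₁ := fun t : ℝ => K (t, v0 M)) (g₂ := fun _ => y0 M)
      (K.continuous.comp (by fun_prop)) continuous_const (by
        funext t
        show pr M (K (t, v0 M)) = pr M (y0 M)
        rw [hK', th_v0]; exact hpt _) 0 hK0
    exact congrFun this t
  have e0 : (fun x => K (0, x)) = F ∘ th 1 := by
    refine (cov (M := M)).eq_of_comp_eq (K.continuous.comp (by fun_prop)) (hFc.comp (continuous_th one_ne_zero)) ?_ (v0 M) ?_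
    · funext x
      show pr M (K (0, x)) = pr M (F (th 1 x))
      rw [hK', hFl, j0, H.apply_zero]
    · show K (0, v0 M) = F (th 1 (v0 M))
      rw [hKv, th_v0, hF.1]
  have e1 : (fun x => K (1, x)) = G ∘ th 1 := by
    refine (cov (M := M)).eq_of_comp_eq (K.continuous.comp (by fun_prop)) (hGc.comp (continuous_th one_ne_zero)) ?_ (v0 M) ?_
    · funext x
      show pr M (K (1, x)) = pr M (G (th 1 x))
      rw [hK', hGl, j1, H.apply_one]
    · show K (1, v0 M) = G (th 1 (v0 M))
      rw [hKv, th_v0, hG.1]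
  have key : EqOn (fun q : ℝ × EE M => K (q.1, -q.2)) (fun q : ℝ × EE M => sg o (K (q.1, q.2))) (univ ×ˢ sphere (0 : EE M) 1) := by
    refine (cov (M := M)).eqOn_of_comp_eqOn (isPreconnected_univ.prod isPreconn_sph) (K.continuous.comp (by fun_prop)).continuousOn
      ((continuous_sg o).comp (K.continuous.comp (by fun_prop))).continuousOn ?_ (a := ((0:ℝ), v0 M)) (by simp [norm_v0]) ?_
    · rintro ⟨t, x⟩ hx
      show pr M (K (t, -x)) = pr M (sg o (K (t, x)))
      have hx' : ‖x‖ = 1 := by simpa using hx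
      rw [pr_sg, hK', hK', th_neg_out hx'.ge, pr_ng]
    · show K (0, -v0 M) = sg o (K (0, v0 M))
      have a1 : K (0, -v0 M) = F (th 1 (-v0 M)) := congrFun e0 (-v0 M)
      rw [a1, hKv, th_neg_out norm_v0.ge, th_v0, hF.2, hF.1]
  have hA : ∀ t, (fun x => K (t, x)) ∈ Asy o := fun t => ⟨hKv t, fun x hx => key (x := (t, x)) ⟨mem_univ _, by simpa using hx⟩⟩
  have hG1 : G ∘ th 1 ∈ Asy o := e1 ▸ hA 1
  have hoo : o = o' := by
    refine sg_inj (y := y0 M) ?_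
    have a1 := hG1.2 (v0 M) norm_v0
    have a2 := (th_mem hG).2 (v0 M) norm_v0
    rw [a1, hG1.1] at a2
    exact a2
  refine ⟨hoo, ?_⟩
  have hh : HomIn (Asy o) (F ∘ th 1) (G ∘ th 1) := by
    rw [← e0, ← e1]
    exact HomIn.mk_family (fun t x => K (t, x)) K.continuous (fun t _ => hA t)
  have := tot_homIn hh
  rwa [tot_of hF, tot_of (hoo ▸ hG)] at this

lemma descend_resp {o : Bool} {F : SS M → SS M} (hF : F ∈ Qsy o) (a b : SS M) (h : b = a ∨ b = Sph.antipode (M+2) a) :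
    pr M (F a) = pr M (F b) := by
  rcases h with rfl | rfl
  · rfl
  · have : F (Sph.antipode (M+2) a) = sg o (F a) := hF.2 a
    rw [this, pr_sg]

lemma descend_ex {o : Bool} {F : SS M → SS M} (hF : F ∈ Qsy o) (hc : Continuous F) :
    ∃ fb : PtdSelfMap (RP (M+2)) (RP.pt (M+2)), ∀ y, pr M (F y) = fb.1 (pr M y) := by
  refine ⟨⟨⟨Quot.lift (fun y => pr M (F y)) (descend_resp hF), ?_⟩, ?_⟩, fun y => rfl⟩
  · exact continuous_quot_lift _ (pr_cont.comp hc)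
  · show pr M (F (y0 M)) = pr M (y0 M)
    rw [hF.1]

lemma descend_homotopy {fb gb : C(RP (M+2), RP (M+2))} {o : Bool} {F G : SS M → SS M} (h : HomIn (Qsy o) F G)
    (hFl : ∀ y, pr M (F y) = fb (pr M y)) (hGl : ∀ y, pr M (G y) = gb (pr M y)) :
    ContinuousMap.HomotopicRel fb gb {RP.pt (M+2)} := by
  obtain ⟨H, h1, h2, h3, h4⟩ := h
  have hH1 : Continuous (fun q : ℝ × SS M => H q.1 q.2) := h1
  let Hb : unitInterval × RP (M+2) → RP (M+2) := fun q => Quot.lift (fun y => pr M (H q.1 y)) (descend_resp (h2 _ q.1.2)) q.2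
  have hHb : ∀ (t : unitInterval) (y : SS M), Hb (t, pr M y) = pr M (H t y) := fun t y => rfl
  have hq : IsOpenQuotientMap (Prod.map (id : unitInterval → unitInterval) (pr M)) := IsOpenQuotientMap.id.prodMap pr_oq
  have hcont : Continuous Hb := by
    rw [hq.isQuotientMap.continuous_iff]
    have h5 : Continuous (fun q : unitInterval × SS M => ((q.1 : ℝ), q.2)) := by fun_prop
    have h6 : Continuous (fun q : unitInterval × SS M => H (q.1 : ℝ) q.2) :=
      Continuous.comp (g := fun q : ℝ × SS M => H q.1 q.2) hH1 h5
    exact pr_cont.comp h6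
  refine ⟨{ toFun := Hb, continuous_toFun := hcont, map_zero_left := ?_, map_one_left := ?_, prop' := ?_ }⟩
  · intro q
    obtain ⟨y, rfl⟩ := pr_surj q
    show Hb (0, pr M y) = fb (pr M y)
    rw [hHb, ← hFl, ← h3]; rfl
  · intro q
    obtain ⟨y, rfl⟩ := pr_surj q
    show Hb (1, pr M y) = gb (pr M y)
    rw [hHb, ← hGl, ← h4]; rfl
  · intro t q hq
    have hq' : q = pr M (y0 M) := hq
    subst hq'
    show Hb (t, pr M (y0 M)) = fb (pr M (y0 M))
    have hF0 : F (y0 M) = y0 M := by rw [← h3]; exact (h2 0 (by simp)).1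
    rw [hHb, ← hFl, (h2 _ t.2).1, hF0]
end Proj

end RPX

namespace RPX
open Metric
open Set
set_option linter.unusedSectionVars false
set_option linter.unusedSimpArgs false
set_option linter.unusedVariables false
set_option linter.style.longLine false

section Inv
variable {M : ℕ}

/-- the integer invariant of a lift -/
def Nv (o : Bool) (F : SS M → SS M) (m : ℤ) : Prop :=
  F ∈ Qsy o ∧ Continuous F ∧ ((o = true ∧ m = dg F) ∨ (o = false ∧ ∃ β hβ, ∃ k : ℤ, HomIn (Qsy false) F (tot false β) ∧ cls β hβ = bb M ^ k ∧ m = 2 * k))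

lemma nv_true {F : SS M → SS M} {m : ℤ} (h : Nv true F m) : F ∈ Qsy true ∧ Continuous F ∧ m = dg F := by
  obtain ⟨h1, h2, ⟨-, h3⟩ | ⟨h3, -⟩⟩ := h
  · exact ⟨h1, h2, h3⟩
  · exact absurd h3 (by decide)

lemma nv_false {F : SS M → SS M} {m : ℤ} (h : Nv false F m) : F ∈ Qsy false ∧ Continuous F ∧
    ∃ β hβ, ∃ k : ℤ, HomIn (Qsy false) F (tot false β) ∧ cls β hβ = bb M ^ k ∧ m = 2 * k := by
  obtain ⟨h1, h2, ⟨h3, -⟩ | ⟨-, h3⟩⟩ := h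
  · exact absurd h3 (by decide)
  · exact ⟨h1, h2, h3⟩

lemma nv_ex {o : Bool} {F : SS M → SS M} (hF : F ∈ Qsy o) (hc : Continuous F) : ∃ m, Nv o F m := by
  cases o
  · obtain ⟨β, hβ, h⟩ := even_std hF hc
    obtain ⟨k, hk⟩ := hopf (cls β hβ)
    exact ⟨2 * k, hF, hc, Or.inr ⟨rfl, β, hβ, k, h, hk, rfl⟩⟩
  · exact ⟨dg F, hF, hc, Or.inl ⟨rfl, rfl⟩⟩

lemma nv_odd (hM : Even M) {F : SS M → SS M} {m : ℤ} (h : Nv true F m) : m % 2 = 1 := by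
  obtain ⟨h1, h2, rfl⟩ := nv_true h
  obtain ⟨β, hβ, hh⟩ := odd_std h1 h2
  obtain ⟨k, hk⟩ := hopf (cls β hβ)
  obtain ⟨d, -, hd⟩ := odd_dg hM
  rw [dg_homIn hh, hd β hβ k hk, mul_assoc]
  omega

lemma nv_even {F : SS M → SS M} {m : ℤ} (h : Nv false F m) : m % 2 = 0 := by
  obtain ⟨h1, h2, β, hβ, k, -, -, rfl⟩ := nv_false h
  omega

lemma tot_ball {β : EE M → SS M} (hβ : IsBall (y0 M) β) : tot false β ∘ th 1 = β := by
  funext x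
  simp only [Function.comp, tot_th]
  exact ball_clm hβ x

lemma nv_iff (hM : Even M) {o : Bool} {F G : SS M → SS M} {m m' : ℤ} (hF : Nv o F m) (hG : Nv o G m') :
    HomIn (Qsy o) F G ↔ MRel m m' := by
  cases o
  · obtain ⟨h1, h2, β, hβ, k, hh, hk, rfl⟩ := nv_false hF
    obtain ⟨h1', h2', β', hβ', k', hh', hk', rfl⟩ := nv_false hG
    have key := even_iff hM hβ hβ' hk hk'
    have e1 : HomIn (Qsy false) F G ↔ HomIn (Asy false) β β' := by
      constructor
      · intro h
        have := th_homIn ((hh.symm.trans h).trans hh')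
        rwa [tot_ball hβ, tot_ball hβ'] at this
      · intro h
        exact (hh.trans (tot_homIn h)).trans hh'.symm
    rw [e1, key]
    constructor
    · rintro ⟨j, rfl⟩
      unfold MRel
      omega
    · intro h
      refine ⟨(k' - k) / 2, ?_⟩
      unfold MRel at h
      omega
  · have ho := nv_odd hM hF
    have hmr : MRel m m' ↔ m = m' := by unfold MRel; omega
    rw [hmr]
    obtain ⟨h1, h2, rfl⟩ := nv_true hF
    obtain ⟨h1', h2', rfl⟩ := nv_true hG
    refine ⟨dg_homIn, fun h => ?_⟩
    obtain ⟨β, hβ, hh⟩ := odd_std h1 h2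
    obtain ⟨k, hk⟩ := hopf (cls β hβ)
    obtain ⟨β', hβ', hh'⟩ := odd_std h1' h2'
    obtain ⟨k', hk'⟩ := hopf (cls β' hβ')
    obtain ⟨d, hdd, hd⟩ := odd_dg hM
    rw [dg_homIn hh, dg_homIn hh', hd β hβ k hk, hd β' hβ' k' hk'] at h
    have hkk : k = k' := by
      have h5 : k * d = k' * d := by linarith [h, mul_assoc 2 k d, mul_assoc 2 k' d]
      have hd0 : d ≠ 0 := by rintro rfl; simp at hdd
      exact mul_right_cancel₀ hd0 h5
    subst hkk
    exact (hh.trans (odd_hr hβ (cls_eq.1 (hk.trans hk'.symm)))).trans hh'.symm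

lemma nv_surj (hM : Even M) (m : ℤ) : ∃ (o : Bool) (F : SS M → SS M), Nv o F m := by
  rcases Int.emod_two_eq_zero_or_one m with h | h
  · obtain ⟨β, hβ, hk⟩ := cls_surj (bb M ^ (m / 2))
    refine ⟨false, tot false β, tot_mem (ball_asy hβ), continuous_tot (ball_asy hβ) hβ.1, Or.inr ⟨rfl, β, hβ, m / 2, ?_, hk, by omega⟩⟩
    exact HomIn.refl (continuous_tot (ball_asy hβ) hβ.1) (tot_mem (ball_asy hβ))
  · obtain ⟨d, hdd, hd⟩ := odd_dg hM
    obtain ⟨β, hβ, hk⟩ := cls_surj (bb M ^ ((m / 2) * d))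
    refine ⟨true, oddT β, oddT_mem hβ, oddT_cont hβ, Or.inl ⟨rfl, ?_⟩⟩
    rw [hd β hβ _ hk]
    have h2 : m = 1 + 2 * (m / 2) := by omega
    linear_combination h2 - 2 * (m / 2) * hdd

lemma qsy_comp {o o' : Bool} {F G : SS M → SS M} (hF : F ∈ Qsy o) (hG : G ∈ Qsy o') : F ∘ G ∈ Qsy (M := M) (o && o') := by
  refine ⟨?_, fun y => ?_⟩
  · show F (G (y0 M)) = y0 M
    rw [hG.1, hF.1]
  · show F (G (ng y)) = sg (o && o') (F (G y))
    rw [hG.2]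
    cases o' <;> cases o
    · rfl
    · rfl
    · exact hF.2 _
    · exact hF.2 _

lemma comp_even {o : Bool} {F G : SS M → SS M} (hF : F ∈ Qsy o) (hFc : Continuous F) {m' : ℤ} (hG : Nv false G m') :
    Nv false (F ∘ G) (dg F * m') := by
  obtain ⟨h1, h2, β, hβ, k, hh, hk, rfl⟩ := nv_false hG
  have hq : ∀ K ∈ Qsy (M := M) false, F ∘ K ∈ Qsy (M := M) false := fun K hK => by
    have := qsy_comp hF hK; rwa [Bool.and_false] at this
  refine ⟨hq G h1, hFc.comp h2, Or.inr ⟨rfl, F ∘ β, hβ.postc hFc hF.1, dg F * k, ?_, dg_cls hFc hF.1 hk, by ring⟩⟩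
  have h3 := hh.post hFc hq
  have e : F ∘ tot false β = tot false (F ∘ β) := by
    have := tot_of (hq _ (tot_mem (ball_asy hβ)))
    rw [Function.comp_assoc, tot_ball hβ] at this
    exact this.symm
  rwa [e] at h3

lemma comp_eo (hM : Even M) {F G : SS M → SS M} (hF : F ∈ Qsy false) (hFc : Continuous F) (hG : G ∈ Qsy true) (hGc : Continuous G) :
    HomIn (Qsy false) (F ∘ G) F := by
  obtain ⟨β, hβ, hh⟩ := odd_std hG hGc
  have hq : ∀ K ∈ Qsy (M := M) true, F ∘ K ∈ Qsy (M := M) false := fun K hK => qsy_comp hF hK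
  refine (hh.post hFc hq).trans ?_
  have e1 : oddT β ∘ th 1 = st (th 1) β := by
    funext x
    show tot true (st (th 1) β) (th 1 x) = st (th 1) β x
    rw [tot_th]; exact st_th_clm hβ x
  have e2 : (F ∘ oddT β) ∘ th 1 = st (F ∘ th 1) (F ∘ β) := by
    rw [Function.comp_assoc, e1]
    exact post_star th_v0 hβ hF.1
  have hb : IsBall (y0 M) (F ∘ β) := hβ.postc hFc hF.1
  have hnull : HR (F ∘ β) (fun _ => y0 M) := by
    obtain ⟨k, hk⟩ := hopf (cls β hβ)
    have := dg_cls hFc hF.1 hk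
    rw [even_dg hM hF hFc, zero_mul, zpow_zero, cls_one] at this
    exact cls_eq.1 this
  have hFt : Continuous (F ∘ th 1) := hFc.comp (continuous_th one_ne_zero)
  have hF0 : (F ∘ th 1) (v0 M) = y0 M := (th_mem hF).1
  have hr : HR (st (F ∘ th 1) (F ∘ β)) (F ∘ th 1) :=
    (star_HR norm_v0 (HR.refl hFt) hF0 hnull hb).trans (star_const hFt)
  have h3 := tot_homIn (hr.asy (o := false) (st_asy (th_mem hF) hb))
  rw [← e2, tot_of (hq _ (oddT_mem hβ)), tot_of hF] at h3
  exact h3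

lemma nv_comp (hM : Even M) {o o' : Bool} {F G : SS M → SS M} {m m' : ℤ} (hF : Nv o F m) (hG : Nv o' G m') :
    ∃ m'', Nv (o && o') (F ∘ G) m'' ∧ MRel m'' (m * m') := by
  cases o'
  · refine ⟨dg F * m', by rw [Bool.and_false]; exact comp_even hF.1 hF.2.1 hG, ?_⟩
    cases o
    · have h1 := nv_even hF
      have h2 := nv_even hG
      rw [even_dg hM hF.1 hF.2.1, zero_mul]
      obtain ⟨a, rfl⟩ : ∃ a, m = 2 * a := ⟨m / 2, by omega⟩
      obtain ⟨b, rfl⟩ : ∃ b, m' = 2 * b := ⟨m' / 2, by omega⟩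
      have : 2 * a * (2 * b) = 4 * (a * b) := by ring
      rw [this]; unfold MRel; omega
    · rw [(nv_true hF).2.2]; exact Or.inl rfl
  · cases o
    · refine ⟨m, ?_, ?_⟩
      · obtain ⟨h1, h2, β, hβ, k, hh, hk, hm⟩ := nv_false hF
        have h3 := comp_eo hM h1 h2 hG.1 hG.2.1
        exact ⟨h3.left_mem, h3.left_cont, Or.inr ⟨rfl, β, hβ, k, h3.trans hh, hk, hm⟩⟩
      · have h1 := nv_even hF
        have h2 := nv_odd hM hG
        obtain ⟨a, rfl⟩ : ∃ a, m = 2 * a := ⟨m / 2, by omega⟩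
        obtain ⟨b, rfl⟩ : ∃ b, m' = 2 * b + 1 := ⟨m' / 2, by omega⟩
        have : 2 * a * (2 * b + 1) = 4 * (a * b) + 2 * a := by ring
        rw [this]; unfold MRel; omega
    · obtain ⟨h1, h2, rfl⟩ := nv_true hF
      obtain ⟨h1', h2', rfl⟩ := nv_true hG
      exact ⟨dg F * dg G, ⟨qsy_comp h1 h1', h2.comp h2', Or.inl ⟨rfl, (dg_comp h2 h1.1 h2' h1'.1).symm⟩⟩, Or.inl rfl⟩

/-- a map of projective space is represented by an integer -/
def Rl (f : PtdSelfMap (RP (M + 2)) (RP.pt (M + 2))) (m : ℤ) : Prop :=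
  ∃ (o : Bool) (F : SS M → SS M), Nv o F m ∧ ∀ y, pr M (F y) = f.1 (pr M y)

lemma rl_ex (f : PtdSelfMap (RP (M + 2)) (RP.pt (M + 2))) : ∃ m, Rl f m := by
  obtain ⟨o, F, h1, h2, h3⟩ := lift_ex f.1 f.1.continuous f.2
  obtain ⟨m, hm⟩ := nv_ex h1 h2
  exact ⟨m, o, F, hm, h3⟩

lemma rl_iff (hM : Even M) {f g : PtdSelfMap (RP (M + 2)) (RP.pt (M + 2))} {m m' : ℤ} (hf : Rl f m) (hg : Rl g m') :
    ContinuousMap.HomotopicRel f.1 g.1 {RP.pt (M + 2)} ↔ MRel m m' := by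
  obtain ⟨o, F, hF, hFl⟩ := hf
  obtain ⟨o', G, hG, hGl⟩ := hg
  constructor
  · intro h
    obtain ⟨rfl, h2⟩ := lift_homotopy h f.2 hF.1 hG.1 hF.2.1 hG.2.1 hFl hGl
    exact (nv_iff hM hF hG).1 h2
  · intro h
    have hoo : o = o' := by
      unfold MRel at h
      cases o <;> cases o'
      · rfl
      · have h1 := nv_even hF
        have h2 := nv_odd hM hG
        omega
      · have h1 := nv_odd hM hF
        have h2 := nv_even hG
        omega
      · rfl
    subst hoo
    exact descend_homotopy ((nv_iff hM hF hG).2 h) hFl hGl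

lemma rl_surj (hM : Even M) (m : ℤ) : ∃ f : PtdSelfMap (RP (M + 2)) (RP.pt (M + 2)), Rl f m := by
  obtain ⟨o, F, hF⟩ := nv_surj hM m
  obtain ⟨f, hf⟩ := descend_ex hF.1 hF.2.1
  exact ⟨f, o, F, hF, hf⟩

lemma rl_comp (hM : Even M) {f g : PtdSelfMap (RP (M + 2)) (RP.pt (M + 2))} {m m' : ℤ} (hf : Rl f m) (hg : Rl g m') :
    ∃ m'', Rl (f.comp g) m'' ∧ MRel m'' (m * m') := by
  obtain ⟨o, F, hF, hFl⟩ := hf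
  obtain ⟨o', G, hG, hGl⟩ := hg
  obtain ⟨m'', h1, h2⟩ := nv_comp hM hF hG
  refine ⟨m'', ⟨_, _, h1, fun y => ?_⟩, h2⟩
  show pr M (F (G y)) = f.1 (g.1 (pr M y))
  rw [hFl, hGl]

lemma rl_id : Rl (PtdSelfMap.id (RP (M + 2)) (RP.pt (M + 2))) 1 :=
  ⟨true, id, ⟨⟨rfl, fun y => rfl⟩, continuous_id, Or.inl ⟨rfl, dg_id.symm⟩⟩, fun y => rfl⟩

lemma mrel_equiv : Equivalence MRel := by
  refine ⟨fun x => Or.inl rfl, fun {x y} h => ?_, fun {x y z} h h' => ?_⟩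
  · unfold MRel at *; omega
  · unfold MRel at *; omega

lemma mk_iff {x y : ℤ} : MQuot.mk x = MQuot.mk y ↔ MRel x y := by
  constructor
  · intro h
    have := Quot.eqvGen_exact h
    rwa [mrel_equiv.eqvGen_iff] at this
  · exact fun h => Quot.sound h

/-- the value -/
noncomputable def val (f : PtdSelfMap (RP (M + 2)) (RP.pt (M + 2))) : ℤ := (rl_ex f).choose
lemma val_rl (f : PtdSelfMap (RP (M + 2)) (RP.pt (M + 2))) : Rl f (val f) := (rl_ex f).choose_spec

theorem main_aux (hM : Even M) (mul : MQuot → MQuot → MQuot)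
    (hmul : ∀ x y : ℤ, mul (MQuot.mk x) (MQuot.mk y) = MQuot.mk (x * y)) :
    ∃ e : PtdSelfMapClass (RP (M + 2)) (RP.pt (M + 2)) ≃ MQuot,
      (∀ f g : PtdSelfMap (RP (M + 2)) (RP.pt (M + 2)),
        e (PtdSelfMapClass.mk (f.comp g)) =
          mul (e (PtdSelfMapClass.mk f)) (e (PtdSelfMapClass.mk g))) ∧
      e (PtdSelfMapClass.mk (PtdSelfMap.id (RP (M + 2)) (RP.pt (M + 2)))) = MQuot.mk 1 := by
  let φ : PtdSelfMapClass (RP (M + 2)) (RP.pt (M + 2)) → MQuot :=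
    Quot.lift (fun f => MQuot.mk (val f)) (fun f g h => mk_iff.2 ((rl_iff hM (val_rl f) (val_rl g)).1 h))
  have hφ : ∀ f m, Rl f m → φ (PtdSelfMapClass.mk f) = MQuot.mk m := fun f m h =>
    mk_iff.2 ((rl_iff hM (val_rl f) h).1 (ContinuousMap.HomotopicRel.refl f.1))
  have hbij : Function.Bijective φ := by
    constructor
    · rintro ⟨f⟩ ⟨g⟩ h
      exact Quot.sound ((rl_iff hM (val_rl f) (val_rl g)).2 (mk_iff.1 h))
    · rintro ⟨m⟩
      obtain ⟨f, hf⟩ := rl_surj hM m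
      exact ⟨PtdSelfMapClass.mk f, hφ f m hf⟩
  refine ⟨Equiv.ofBijective φ hbij, fun f g => ?_, hφ _ _ rl_id⟩
  simp only [Equiv.ofBijective_apply]
  obtain ⟨m'', h1, h2⟩ := rl_comp hM (val_rl f) (val_rl g)
  rw [hφ _ _ h1, hφ _ _ (val_rl f), hφ _ _ (val_rl g), hmul]
  exact mk_iff.2 h2
end Inv

end RPX

theorem selfMaps_RP_even_iso (n : ℕ) (hn : 1 ≤ n)
    (mul : MQuot → MQuot → MQuot)
    (hmul : ∀ x y : ℤ, mul (MQuot.mk x) (MQuot.mk y) = MQuot.mk (x * y)) :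
    ∃ e : PtdSelfMapClass (RP (2 * n)) (RP.pt (2 * n)) ≃ MQuot,
      (∀ f g : PtdSelfMap (RP (2 * n)) (RP.pt (2 * n)),
        e (PtdSelfMapClass.mk (f.comp g)) =
          mul (e (PtdSelfMapClass.mk f)) (e (PtdSelfMapClass.mk g))) ∧
      e (PtdSelfMapClass.mk (PtdSelfMap.id (RP (2 * n)) (RP.pt (2 * n)))) = MQuot.mk 1 ∧
      (∀ f g : PtdSelfMap (RP (2 * n)) (RP.pt (2 * n)),
        PtdSelfMapClass.mk (f.comp g) = PtdSelfMapClass.mk (g.comp f)) ∧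
      Countable (PtdSelfMapClass (RP (2 * n)) (RP.pt (2 * n))) ∧
      Infinite (PtdSelfMapClass (RP (2 * n)) (RP.pt (2 * n))) ∧
      MQuot.mk 0 ≠ MQuot.mk 2 ∧
      (∀ x : ℤ, x % 2 = 0 → MQuot.mk x = MQuot.mk 0 ∨ MQuot.mk x = MQuot.mk 2) := by
  obtain ⟨m, rfl⟩ : ∃ m, n = m + 1 := ⟨n - 1, by omega⟩
  obtain ⟨e, h1, h2⟩ := RPX.main_aux (M := 2 * m) (even_two_mul m) mul hmul
  have hcomm : ∀ a b : MQuot, mul a b = mul b a := by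
    rintro ⟨a⟩ ⟨b⟩
    exact (hmul a b).trans ((congrArg MQuot.mk (mul_comm a b)).trans (hmul b a).symm)
  have hcq : Countable MQuot := (inferInstance : Countable (Quot MRel))
  have hiq : Infinite MQuot := by
    refine Infinite.of_injective (fun k : ℕ => MQuot.mk (2 * k + 1)) (fun a b h => ?_)
    have := RPX.mk_iff.1 h
    unfold MRel at this
    omega
  refine ⟨e, h1, h2, fun f g => e.injective ?_, ?_, ?_, ?_, ?_⟩
  · exact (h1 f g).trans ((hcomm _ _).trans (h1 g f).symm)
  · exact e.injective.countable
  · exact Infinite.of_injective e.symm e.symm.injective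
  · intro h
    have := RPX.mk_iff.1 h
    unfold MRel at this
    omega
  · intro x hx
    rw [RPX.mk_iff, RPX.mk_iff]
    unfold MRel
    omega
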